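/- arXiv:2005.12107 — 4 statements merged into one kernel-verified Lean document; each statement's English description precedes it below -/
import Mathlib

section
/- Let θ ∈ ℝ and let G be a finite simple graph. Let D be the set of θ-essential vertices of G and let A = ∂D be the set of vertices not in D that have a neighbor in D. Then mult(θ,G) equals the number of connected components of the induced subgraph G[D] minus |A|. -/
open Polynomial

/-- The matching polynomial of a finite simple graph `G`:
`μ(G,z) = ∑_k (-1)^k p(k,G) z^(n-2k)`, written as a sum over all matchings
(finsets of pairwise disjoint edges). -/
noncomputable def matchingPolynomial {V : Type*} [Finite V] (G : SimpleGraph V) :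
    Polynomial ℝ := by
  classical
  have : Fintype V := Fintype.ofFinite V
  exact ∑ M ∈ Finset.univ.filter
      (fun M : Finset (Sym2 V) =>
        (∀ e ∈ M, e ∈ G.edgeSet) ∧ ∀ e ∈ M, ∀ f ∈ M, e ≠ f → ∀ v, v ∈ e → v ∉ f),
    (-1 : Polynomial ℝ) ^ M.card * X ^ (Nat.card V - 2 * M.card)

/-- `matchMult θ G` is the multiplicity of `θ` as a root of the matching polynomial
of `G` (equal to `0` if `θ` is not a root). -/
noncomputable def matchMult {V : Type*} [Finite V] (θ : ℝ) (G : SimpleGraph V) : ℕ :=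
  Polynomial.rootMultiplicity θ (matchingPolynomial G)

/-- A vertex `u` is `θ`-essential if `mult(θ, G-u) = mult(θ, G) - 1`. -/
def IsEssential {V : Type*} [Finite V] (θ : ℝ) (G : SimpleGraph V) (u : V) : Prop :=
  matchMult θ (G.induce {v | v ≠ u}) + 1 = matchMult θ G

/-- A vertex `u` is `θ`-positive if `mult(θ, G-u) = mult(θ, G) + 1`. -/
def IsPositive {V : Type*} [Finite V] (θ : ℝ) (G : SimpleGraph V) (u : V) : Prop :=
  matchMult θ (G.induce {v | v ≠ u}) = matchMult θ G + 1

/-- A vertex `u` is `θ`-neutral if `mult(θ, G-u) = mult(θ, G)`. -/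
def IsNeutral {V : Type*} [Finite V] (θ : ℝ) (G : SimpleGraph V) (u : V) : Prop :=
  matchMult θ (G.induce {v | v ≠ u}) = matchMult θ G

/-- A vertex is `θ`-special if it is not `θ`-essential but has a `θ`-essential neighbor. -/
def IsSpecial {V : Type*} [Finite V] (θ : ℝ) (G : SimpleGraph V) (u : V) : Prop :=
  ¬ IsEssential θ G u ∧ ∃ w, G.Adj u w ∧ IsEssential θ G w

/-- The outer vertex boundary `∂S`: vertices not in `S` with a neighbor in `S`. -/
def vertexBoundary {V : Type*} (G : SimpleGraph V) (S : Set V) : Set V :=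
  {v | v ∉ S ∧ ∃ w ∈ S, G.Adj v w}


section GE
open Classical

/-- vertex-deletion recurrence -/
def GERec {V R : Type*} [CommRing R] (G : SimpleGraph V) (x : V → R) (f : Finset V → R) : Prop :=
  ∀ S u, u ∈ S → f S = x u * f (S.erase u) -
    ∑ w ∈ (S.erase u).filter (G.Adj u), f ((S.erase u).erase w)

theorem ge_nonneg {V : Type*} {G : SimpleGraph V} {x : V → ℝ} {f : Finset V → ℝ}
    (h : GERec G x f) : ∀ (n : ℕ) (S : Finset V), S.card = n → ∀ u v, u ∈ S → v ∈ S → u ≠ v →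
    (if G.Adj u v then f ((S.erase u).erase v) ^ 2 else 0) ≤
      f (S.erase u) * f (S.erase v) - f S * f ((S.erase u).erase v) := by
  intro n
  induction n with
  | zero => intro S hS u v hu; simp_all
  | succ n ih =>
    intro S hS u v hu hv huv
    have e1 := h S u hu
    have e2 := h (S.erase v) u (by simp [hu, huv])
    have key : f (S.erase u) * f (S.erase v) - f S * f ((S.erase u).erase v) =
        (if G.Adj u v then f ((S.erase u).erase v) ^ 2 else 0) +
        ∑ w ∈ ((S.erase u).erase v).filter (G.Adj u),
          (f ((S.erase u).erase w) * f ((S.erase u).erase v) -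
            f (S.erase u) * f (((S.erase u).erase w).erase v)) := by
      have e3 : ∑ w ∈ (S.erase u).filter (G.Adj u), f ((S.erase u).erase w) =
          (if G.Adj u v then f ((S.erase u).erase v) else 0) +
          ∑ w ∈ ((S.erase u).erase v).filter (G.Adj u), f ((S.erase u).erase w) := by
        rw [Finset.sum_filter, Finset.sum_filter,
          ← Finset.add_sum_erase (S.erase u) _ (show v ∈ S.erase u by simp [hv, huv.symm])]
      rw [e1, e2, e3, Finset.erase_right_comm (a := v) (b := u), Finset.sum_sub_distrib,
        ← Finset.sum_mul, ← Finset.mul_sum]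
      have e4 : ∀ w, ((S.erase u).erase v).erase w = ((S.erase u).erase w).erase v :=
        fun w => Finset.erase_right_comm
      simp only [e4]
      split_ifs <;> ring
    rw [key]
    have : 0 ≤ ∑ w ∈ ((S.erase u).erase v).filter (G.Adj u),
          (f ((S.erase u).erase w) * f ((S.erase u).erase v) -
            f (S.erase u) * f (((S.erase u).erase w).erase v)) := by
      apply Finset.sum_nonneg
      intro w hw
      simp only [Finset.mem_filter, Finset.mem_erase] at hw
      have := ih (S.erase u) (by rw [Finset.card_erase_of_mem hu]; omega) w v
        (by simp [hw]) (by simp [hv, huv.symm]) hw.1.1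
      refine le_trans ?_ this
      split_ifs <;> positivity
    linarith

theorem ge_shift {V : Type*} {G : SimpleGraph V} {x : V → ℝ} {f : Finset V → ℝ}
    (h : GERec G x f) (v : V) (t : ℝ) :
    GERec G (fun u => if u = v then x u + t else x u)
      (fun S => if v ∈ S then f S + t * f (S.erase v) else f S) := by
  intro S u hu
  by_cases huv : u = v
  · subst huv
    have := h S u hu
    simp only [hu, if_true, Finset.mem_erase, ne_eq, not_true, false_and, and_false, if_false]
    rw [this]; ring
  · by_cases hv : v ∈ S
    · have e1 := h S u hu
      have e2 := h (S.erase v) u (by simp [hu, huv])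
      have hvu : ¬ v = u := fun e => huv e.symm
      simp only [hv, huv, hvu, if_true, if_false, Finset.mem_erase, ne_eq, not_false_eq_true,
        and_true, true_and]
      have hv' : v ∈ S.erase u := by simp [hv, hvu]
      rw [e1, e2, Finset.sum_filter, Finset.sum_filter, Finset.sum_filter,
        ← Finset.add_sum_erase (S.erase u) _ hv', ← Finset.add_sum_erase (S.erase u) _ hv',
        Finset.erase_right_comm (a := v) (b := u)]
      have e5 : ∑ w ∈ (S.erase u).erase v, (if G.Adj u w then
          (if ¬ v = w then f ((S.erase u).erase w) + t * f (((S.erase u).erase w).erase v)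
            else f ((S.erase u).erase w)) else 0) =
          ∑ w ∈ (S.erase u).erase v, (if G.Adj u w then f ((S.erase u).erase w) else 0) +
          t * ∑ w ∈ (S.erase u).erase v,
            (if G.Adj u w then f (((S.erase u).erase v).erase w) else 0) := by
        rw [Finset.mul_sum, ← Finset.sum_add_distrib]
        apply Finset.sum_congr rfl
        intro w hw
        have : ¬ v = w := fun e => by simp [e] at hw
        rw [Finset.erase_right_comm (a := v) (b := w)]
        split_ifs <;> simp
      rw [e5]
      simp only [not_true, if_false]
      split_ifs <;> ring
    · have e1 := h S u hu
      simp only [hv, huv, if_false, Finset.mem_erase, and_false]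
      exact e1

/-- discriminant inequality -/
theorem ge_disc {V : Type*} {G : SimpleGraph V} {x : V → ℝ} {f : Finset V → ℝ}
    (h : GERec G x f) (S : Finset V) (u v w : V) (hu : u ∈ S) (hv : v ∈ S) (hw : w ∈ S)
    (huv : u ≠ v) (huw : u ≠ w) (hvw : v ≠ w) :
    (f ((S.erase u).erase v) * f (S.erase w) + f (S.erase u) * f ((S.erase w).erase v)
      - f (S.erase v) * f ((S.erase u).erase w) - f S * f (((S.erase u).erase w).erase v)) ^ 2 ≤
    4 * (f (S.erase u) * f (S.erase w) - f S * f ((S.erase u).erase w)) *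
     (f ((S.erase u).erase v) * f ((S.erase w).erase v) -
        f (S.erase v) * f (((S.erase u).erase w).erase v)) := by
  have := discrim_le_zero (K := ℝ)
    (a := (f ((S.erase u).erase v) * f ((S.erase w).erase v) -
        f (S.erase v) * f (((S.erase u).erase w).erase v)))
    (b := (f ((S.erase u).erase v) * f (S.erase w) + f (S.erase u) * f ((S.erase w).erase v)
      - f (S.erase v) * f ((S.erase u).erase w) - f S * f (((S.erase u).erase w).erase v)))
    (c := (f (S.erase u) * f (S.erase w) - f S * f ((S.erase u).erase w))) (by
      intro t
      have := ge_nonneg (ge_shift h v t) _ S rfl u w hu hw huw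
      simp only [hv, huv.symm, hvw, if_true, Finset.mem_erase, ne_eq, not_false_eq_true,
        and_true] at this
      have h0 : ∀ (p : Prop) [Decidable p] (y : ℝ), 0 ≤ if p then y ^ 2 else 0 := by
        intro p _ y; split_ifs <;> positivity
      have := (h0 _ _).trans this
      nlinarith [this])
  unfold discrim at this
  linarith

/-! polynomial order lemmas -/

theorem ge_dom {θ : ℝ} {p q : ℝ[X]} (h : ∀ z, |p.eval z| ≤ |q.eval z|) :
    ∀ n : ℕ, (X - C θ) ^ n ∣ q → (X - C θ) ^ n ∣ p := by
  intro n
  induction n with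
  | zero => simp
  | succ n ih =>
    rintro ⟨q1, hq⟩
    obtain ⟨p1, hp⟩ := ih ⟨(X - C θ) * q1, by rw [hq]; ring⟩
    have h1 : ∀ z, |p1.eval z| ≤ |z - θ| * |q1.eval z| := by
      have hcl : IsClosed {z : ℝ | |p1.eval z| ≤ |z - θ| * |q1.eval z|} :=
        isClosed_le (by fun_prop) (by fun_prop)
      have hd : Dense ({θ}ᶜ : Set ℝ) := dense_compl_singleton θ
      have hsub : ({θ}ᶜ : Set ℝ) ⊆ {z : ℝ | |p1.eval z| ≤ |z - θ| * |q1.eval z|} := by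
        intro z hz
        have hz : z - θ ≠ 0 := sub_ne_zero.mpr hz
        have := h z
        rw [hp, hq] at this
        simp only [eval_mul, eval_pow, eval_sub, eval_X, eval_C, abs_mul, abs_pow, pow_succ] at this
        have hpos : 0 < |z - θ| ^ n := by positivity
        rw [mul_assoc] at this
        exact le_of_mul_le_mul_left this hpos
      intro z
      have := hcl.closure_subset_iff.mpr hsub
      exact this (hd z)
    have h2 := h1 θ
    simp only [sub_self, abs_zero, zero_mul] at h2
    have h3 : p1.IsRoot θ := abs_nonpos_iff.mp h2
    obtain ⟨r, hr⟩ := dvd_iff_isRoot.mpr h3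
    exact ⟨r, by rw [hp, hr]; ring⟩

theorem ge_even {θ : ℝ} {p : ℝ[X]} (h : ∀ z, 0 ≤ p.eval z) (n : ℕ)
    (hd : (X - C θ) ^ (2 * n + 1) ∣ p) : (X - C θ) ^ (2 * n + 2) ∣ p := by
  obtain ⟨r, hr⟩ := hd
  have h1 : ∀ z, z ≠ θ → 0 ≤ (z - θ) * r.eval z := by
    intro z hz
    have hz : z - θ ≠ 0 := sub_ne_zero.mpr hz
    have := h z
    rw [hr] at this
    simp only [eval_mul, eval_pow, eval_sub, eval_X, eval_C] at this
    have hpos : 0 < (z - θ) ^ (2 * n) := by rw [pow_mul]; positivity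
    rw [pow_succ, mul_assoc] at this
    exact nonneg_of_mul_nonneg_right this hpos
  have h2 : r.eval θ = 0 := by
    have hc : Continuous (fun z => r.eval z) := by fun_prop
    apply le_antisymm
    · have hcl : IsClosed {z : ℝ | r.eval z ≤ 0} := isClosed_le (by fun_prop) (by fun_prop)
      have hsub : Set.Iio θ ⊆ {z : ℝ | r.eval z ≤ 0} := by
        intro z hz
        have hz : z < θ := hz
        have := h1 z hz.ne
        show r.eval z ≤ 0
        by_contra hh
        push Not at hh
        nlinarith
      have := hcl.closure_subset_iff.mpr hsub
      rw [closure_Iio] at this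
      exact this (Set.mem_Iic.mpr le_rfl)
    · have hcl : IsClosed {z : ℝ | 0 ≤ r.eval z} := isClosed_le (by fun_prop) (by fun_prop)
      have hsub : Set.Ioi θ ⊆ {z : ℝ | 0 ≤ r.eval z} := by
        intro z hz
        have hz : θ < z := hz
        have := h1 z hz.ne'
        show 0 ≤ r.eval z
        by_contra hh
        push Not at hh
        nlinarith
      have := hcl.closure_subset_iff.mpr hsub
      rw [closure_Ioi] at this
      exact this (Set.mem_Ici.mpr le_rfl)
  obtain ⟨s, hs⟩ := dvd_iff_isRoot.mpr h2
  exact ⟨s, by rw [hr, hs]; ring⟩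

/-! abstract systems -/

structure GESys {V : Type*} (G : SimpleGraph V) (F : Finset V → ℝ[X]) : Prop where
  rec' : GERec G (fun _ => X) F
  empty' : F ∅ = 1

section
variable {V : Type*} {G : SimpleGraph V} {F : Finset V → ℝ[X]}

theorem GESys.evalRec (h : GESys G F) (z : ℝ) :
    GERec G (fun _ => z) (fun S => (F S).eval z) := by
  intro S u hu
  simp only
  rw [h.rec' S u hu]
  simp [eval_finset_sum]

theorem GESys.monic (h : GESys G F) : ∀ (n : ℕ) (S : Finset V), S.card = n →
    (F S).natDegree ≤ n ∧ (F S).coeff n = 1 := by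
  intro n
  induction n using Nat.strong_induction_on with
  | _ n ih =>
    intro S hS
    rcases S.eq_empty_or_nonempty with rfl | ⟨u, hu⟩
    · simp at hS
      subst hS
      simp [h.empty']
    · have hc : (S.erase u).card = n - 1 := by rw [Finset.card_erase_of_mem hu, hS]
      have hpos : 0 < n := by rw [← hS]; exact Finset.card_pos.mpr ⟨u, hu⟩
      obtain ⟨i1, i2⟩ := ih (n - 1) (by omega) (S.erase u) hc
      have i3 : ∀ w ∈ (S.erase u).filter (G.Adj u),
          (F ((S.erase u).erase w)).natDegree ≤ n - 1 ∧
          (F ((S.erase u).erase w)).coeff n = 0 := by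
        intro w hw
        have hw := (Finset.mem_filter.mp hw).1
        have hcw : ((S.erase u).erase w).card = n - 1 - 1 := by
          rw [Finset.card_erase_of_mem hw, hc]
        have := (ih (n - 1 - 1) (by omega) _ hcw).1
        exact ⟨by omega, coeff_eq_zero_of_natDegree_lt (by omega)⟩
      rw [h.rec' S u hu]
      constructor
      · refine (natDegree_sub_le _ _).trans (max_le ?_ ?_)
        · refine natDegree_mul_le.trans ?_
          rw [natDegree_X]; omega
        · exact natDegree_sum_le_of_forall_le _ _ (fun w hw => (i3 w hw).1.trans (by omega))
      · obtain ⟨j, rfl⟩ : ∃ j, n = j + 1 := ⟨n - 1, by omega⟩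
        rw [coeff_sub, coeff_X_mul, finset_sum_coeff,
          Finset.sum_eq_zero (fun w hw => (i3 w hw).2)]
        simpa using i2

theorem GESys.ne_zero (h : GESys G F) (S : Finset V) : F S ≠ 0 := by
  intro h0
  have := (h.monic _ S rfl).2
  simp [h0] at this

theorem GESys.deriv (h : GESys G F) : ∀ (n : ℕ) (S : Finset V), S.card = n →
    derivative (F S) = ∑ v ∈ S, F (S.erase v) := by
  intro n
  induction n using Nat.strong_induction_on with
  | _ n ih =>
    intro S hS
    rcases S.eq_empty_or_nonempty with rfl | ⟨u, hu⟩
    · simp [h.empty']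
    · have hpos : 0 < n := by rw [← hS]; exact Finset.card_pos.mpr ⟨u, hu⟩
      have hc : (S.erase u).card = n - 1 := by rw [Finset.card_erase_of_mem hu, hS]
      rw [h.rec' S u hu, ← Finset.add_sum_erase S _ hu]
      simp only [derivative_sub, derivative_mul, derivative_X, one_mul, derivative_sum]
      rw [ih (n - 1) (by omega) _ hc]
      have e1 : ∀ v ∈ S.erase u, F (S.erase v) = X * F ((S.erase u).erase v) -
          ∑ w ∈ S.erase u, if w ≠ v ∧ G.Adj u w then F (((S.erase u).erase w).erase v) else 0 := by
        intro v hv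
        rw [h.rec' (S.erase v) u (by simp at hv; simp [hu, Ne.symm hv.1]),
          Finset.erase_right_comm (a := v) (b := u)]
        congr 1
        rw [Finset.sum_filter, ← Finset.add_sum_erase _ _ hv]
        simp only [ne_eq, not_true, false_and, if_false, zero_add]
        apply Finset.sum_congr rfl
        intro w hw
        simp only [Finset.mem_erase] at hw
        simp only [hw.1, not_false_eq_true, true_and]
        rw [Finset.erase_right_comm (a := v) (b := w)]
      rw [Finset.sum_congr rfl e1, Finset.sum_sub_distrib, ← Finset.mul_sum, Finset.sum_comm,
        Finset.sum_filter]
      have e2 : ∀ w ∈ S.erase u, (if G.Adj u w then derivative (F ((S.erase u).erase w)) else 0) =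
          ∑ v ∈ S.erase u, if w ≠ v ∧ G.Adj u w then F (((S.erase u).erase w).erase v) else 0 := by
        intro w hw
        rw [← Finset.add_sum_erase _ _ hw]
        by_cases ha : G.Adj u w
        · have hcw : ((S.erase u).erase w).card = n - 1 - 1 := by
            rw [Finset.card_erase_of_mem hw, hc]
          simp only [ha, if_true, ne_eq, not_true, false_and, if_false, zero_add, and_true]
          rw [ih (n - 1 - 1) (by omega) _ hcw]
          apply Finset.sum_congr rfl
          intro v hv
          simp only [Finset.mem_erase] at hv
          rw [if_pos (fun e => hv.1 e.symm)]
        · simp [ha]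
      rw [Finset.sum_congr rfl e2]
      ring

end
end GE

section GE
open Classical
section
variable {V : Type*} {G : SimpleGraph V} {F : Finset V → ℝ[X]}

noncomputable def gm (θ : ℝ) (F : Finset V → ℝ[X]) (S : Finset V) : ℕ := rootMultiplicity θ (F S)

theorem GESys.dvd_iff (h : GESys G F) (θ : ℝ) (S : Finset V) (n : ℕ) :
    (X - C θ) ^ n ∣ F S ↔ n ≤ gm θ F S :=
  (le_rootMultiplicity_iff (h.ne_zero S)).symm

theorem GESys.dvd_mul (h : GESys G F) (θ : ℝ) (S T : Finset V) (n : ℕ) :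
    (X - C θ) ^ n ∣ F S * F T ↔ n ≤ gm θ F S + gm θ F T := by
  have hne := mul_ne_zero (h.ne_zero S) (h.ne_zero T)
  rw [← le_rootMultiplicity_iff hne, rootMultiplicity_mul hne]; rfl

theorem GESys.q_ge (h : GESys G F) {S : Finset V} {u v : V} (hu : u ∈ S) (hv : v ∈ S)
    (huv : u ≠ v) (z : ℝ) : (if G.Adj u v then (F ((S.erase u).erase v)).eval z ^ 2 else 0) ≤
    (F (S.erase u) * F (S.erase v) - F S * F ((S.erase u).erase v)).eval z := by
  simpa using ge_nonneg (h.evalRec z) _ S rfl u v hu hv huv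

theorem GESys.q_nonneg (h : GESys G F) {S : Finset V} {u v : V} (hu : u ∈ S) (hv : v ∈ S)
    (huv : u ≠ v) (z : ℝ) : 0 ≤
    (F (S.erase u) * F (S.erase v) - F S * F ((S.erase u).erase v)).eval z := by
  refine le_trans ?_ (h.q_ge hu hv huv z)
  split_ifs <;> positivity

theorem GESys.le1 (h : GESys G F) (θ : ℝ) {S : Finset V} {u : V} (hu : u ∈ S) :
    gm θ F S ≤ gm θ F (S.erase u) + 1 := by
  by_contra hlt
  push Not at hlt
  set W := F (S.erase u) * derivative (F S) - F S * derivative (F (S.erase u)) with hW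
  have hWe : W = F (S.erase u) * F (S.erase u) + ∑ v ∈ S.erase u,
      (F (S.erase u) * F (S.erase v) - F S * F ((S.erase u).erase v)) := by
    rw [hW, h.deriv _ S rfl, h.deriv _ (S.erase u) rfl, ← Finset.add_sum_erase S _ hu,
      Finset.sum_sub_distrib, ← Finset.mul_sum, ← Finset.mul_sum]
    ring
  have hdom : ∀ z, |(F (S.erase u) * F (S.erase u)).eval z| ≤ |W.eval z| := by
    intro z
    rw [eval_mul, abs_of_nonneg (mul_self_nonneg _)]
    refine le_trans ?_ (le_abs_self _)
    rw [hWe, eval_add, eval_mul, eval_finsetSum]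
    have : 0 ≤ ∑ v ∈ S.erase u,
      (F (S.erase u) * F (S.erase v) - F S * F ((S.erase u).erase v)).eval z := by
      apply Finset.sum_nonneg
      intro v hv
      simp only [Finset.mem_erase] at hv
      exact h.q_nonneg hu hv.2 (Ne.symm hv.1) z
    linarith
  set b := gm θ F (S.erase u)
  have d1 : (X - C θ) ^ (b + 2) ∣ F S := (h.dvd_iff θ S _).mpr hlt
  have d2 : (X - C θ) ^ (b + 1) ∣ derivative (F S) := by
    have := pow_sub_one_dvd_derivative_of_pow_dvd d1
    simpa using this
  have d3 : (X - C θ) ^ b ∣ F (S.erase u) := (h.dvd_iff θ _ _).mpr le_rfl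
  have d4 : (X - C θ) ^ (b - 1) ∣ derivative (F (S.erase u)) :=
    pow_sub_one_dvd_derivative_of_pow_dvd d3
  have d5 : (X - C θ) ^ (2 * b + 1) ∣ W := by
    apply dvd_sub
    · have := mul_dvd_mul d3 d2
      rw [← pow_add] at this
      exact (pow_dvd_pow _ (by omega)).trans this
    · have := mul_dvd_mul d1 d4
      rw [← pow_add] at this
      exact (pow_dvd_pow _ (by omega)).trans this
  have d6 := ge_dom hdom _ d5
  rw [h.dvd_mul] at d6
  omega

theorem GESys.le2 (h : GESys G F) (θ : ℝ) {S : Finset V} {u : V} (hu : u ∈ S) :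
    gm θ F (S.erase u) ≤ gm θ F S + 1 := by
  have : (X - C θ) ^ (gm θ F (S.erase u) - 1) ∣ F S := by
    rw [h.rec' S u hu]
    apply dvd_sub
    · apply Dvd.dvd.mul_left
      rw [h.dvd_iff]; omega
    · apply Finset.dvd_sum
      intro w hw
      rw [h.dvd_iff]
      have := h.le1 θ (Finset.mem_filter.mp hw).1
      omega
  rw [h.dvd_iff] at this
  omega

theorem GESys.exists_ess (h : GESys G F) {θ : ℝ} {S : Finset V} (hS : 0 < gm θ F S) :
    ∃ v ∈ S, gm θ F (S.erase v) + 1 = gm θ F S := by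
  by_contra hcon
  push Not at hcon
  have h1 : ∀ v ∈ S, gm θ F S ≤ gm θ F (S.erase v) := by
    intro v hv
    have := h.le1 θ hv
    have := hcon v hv
    omega
  have h2 : (X - C θ) ^ (gm θ F S) ∣ derivative (F S) := by
    rw [h.deriv _ S rfl]
    exact Finset.dvd_sum (fun v hv => (h.dvd_iff θ _ _).mpr (h1 v hv))
  have hroot : (F S).IsRoot θ := (rootMultiplicity_pos (h.ne_zero S)).mp hS
  have h3 := derivative_rootMultiplicity_of_root hroot
  have hd0 : derivative (F S) ≠ 0 := by
    intro h0
    have h4 := natDegree_eq_zero_of_derivative_eq_zero h0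
    obtain ⟨c, hc⟩ := natDegree_eq_zero.mp h4
    have := h.ne_zero S
    rw [← hc] at hroot this
    simp [IsRoot] at hroot
    simp [hroot] at this
  rw [← le_rootMultiplicity_iff hd0, h3] at h2
  unfold gm at *
  omega

/-- if a neighbour `w` is essential in `S - u` then `u` is positive -/
theorem GESys.pos_of (h : GESys G F) {θ : ℝ} {S : Finset V} {u w : V} (hu : u ∈ S) (hw : w ∈ S)
    (ha : G.Adj u w) (he : gm θ F ((S.erase u).erase w) + 1 = gm θ F (S.erase u)) :
    gm θ F (S.erase u) = gm θ F S + 1 := by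
  have huw : u ≠ w := ha.ne
  have l1 := h.le2 θ hu
  have l2 := h.le1 θ hw
  by_contra hcon
  set b := gm θ F ((S.erase u).erase w)
  have hdom : ∀ z, |(F ((S.erase u).erase w) * F ((S.erase u).erase w)).eval z| ≤
      |(F (S.erase u) * F (S.erase w) - F S * F ((S.erase u).erase w)).eval z| := by
    intro z
    have := h.q_ge hu hw huw z
    rw [if_pos ha] at this
    refine le_trans ?_ (this.trans (le_abs_self _))
    rw [eval_mul, abs_of_nonneg (mul_self_nonneg _), sq]
  have := ge_dom (θ := θ) hdom (2 * b + 1) (by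
    apply dvd_sub <;> rw [h.dvd_mul] <;> omega)
  rw [h.dvd_mul] at this
  omega

theorem GESys.of_pos (h : GESys G F) {θ : ℝ} {S : Finset V} {u : V} (hu : u ∈ S)
    (hp : gm θ F (S.erase u) = gm θ F S + 1) : ∃ w ∈ S, G.Adj u w ∧
      gm θ F ((S.erase u).erase w) + 1 = gm θ F (S.erase u) := by
  by_contra hcon
  push Not at hcon
  have : (X - C θ) ^ (gm θ F S + 1) ∣ F S := by
    conv_rhs => rw [h.rec' S u hu]
    apply dvd_sub
    · apply Dvd.dvd.mul_left
      rw [h.dvd_iff]; omega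
    · apply Finset.dvd_sum
      intro w hw
      rw [h.dvd_iff]
      rw [Finset.mem_filter] at hw
      have l := h.le1 θ hw.1
      have := hcon w (Finset.mem_of_mem_erase hw.1) hw.2
      omega
  rw [h.dvd_iff] at this
  omega

theorem GESys.special_pos (h : GESys G F) {θ : ℝ} {S : Finset V} {u w : V} (hu : u ∈ S)
    (hw : w ∈ S) (ha : G.Adj u w) (hn : gm θ F (S.erase u) + 1 ≠ gm θ F S)
    (he : gm θ F (S.erase w) + 1 = gm θ F S) : gm θ F (S.erase u) = gm θ F S + 1 := by
  have huw := ha.ne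
  by_contra hcon
  have l1 := h.le1 θ hu
  have l2 := h.le2 θ hu
  have hneu : gm θ F (S.erase u) = gm θ F S := by omega
  have hw' : w ∈ S.erase u := by simp [hw, huw.symm]
  have l3 := h.le1 θ hw'
  have hu' : u ∈ S.erase w := by simp [hu, huw]
  have l4 := h.le2 θ hu'
  rw [Finset.erase_right_comm (a := w) (b := u)] at l4
  by_cases hc : gm θ F ((S.erase u).erase w) + 1 = gm θ F (S.erase u)
  · exact hcon (h.pos_of hu hw ha hc)
  · obtain ⟨b, hb⟩ : ∃ b, gm θ F (S.erase w) = b := ⟨_, rfl⟩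
    have := ge_even (θ := θ) (h.q_nonneg hu hw huw) b (by
      apply dvd_sub <;> rw [h.dvd_mul] <;> omega)
    have d2 : (X - C θ) ^ (2 * b + 2) ∣ F S * F ((S.erase u).erase w) := by
      rw [h.dvd_mul]; omega
    have d3 := dvd_add this d2
    rw [sub_add_cancel, h.dvd_mul] at d3
    omega

/-- exchange -/
theorem GESys.exchange (h : GESys G F) {θ : ℝ} {S : Finset V} {u v w : V} (hu : u ∈ S)
    (hv : v ∈ S) (hw : w ∈ S) (huv : u ≠ v) (huw : u ≠ w) (hvw : v ≠ w)
    (hbad : gm θ F ((S.erase u).erase w) + 2 = gm θ F S)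
    (hess : gm θ F (S.erase v) + 1 = gm θ F S) :
    gm θ F ((S.erase u).erase v) + 2 = gm θ F S ∨ gm θ F ((S.erase w).erase v) + 2 = gm θ F S := by
  by_contra hcon
  push Not at hcon
  obtain ⟨c1, c2⟩ := hcon
  have a1 := h.le1 θ hu
  have a2 := h.le1 θ hw
  have a3 := h.le1 θ (show w ∈ S.erase u by simp [hw, huw.symm])
  have a4 := h.le2 θ (show w ∈ S.erase u by simp [hw, huw.symm])
  have a5 := h.le2 θ (show u ∈ S.erase w by simp [hu, huw])
  have a5' := h.le1 θ (show u ∈ S.erase w by simp [hu, huw])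
  rw [Finset.erase_right_comm (a := w) (b := u)] at a5 a5'
  have a6 := h.le1 θ (show u ∈ S.erase v by simp [hu, huv])
  have a7 := h.le1 θ (show w ∈ S.erase v by simp [hw, hvw.symm])
  rw [Finset.erase_right_comm] at a6 a7
  have a8 := h.le1 θ (show w ∈ (S.erase u).erase v by simp [hw, huw.symm, hvw.symm])
  rw [Finset.erase_right_comm (a := v) (b := w)] at a8
  have b1 := h.le1 θ (show v ∈ S.erase u by simp [hv, huv.symm])
  have b2 := h.le1 θ (show v ∈ S.erase w by simp [hv, hvw])
  obtain ⟨j, hj⟩ : ∃ j, gm θ F ((S.erase u).erase w) = j := ⟨_, rfl⟩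
  have dv : ∀ A B : Finset V, 2 * j + 2 ≤ gm θ F A + gm θ F B →
      (X - C θ) ^ (2 * j + 2) ∣ F A * F B := fun A B hAB => (h.dvd_mul θ A B _).mpr hAB
  set Q0 := F (S.erase u) * F (S.erase w) - F S * F ((S.erase u).erase w) with hQ0
  set Q2 := F ((S.erase u).erase v) * F ((S.erase w).erase v) -
        F (S.erase v) * F (((S.erase u).erase w).erase v) with hQ2
  set Q1 := F ((S.erase u).erase v) * F (S.erase w) + F (S.erase u) * F ((S.erase w).erase v)
      - F (S.erase v) * F ((S.erase u).erase w) - F S * F (((S.erase u).erase w).erase v) with hQ1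
  have d0 : (X - C θ) ^ (2 * j + 2) ∣ Q0 := dvd_sub (dv _ _ (by omega)) (dv _ _ (by omega))
  have d2 : (X - C θ) ^ (2 * j + 2) ∣ Q2 := by
    apply ge_even
    · intro z
      have := h.q_nonneg (show u ∈ S.erase v by simp [hu, huv])
        (show w ∈ S.erase v by simp [hw, hvw.symm]) huw z
      rw [Finset.erase_right_comm (a := v) (b := u), Finset.erase_right_comm (a := v) (b := w),
        Finset.erase_right_comm (a := v) (b := w)] at this
      exact this
    · apply dvd_sub <;> rw [h.dvd_mul] <;> omega
  have hdom : ∀ z, |(Q1 ^ 2).eval z| ≤ |(4 * Q0 * Q2).eval z| := by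
    intro z
    have := ge_disc (h.evalRec z) S u v w hu hv hw huv huw hvw
    rw [eval_pow, abs_of_nonneg (sq_nonneg _)]
    refine le_trans ?_ (le_abs_self _)
    simp only [hQ0, hQ1, hQ2, eval_add, eval_sub, eval_mul, eval_ofNat]
    exact this
  have d1 : ((X - C θ) ^ (2 * j + 2)) ^ 2 ∣ Q1 ^ 2 := by
    rw [← pow_mul]
    apply ge_dom hdom
    rw [mul_comm (2 * j + 2) 2, two_mul, pow_add]
    exact mul_dvd_mul (d0.mul_left 4) d2
  have d1' : (X - C θ) ^ (2 * j + 2) ∣ Q1 := (IsIntegrallyClosed.pow_dvd_pow_iff two_ne_zero).mp d1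
  have e : F (S.erase v) * F ((S.erase u).erase w) =
      F ((S.erase u).erase v) * F (S.erase w) + F (S.erase u) * F ((S.erase w).erase v)
       - F S * F (((S.erase u).erase w).erase v) - Q1 := by rw [hQ1]; ring
  have d : (X - C θ) ^ (2 * j + 2) ∣ F (S.erase v) * F ((S.erase u).erase w) := by
    rw [e]
    exact dvd_sub (dvd_sub (dvd_add (dv _ _ (by omega)) (dv _ _ (by omega)))
      (dv _ _ (by omega))) d1'
  rw [h.dvd_mul] at d
  omega

/-- stability -/
theorem GESys.stable (h : GESys G F) {θ : ℝ} {S : Finset V} {u w v : V} (hu : u ∈ S)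
    (hw : w ∈ S) (ha : G.Adj u w) (hn : gm θ F (S.erase u) + 1 ≠ gm θ F S)
    (he : gm θ F (S.erase w) + 1 = gm θ F S) (hv : v ∈ S) (hvu : v ≠ u) :
    gm θ F ((S.erase u).erase v) + 1 = gm θ F (S.erase u) ↔
      gm θ F (S.erase v) + 1 = gm θ F S := by
  have hp := h.special_pos hu hw ha hn he
  have fwd : ∀ x ∈ S, x ≠ u → gm θ F (S.erase x) + 1 = gm θ F S →
      gm θ F ((S.erase u).erase x) + 1 = gm θ F (S.erase u) := by
    intro x hx hxu hex
    have l1 := h.le1 θ (show x ∈ S.erase u by simp [hx, hxu])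
    have l2 := h.le2 θ (show u ∈ S.erase x by simp [hu, hxu.symm])
    rw [Finset.erase_right_comm] at l2
    omega
  refine ⟨fun hev => ?_, fwd v hv hvu⟩
  have hew := fwd w hw ha.ne.symm he
  -- u positive in S - w
  have huw : u ∈ S.erase w := by simp [hu, ha.ne]
  obtain ⟨w', hw', ha', he'⟩ := h.of_pos (θ := θ) huw (by
    rw [Finset.erase_right_comm]; omega)
  simp only [Finset.mem_erase] at hw'
  rw [Finset.erase_right_comm (a := w) (b := u)] at he'
  have fin : ∀ x ∈ S, G.Adj u x → x ≠ v →
      gm θ F (((S.erase u).erase x).erase v) + 2 = gm θ F (S.erase u) →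
      gm θ F (S.erase v) + 1 = gm θ F S := by
    intro x hx hax hxv hb
    have := h.pos_of (θ := θ) (S := S.erase v) (u := u) (w := x) (by simp [hu, hvu.symm])
      (by simp [hx, hxv]) hax (by
        rw [Finset.erase_right_comm (a := v) (b := u), Finset.erase_right_comm (a := v) (b := x)]
        omega)
    rw [Finset.erase_right_comm] at this
    omega
  by_cases hvw : v = w
  · subst hvw; exact he
  by_cases hvw' : v = w'
  · subst hvw'
    refine fin w hw ha (Ne.symm hvw) ?_
    omega
  rcases h.exchange (θ := θ) (S := S.erase u) (u := w) (v := v) (w := w')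
    (by simp [hw, ha.ne.symm]) (by simp [hv, hvu]) (by simp [hw', ha'.ne.symm]) (Ne.symm hvw)
    (Ne.symm hw'.1) hvw' (by omega) hev with hb | hb
  · exact fin w hw ha (Ne.symm hvw) hb
  · exact fin w' hw'.2 ha' (Ne.symm hvw') hb

theorem GESys.adj_not_bad (h : GESys G F) {θ : ℝ} {S : Finset V} {u w : V} (hu : u ∈ S)
    (hw : w ∈ S) (ha : G.Adj u w) (he : gm θ F (S.erase u) + 1 = gm θ F S) :
    gm θ F ((S.erase u).erase w) + 2 ≠ gm θ F S := by
  intro hb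
  have := h.pos_of (θ := θ) hu hw ha (by omega)
  omega

theorem GESys.union (h : GESys G F) (B : Finset V) : ∀ (n : ℕ) (A : Finset V), A.card = n →
    Disjoint A B → (∀ a ∈ A, ∀ b ∈ B, ¬ G.Adj a b) → F (A ∪ B) = F A * F B := by
  intro n
  induction n using Nat.strong_induction_on with
  | _ n ih =>
    intro A hA hd hadj
    rcases A.eq_empty_or_nonempty with rfl | ⟨u, hu⟩
    · simp [h.empty']
    · have hpos : 0 < n := by rw [← hA]; exact Finset.card_pos.mpr ⟨u, hu⟩
      have hc : (A.erase u).card = n - 1 := by rw [Finset.card_erase_of_mem hu, hA]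
      have huB : u ∉ B := Finset.disjoint_left.mp hd hu
      have e0 : ∀ (A' : Finset V) (x : V), x ∉ B → (A' ∪ B).erase x = A'.erase x ∪ B := by
        intro A' x hx
        rw [Finset.erase_union_distrib, Finset.erase_eq_of_notMem hx]
      have e1 : F (A.erase u ∪ B) = F (A.erase u) * F B :=
        ih (n - 1) (by omega) _ hc (hd.mono_left (Finset.erase_subset _ _))
          (fun a ha => hadj a (Finset.mem_of_mem_erase ha))
      have e2 : (A.erase u ∪ B).filter (G.Adj u) = (A.erase u).filter (G.Adj u) := by
        rw [Finset.filter_union, Finset.filter_eq_empty_iff.mpr (fun b hb => hadj u hu b hb),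
          Finset.union_empty]
      rw [h.rec' (A ∪ B) u (by simp [hu]), h.rec' A u hu, e0 A u huB, e1, e2, sub_mul,
        Finset.sum_mul, mul_assoc]
      congr 1
      apply Finset.sum_congr rfl
      intro w hw
      have hw := (Finset.mem_filter.mp hw).1
      have hwA := Finset.mem_of_mem_erase hw
      rw [e0 _ w (Finset.disjoint_left.mp hd hwA)]
      refine ih (n - 1 - 1) (by omega) _ (by rw [Finset.card_erase_of_mem hw, hc])
        (hd.mono_left ((Finset.erase_subset _ _).trans (Finset.erase_subset _ _)))
        (fun a ha => hadj a (Finset.mem_of_mem_erase (Finset.mem_of_mem_erase ha)))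

theorem GESys.gm_union (h : GESys G F) (θ : ℝ) {A B : Finset V}
    (hd : Disjoint A B) (hadj : ∀ a ∈ A, ∀ b ∈ B, ¬ G.Adj a b) :
    gm θ F (A ∪ B) = gm θ F A + gm θ F B := by
  unfold gm
  rw [h.union B _ A rfl hd hadj, rootMultiplicity_mul (mul_ne_zero (h.ne_zero _) (h.ne_zero _))]

theorem GESys.gm_biUnion (h : GESys G F) (θ : ℝ) {ι : Type*} (T : ι → Finset V) (I : Finset ι)
    (hd : ∀ i j, i ≠ j → Disjoint (T i) (T j))
    (hadj : ∀ i j, i ≠ j → ∀ a ∈ T i, ∀ b ∈ T j, ¬ G.Adj a b) :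
    gm θ F (I.biUnion T) = ∑ i ∈ I, gm θ F (T i) := by
  induction I using Finset.induction_on with
  | empty => simp [gm, h.empty']
  | insert i I hi ih =>
    have hne : ∀ j ∈ I, i ≠ j := fun j hj e => hi (e ▸ hj)
    rw [Finset.biUnion_insert, Finset.sum_insert hi, h.gm_union, ih]
    · rw [Finset.disjoint_biUnion_right]
      exact fun j hj => hd i j (hne j hj)
    · intro a ha b hb
      obtain ⟨j, hj, hb⟩ := Finset.mem_biUnion.mp hb
      exact hadj i j (hne j hj) a ha b hb

/-- Gallai lemma: `S` nonempty, all vertices essential, connected (in terms of a relation) -/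
theorem GESys.gallai (h : GESys G F) {θ : ℝ} {S : Finset V} {v₀ : V} (hv₀ : v₀ ∈ S)
    (hess : ∀ v ∈ S, gm θ F (S.erase v) + 1 = gm θ F S)
    (hconn : ∀ v ∈ S, Relation.ReflTransGen (fun a b => b ∈ S ∧ G.Adj a b) v₀ v) :
    gm θ F S = 1 := by
  by_contra hcon
  have e0 := hess v₀ hv₀
  obtain ⟨y, hy, hye⟩ := h.exists_ess (θ := θ) (S := S.erase v₀) (by omega)
  have key : ∀ v, Relation.ReflTransGen (fun a b => b ∈ S ∧ G.Adj a b) v₀ v →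
      v ∈ S ∧ (v ≠ v₀ → gm θ F ((S.erase v₀).erase v) + 2 ≠ gm θ F S) := by
    intro v hv
    induction hv with
    | refl => exact ⟨hv₀, fun hh => absurd rfl hh⟩
    | tail _ hab ih =>
      rename_i a b _
      obtain ⟨haS, hanb⟩ := ih
      refine ⟨hab.1, fun hb hbad => ?_⟩
      by_cases hav : a = v₀
      · subst hav
        exact h.adj_not_bad haS hab.1 hab.2 (hess _ haS) hbad
      · rcases h.exchange hv₀ haS hab.1 (Ne.symm hav) (Ne.symm hb) hab.2.ne hbad (hess a haS)
          with hh | hh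
        · exact hanb hav hh
        · rw [Finset.erase_right_comm] at hh
          exact h.adj_not_bad haS hab.1 hab.2 (hess _ haS) hh
  simp only [Finset.mem_erase] at hy
  exact (key y (hconn y hy.2)).2 hy.1 (by omega)

end
end GE

section GE
open Classical
theorem GESys.main {V : Type*} [Fintype V] {G : SimpleGraph V} {F : Finset V → ℝ[X]}
    (h : GESys G F) (θ : ℝ) (D : Set V)
    (hD : ∀ v, v ∈ D ↔ gm θ F (Finset.univ.erase v) + 1 = gm θ F Finset.univ) :
    gm θ F Finset.univ + {v | v ∉ D ∧ ∃ w ∈ D, G.Adj v w}.ncard =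
      Nat.card (G.induce D).ConnectedComponent := by
  set A : Finset V := Finset.univ.filter (fun v => v ∉ D ∧ ∃ w ∈ D, G.Adj v w) with hA
  have hAc : {v | v ∉ D ∧ ∃ w ∈ D, G.Adj v w}.ncard = A.card := by
    rw [← Set.ncard_coe_finset]; congr 1; ext; simp [hA]
  rw [hAc]
  have step : ∀ B : Finset V, B ⊆ A → gm θ F (Finset.univ \ B) = gm θ F Finset.univ + B.card ∧
      ∀ v, v ∉ B → (gm θ F ((Finset.univ \ B).erase v) + 1 = gm θ F (Finset.univ \ B) ↔ v ∈ D) := by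
    intro B
    induction B using Finset.induction_on with
    | empty => intro _; simp [hD]
    | insert u B hu ih =>
      intro hs
      obtain ⟨i1, i2⟩ := ih ((Finset.subset_insert _ _).trans hs)
      have huA : u ∈ A := hs (Finset.mem_insert_self _ _)
      simp only [hA, Finset.mem_filter, Finset.mem_univ, true_and] at huA
      obtain ⟨huD, w, hwD, haw⟩ := huA
      have hnB : ∀ x ∈ D, x ∉ B := by
        intro x hx hxB
        have := hs (Finset.mem_insert_of_mem hxB)
        simp [hA] at this
        exact this.1 hx
      have e : Finset.univ \ insert u B = (Finset.univ \ B).erase u := by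
        ext x; simp [not_or]
      have huS : u ∈ Finset.univ \ B := by simp [hu]
      have hwS : w ∈ Finset.univ \ B := by simp [hnB w hwD]
      have hn : gm θ F ((Finset.univ \ B).erase u) + 1 ≠ gm θ F (Finset.univ \ B) :=
        fun hh => huD ((i2 u hu).mp hh)
      have he := (i2 w (hnB w hwD)).mpr hwD
      rw [e]
      constructor
      · rw [h.special_pos huS hwS haw hn he, i1, Finset.card_insert_of_notMem hu]; ring
      · intro v hv
        simp only [Finset.mem_insert, not_or] at hv
        rw [h.stable huS hwS haw hn he (by simp [hv.2]) hv.1, i2 v hv.2]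
  obtain ⟨s1, s2⟩ := step A le_rfl
  rw [← s1]
  set DF : Finset V := Finset.univ.filter (· ∈ D) with hDF
  set R : Finset V := (Finset.univ \ A) \ DF with hR
  have hDA : ∀ x ∈ D, x ∉ A := by intro x hx; simp [hA, hx]
  have hT : Finset.univ \ A = DF ∪ R := by
    rw [hR, Finset.union_sdiff_of_subset]
    intro x hx
    simp [hDF] at hx
    simp [hDA x hx]
  have hdisj : Disjoint DF R := Finset.disjoint_sdiff
  have hadj : ∀ a ∈ DF, ∀ b ∈ R, ¬ G.Adj a b := by
    intro a ha b hb hab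
    simp [hDF] at ha
    simp [hR, hDF, hA] at hb
    exact hb.1 hb.2 a ha hab.symm
  have hsum := h.gm_union θ hdisj hadj
  -- essential vertices of parts
  have partR : gm θ F R = 0 := by
    by_contra hne
    obtain ⟨v, hv, hve⟩ := h.exists_ess (Nat.pos_of_ne_zero hne)
    have hvD : v ∉ DF := Finset.disjoint_right.mp hdisj hv
    have e : (DF ∪ R).erase v = DF ∪ R.erase v := by
      rw [Finset.erase_union_distrib, Finset.erase_eq_of_notMem hvD]
    have h2 := h.gm_union θ (hdisj.mono_right (Finset.erase_subset v R))
      (fun a ha b hb => hadj a ha b (Finset.mem_of_mem_erase hb))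
    have hvA : v ∉ A := by simp only [hR, Finset.mem_sdiff] at hv; exact hv.1.2
    have := (s2 v hvA).mp (by rw [hT, e]; omega)
    exact hvD (by simp [hDF, this])
  have partD : ∀ v ∈ D, gm θ F (DF.erase v) + 1 = gm θ F DF := by
    intro v hv
    have hvD : v ∈ DF := by simp [hDF, hv]
    have hvR : v ∉ R := Finset.disjoint_left.mp hdisj hvD
    have e : (DF ∪ R).erase v = DF.erase v ∪ R := by
      rw [Finset.erase_union_distrib, Finset.erase_eq_of_notMem hvR]
    have h2 := h.gm_union θ (hdisj.mono_left (Finset.erase_subset v DF))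
      (fun a ha b hb => hadj a (Finset.mem_of_mem_erase ha) b hb)
    have := (s2 v (hDA v hv)).mpr hv
    rw [hT, e] at this
    omega
  rw [hT, hsum, partR, add_zero]
  -- components
  have : Fintype (G.induce D).ConnectedComponent := Fintype.ofFinite _
  set T : (G.induce D).ConnectedComponent → Finset V :=
    fun c => Finset.univ.filter (fun v => ∃ hv : v ∈ D, (G.induce D).connectedComponentMk ⟨v, hv⟩ = c)
    with hTdef
  have memT : ∀ c v, v ∈ T c ↔ ∃ hv : v ∈ D, (G.induce D).connectedComponentMk ⟨v, hv⟩ = c := by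
    intro c v; simp [hTdef]
  have hTd : ∀ i j, i ≠ j → Disjoint (T i) (T j) := by
    intro i j hij
    rw [Finset.disjoint_left]
    intro v hi hj
    obtain ⟨_, hi⟩ := (memT _ _).mp hi
    obtain ⟨_, hj⟩ := (memT _ _).mp hj
    exact hij (hi.symm.trans hj)
  have hTa : ∀ i j, i ≠ j → ∀ a ∈ T i, ∀ b ∈ T j, ¬ G.Adj a b := by
    intro i j hij a ha b hb hab
    obtain ⟨h1, hi⟩ := (memT _ _).mp ha
    obtain ⟨h2, hj⟩ := (memT _ _).mp hb
    apply hij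
    rw [← hi, ← hj, SimpleGraph.ConnectedComponent.eq]
    exact SimpleGraph.Adj.reachable (by simpa using hab)
  have hU : DF = Finset.univ.biUnion T := by
    ext v; simp [hDF, memT]
  have hU' : ∀ c, DF = T c ∪ (Finset.univ.erase c).biUnion T := by
    intro c
    rw [hU, ← Finset.biUnion_insert, Finset.insert_erase (Finset.mem_univ c)]
  have hone : ∀ c, gm θ F (T c) = 1 := by
    intro c
    set R' := (Finset.univ.erase c).biUnion T with hR'
    have hd' : Disjoint (T c) R' := by
      rw [hR', Finset.disjoint_biUnion_right]
      exact fun j hj => hTd c j (Finset.ne_of_mem_erase hj).symm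
    have ha' : ∀ a ∈ T c, ∀ b ∈ R', ¬ G.Adj a b := by
      intro a ha b hb
      obtain ⟨j, hj, hb⟩ := Finset.mem_biUnion.mp hb
      exact hTa c j (Finset.ne_of_mem_erase hj).symm a ha b hb
    have hess : ∀ v ∈ T c, gm θ F ((T c).erase v) + 1 = gm θ F (T c) := by
      intro v hv
      obtain ⟨hvD, _⟩ := (memT _ _).mp hv
      have hvR : v ∉ R' := Finset.disjoint_left.mp hd' hv
      have e : (T c ∪ R').erase v = (T c).erase v ∪ R' := by
        rw [Finset.erase_union_distrib, Finset.erase_eq_of_notMem hvR]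
      have h1 := h.gm_union θ hd' ha'
      have h2 := h.gm_union θ (hd'.mono_left (Finset.erase_subset v _))
        (fun a ha b hb => ha' a (Finset.mem_of_mem_erase ha) b hb)
      have := partD v hvD
      rw [show DF = T c ∪ R' from hU' c, e] at this
      omega
    obtain ⟨⟨v₀, hv₀⟩, hc⟩ := c.exists_rep
    have hc : (G.induce D).connectedComponentMk ⟨v₀, hv₀⟩ = c := hc
    refine h.gallai (v₀ := v₀) ((memT _ _).mpr ⟨hv₀, hc⟩) hess ?_
    intro v hv
    obtain ⟨hvD, hvc⟩ := (memT _ _).mp hv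
    have hr : (G.induce D).Reachable ⟨v₀, hv₀⟩ ⟨v, hvD⟩ := by
      rw [← SimpleGraph.ConnectedComponent.eq, hc, hvc]
    rw [SimpleGraph.reachable_iff_reflTransGen] at hr
    have key : ∀ y : D, Relation.ReflTransGen (G.induce D).Adj ⟨v₀, hv₀⟩ y →
        Relation.ReflTransGen (fun a b => b ∈ T c ∧ G.Adj a b) v₀ y := by
      intro y hy
      induction hy with
      | refl => exact .refl
      | tail h1 h2 ih =>
        rename_i a b
        refine ih.tail ⟨(memT _ _).mpr ⟨b.2, ?_⟩, by simpa using h2⟩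
        rw [← hc, SimpleGraph.ConnectedComponent.eq, SimpleGraph.reachable_comm,
          SimpleGraph.reachable_iff_reflTransGen]
        exact h1.tail h2
    exact key _ hr
  have := h.gm_biUnion θ T Finset.univ hTd hTa
  rw [← hU] at this
  rw [this, Finset.sum_congr rfl (fun c _ => hone c)]
  simp [Nat.card_eq_fintype_card]
end GE
section GE
open Classical

def GEIsM {V : Type*} (G : SimpleGraph V) (S : Finset V) (M : Finset (Sym2 V)) : Prop :=
  (∀ e ∈ M, e ∈ G.edgeSet) ∧ (∀ e ∈ M, ∀ f ∈ M, e ≠ f → ∀ v, v ∈ e → v ∉ f) ∧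
    ∀ e ∈ M, ∀ v ∈ e, v ∈ S

noncomputable def geM {V : Type*} [Fintype V] (G : SimpleGraph V) (S : Finset V) :
    Finset (Finset (Sym2 V)) := Finset.univ.filter (GEIsM G S)

noncomputable def geMu {V : Type*} [Fintype V] (G : SimpleGraph V) (S : Finset V) : ℝ[X] :=
  ∑ M ∈ geM G S, (-1 : ℝ[X]) ^ M.card * X ^ (S.card - 2 * M.card)

theorem geM_card {V : Type*} {G : SimpleGraph V} {S : Finset V} {M : Finset (Sym2 V)}
    (h : GEIsM G S M) : 2 * M.card ≤ S.card := by
  have h1 : (M.biUnion Sym2.toFinset).card = ∑ e ∈ M, e.toFinset.card := by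
    apply Finset.card_biUnion
    intro e he f hf hef
    simp only [Function.onFun]
    rw [Finset.disjoint_left]
    intro v hv hv'
    rw [Sym2.mem_toFinset] at hv hv'
    exact h.2.1 e he f hf hef v hv hv'
  have h2 : ∑ e ∈ M, e.toFinset.card = ∑ e ∈ M, 2 := by
    apply Finset.sum_congr rfl
    intro e he
    exact Sym2.card_toFinset_of_not_isDiag _ (G.not_isDiag_of_mem_edgeSet (h.1 e he))
  have h3 : M.biUnion Sym2.toFinset ⊆ S := by
    intro v hv
    obtain ⟨e, he, hv⟩ := Finset.mem_biUnion.mp hv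
    exact h.2.2 e he v (Sym2.mem_toFinset.mp hv)
  have := Finset.card_le_card h3
  rw [h1, h2] at this
  simp at this
  omega

theorem geM_insert {V : Type*} {G : SimpleGraph V} {S : Finset V} {u w : V}
    (hu : u ∈ S) (hw : w ∈ S) (ha : G.Adj u w) {M : Finset (Sym2 V)}
    (h : GEIsM G ((S.erase u).erase w) M) :
    GEIsM G S (insert s(u, w) M) ∧ s(u, w) ∉ M := by
  obtain ⟨h1, h2, h3⟩ := h
  have h4 : ∀ f ∈ M, ∀ v ∈ f, v ≠ w ∧ v ≠ u ∧ v ∈ S := by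
    intro f hf v hv
    simpa using h3 f hf v hv
  refine ⟨⟨?_, ?_, ?_⟩, ?_⟩
  · intro e he
    rcases Finset.mem_insert.mp he with rfl | he
    · exact ha
    · exact h1 e he
  · intro e he f hf hef v hve hvf
    rcases Finset.mem_insert.mp he with rfl | he <;> rcases Finset.mem_insert.mp hf with rfl | hf
    · exact hef rfl
    · have := h4 f hf v hvf
      rcases Sym2.mem_iff.mp hve with rfl | rfl
      · exact this.2.1 rfl
      · exact this.1 rfl
    · have := h4 e he v hve
      rcases Sym2.mem_iff.mp hvf with rfl | rfl
      · exact this.2.1 rfl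
      · exact this.1 rfl
    · exact h2 e he f hf hef v hve hvf
  · intro e he v hv
    rcases Finset.mem_insert.mp he with rfl | he
    · rcases Sym2.mem_iff.mp hv with rfl | rfl <;> assumption
    · exact (h4 e he v hv).2.2
  · intro hm
    exact (h4 _ hm u (by simp)).2.1 rfl

theorem geM_split {V : Type*} [Fintype V] (G : SimpleGraph V) {S : Finset V} {u : V}
    (hu : u ∈ S) : geM G S = geM G (S.erase u) ∪
      ((S.erase u).filter (G.Adj u)).biUnion
        (fun w => (geM G ((S.erase u).erase w)).image (insert s(u, w))) := by
  ext M
  simp only [geM, Finset.mem_union, Finset.mem_filter, Finset.mem_univ, true_and,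
    Finset.mem_biUnion, Finset.mem_image]
  constructor
  · intro h
    obtain ⟨h1, h2, h3⟩ := h
    by_cases hc : ∃ e ∈ M, u ∈ e
    · right
      obtain ⟨e, he, hue⟩ := hc
      obtain ⟨w, rfl⟩ := hue
      have ha : G.Adj u w := h1 _ he
      refine ⟨w, ⟨?_, ha⟩, M.erase s(u, w), ⟨?_, ?_, ?_⟩, Finset.insert_erase he⟩
      · simp [ha.ne.symm, h3 _ he w (by simp)]
      · exact fun f hf => h1 f (Finset.mem_of_mem_erase hf)
      · exact fun f hf g hg => h2 f (Finset.mem_of_mem_erase hf) g (Finset.mem_of_mem_erase hg)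
      · intro f hf v hv
        have hf' := Finset.mem_erase.mp hf
        have := h2 f hf'.2 _ he hf'.1 v hv
        simp only [Sym2.mem_iff, not_or] at this
        simp [this, h3 f hf'.2 v hv]
    · left
      push Not at hc
      refine ⟨h1, h2, fun e he v hv => ?_⟩
      rw [Finset.mem_erase]
      exact ⟨fun hvu => hc e he (hvu ▸ hv), h3 e he v hv⟩
  · rintro (⟨h1, h2, h3⟩ | ⟨w, ⟨hw, ha⟩, M', hM', rfl⟩)
    · exact ⟨h1, h2, fun e he v hv => Finset.mem_of_mem_erase (h3 e he v hv)⟩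
    · exact (geM_insert hu (Finset.mem_of_mem_erase hw) ha hM').1

theorem geMu_sys {V : Type*} [Fintype V] (G : SimpleGraph V) : GESys G (geMu G) := by
  constructor
  · intro S u hu
    have memM : ∀ S M, M ∈ geM G S ↔ GEIsM G S M := by intro S M; simp [geM]
    have hpos : 0 < S.card := Finset.card_pos.mpr ⟨u, hu⟩
    conv_lhs => rw [geMu, geM_split G hu]
    rw [Finset.sum_union, Finset.sum_biUnion, sub_eq_add_neg]
    · congr 1
      · rw [geMu, Finset.mul_sum]
        apply Finset.sum_congr rfl
        intro M hM
        have := geM_card ((memM _ _).mp hM)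
        rw [Finset.card_erase_of_mem hu] at *
        rw [show S.card - 2 * M.card = S.card - 1 - 2 * M.card + 1 by omega, pow_succ]
        ring
      · rw [← Finset.sum_neg_distrib]
        apply Finset.sum_congr rfl
        intro w hw
        obtain ⟨hw, ha⟩ := Finset.mem_filter.mp hw
        have hwS := Finset.mem_of_mem_erase hw
        rw [Finset.sum_image, geMu, ← Finset.sum_neg_distrib]
        · apply Finset.sum_congr rfl
          intro M hM
          rw [Finset.card_insert_of_notMem (geM_insert hu hwS ha ((memM _ _).mp hM)).2,
            Finset.card_erase_of_mem hw, Finset.card_erase_of_mem hu,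
            show S.card - 2 * (M.card + 1) = S.card - 1 - 1 - 2 * M.card by omega, pow_succ]
          ring
        · intro M hM M' hM' he
          have n1 := (geM_insert hu hwS ha ((memM _ _).mp hM)).2
          have n2 := (geM_insert hu hwS ha ((memM _ _).mp hM')).2
          rw [← Finset.erase_insert n1, he, Finset.erase_insert n2]
    · intro w hw w' hw' hne
      obtain ⟨hw, ha⟩ := Finset.mem_filter.mp hw
      obtain ⟨hw', ha'⟩ := Finset.mem_filter.mp hw'
      simp only [Function.onFun]
      rw [Finset.disjoint_left]
      intro M hM hM'
      obtain ⟨N, hN, rfl⟩ := Finset.mem_image.mp hM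
      obtain ⟨N', hN', he⟩ := Finset.mem_image.mp hM'
      have h1 := (geM_insert hu (Finset.mem_of_mem_erase hw) ha ((memM _ _).mp hN)).1
      refine h1.2.1 s(u, w) (by simp) s(u, w') (by rw [← he]; simp) ?_ u (by simp) (by simp)
      intro e
      rw [Sym2.congr_right] at e
      exact hne e
    · rw [Finset.disjoint_left]
      intro M hM hM'
      obtain ⟨w, hw, hM'⟩ := Finset.mem_biUnion.mp hM'
      obtain ⟨N, hN, rfl⟩ := Finset.mem_image.mp hM'
      have := ((memM _ _).mp hM).2.2 s(u, w) (by simp) u (by simp)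
      simp at this
  · have : geM G ∅ = {∅} := by
      ext M
      simp only [geM, Finset.mem_filter, Finset.mem_univ, true_and, Finset.mem_singleton]
      constructor
      · intro h
        have := geM_card h
        simpa using this
      · rintro rfl
        simp [GEIsM]
    simp [geMu, this]

theorem geMu_transfer {V W : Type*} [Fintype V] [Finite W] (G : SimpleGraph V) (H : SimpleGraph W)
    (φ : W ↪ V) (S : Finset V) (hS : ∀ v, v ∈ S ↔ ∃ w, φ w = v)
    (hH : ∀ a b, H.Adj a b ↔ G.Adj (φ a) (φ b)) : matchingPolynomial H = geMu G S := by
  unfold matchingPolynomial geMu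
  let : Fintype W := Fintype.ofFinite W
  have hcard : Nat.card W = S.card := by
    rw [Nat.card_eq_fintype_card, ← Finset.card_univ, ← Finset.card_map φ]
    congr 1
    ext v; simp [hS]
  have hedge : ∀ e : Sym2 W, e ∈ H.edgeSet ↔ Sym2.map φ e ∈ G.edgeSet := by
    intro e
    induction e with
    | _ a b => simpa using hH a b
  have hmem : ∀ (e : Sym2 W) (w : W), φ w ∈ Sym2.map φ e ↔ w ∈ e := by
    intro e w
    rw [Sym2.mem_map]
    exact ⟨fun ⟨a, ha, hh⟩ => φ.injective hh ▸ ha, fun hw => ⟨w, hw, rfl⟩⟩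
  simp only
  refine Finset.sum_bij (fun M _ => M.map φ.sym2Map) ?_ ?_ ?_ ?_
  · intro M hM
    simp only [Finset.mem_filter, Finset.mem_univ, true_and] at hM
    simp only [geM, Finset.mem_filter, Finset.mem_univ, true_and]
    refine ⟨?_, ?_, ?_⟩
    · intro e he
      obtain ⟨e, he', rfl⟩ := Finset.mem_map.mp he
      exact (hedge e).mp (hM.1 e he')
    · intro e he f hf hef v hv hv'
      obtain ⟨e, he', rfl⟩ := Finset.mem_map.mp he
      obtain ⟨f, hf', rfl⟩ := Finset.mem_map.mp hf
      simp only [Function.Embedding.sym2Map_apply] at hv hv' hef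
      obtain ⟨a, ha, rfl⟩ := Sym2.mem_map.mp hv
      rw [hmem] at hv'
      exact hM.2 e he' f hf' (fun h => hef (by rw [h])) a ha hv'
    · intro e he v hv
      obtain ⟨e, he', rfl⟩ := Finset.mem_map.mp he
      obtain ⟨a, ha, rfl⟩ := Sym2.mem_map.mp hv
      exact (hS _).mpr ⟨a, rfl⟩
  · intro M _ M' _ h
    exact Finset.map_injective _ h
  · intro N hN
    simp only [geM, Finset.mem_filter, Finset.mem_univ, true_and] at hN
    obtain ⟨h1, h2, h3⟩ := hN
    refine ⟨Finset.univ.filter (fun e => Sym2.map φ e ∈ N), ?_, ?_⟩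
    · simp only [Finset.mem_filter, Finset.mem_univ, true_and]
      refine ⟨fun e he => (hedge e).mpr (h1 _ he), ?_⟩
      intro e he f hf hef v hv hv'
      exact h2 _ he _ hf (fun h => hef (Sym2.map.injective φ.injective h)) (φ v)
        ((hmem _ _).mpr hv) ((hmem _ _).mpr hv')
    · ext e
      simp only [Finset.mem_map, Finset.mem_filter, Finset.mem_univ, true_and,
        Function.Embedding.sym2Map_apply]
      constructor
      · rintro ⟨a, ha, rfl⟩; exact ha
      · intro he
        have h3 := h3 e he
        induction e with
        | _ a b =>
          obtain ⟨a, rfl⟩ := (hS a).mp (h3 a (by simp))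
          obtain ⟨b, rfl⟩ := (hS b).mp (h3 b (by simp))
          exact ⟨s(a, b), by simpa using he, by simp⟩
  · intro M _
    rw [Finset.card_map, hcard]

theorem ge_final {V : Type*} [Finite V] (θ : ℝ) (G : SimpleGraph V) :
    matchMult θ G + (vertexBoundary G {v | IsEssential θ G v}).ncard =
      Nat.card ((G.induce {v | IsEssential θ G v}).ConnectedComponent) := by
  let : Fintype V := Fintype.ofFinite V
  have h1 : matchMult θ G = gm θ (geMu G) Finset.univ := by
    unfold matchMult gm
    rw [geMu_transfer G G (Function.Embedding.refl V) Finset.univ (by simp) (by simp)]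
  have h2 : ∀ u, matchMult θ (G.induce {v | v ≠ u}) = gm θ (geMu G) (Finset.univ.erase u) := by
    intro u
    unfold matchMult gm
    rw [geMu_transfer G (G.induce {v | v ≠ u}) (Function.Embedding.subtype _)
      (Finset.univ.erase u) (by simp) (by simp)]
  rw [h1]
  refine (geMu_sys G).main θ _ ?_
  intro v
  show IsEssential θ G v ↔ _
  unfold IsEssential
  rw [h1, h2]
end GE

-- statement 4
theorem gallai_edmonds_multiplicity {V : Type*} [Finite V] (θ : ℝ) (G : SimpleGraph V) :
    matchMult θ G + (vertexBoundary G {v | IsEssential θ G v}).ncard =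
      Nat.card ((G.induce {v | IsEssential θ G v}).ConnectedComponent) := ge_final θ G
end

section
/- Let θ ∈ ℝ, let G be a finite simple graph, let A be a set of vertices of G none of which is θ-essential, and let u ∉ A be a θ-essential vertex of G. Then u is θ-essential in G−A: mult(θ, (G−A)−u) = mult(θ, G−A) − 1. -/
open Polynomial

/-- A family of polynomials satisfying a (weighted) matching recursion. -/
def MFam {V : Type*} [DecidableEq V] (e : V → V → ℝ) (F : Finset V → ℝ[X]) : Prop :=
  F ∅ = 1 ∧ ∃ w : V → ℝ, ∀ S : Finset V, ∀ u ∈ S,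
    F S = (X + C (w u)) * F (S.erase u)
      - ∑ x ∈ S.erase u, C (e u x) * F ((S.erase u).erase x)

section
variable {V : Type*} [DecidableEq V] {e : V → V → ℝ} {F : Finset V → ℝ[X]}

lemma MFam.D_nonneg (he : ∀ x y, 0 ≤ e x y) (h : MFam e F) (z : ℝ) :
    ∀ n : ℕ, ∀ S : Finset V, S.card = n → ∀ u ∈ S, ∀ v ∈ S, u ≠ v →
      0 ≤ (F (S.erase u) * F (S.erase v) - F S * F ((S.erase u).erase v)).eval z := by
  obtain ⟨_, w, hw⟩ := h
  intro n
  induction n with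
  | zero => intro S hS u hu; simp [Finset.card_eq_zero.mp hS] at hu
  | succ n ih =>
    intro S hS u hu v hv huv
    have hvu : v ∈ S.erase u := Finset.mem_erase.mpr ⟨huv.symm, hv⟩
    have huv' : u ∈ S.erase v := Finset.mem_erase.mpr ⟨huv, hu⟩
    have key : F (S.erase u) * F (S.erase v) - F S * F ((S.erase u).erase v)
        = C (e u v) * F ((S.erase u).erase v) ^ 2
          + ∑ x ∈ (S.erase u).erase v, C (e u x) *
            (F ((S.erase u).erase x) * F ((S.erase u).erase v)
              - F (S.erase u) * F (((S.erase u).erase x).erase v)) := by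
      rw [hw S u hu, hw (S.erase v) u huv', Finset.erase_right_comm (a := v) (b := u),
        ← Finset.add_sum_erase _ _ hvu]
      simp only [mul_sub, Finset.sum_sub_distrib, sub_mul, add_mul, mul_add, Finset.mul_sum,
        Finset.sum_mul]
      have : ∀ x, ((S.erase u).erase v).erase x = ((S.erase u).erase x).erase v :=
        fun x => Finset.erase_right_comm
      simp only [this]
      have e1 : ∑ x ∈ (S.erase u).erase v, C (e u x) * (F (S.erase u) * F (((S.erase u).erase x).erase v))
        = ∑ x ∈ (S.erase u).erase v, F (S.erase u) * (C (e u x) * F (((S.erase u).erase x).erase v)) :=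
        Finset.sum_congr rfl fun x _ => by ring
      have e2 : ∑ x ∈ (S.erase u).erase v, C (e u x) * (F ((S.erase u).erase x) * F ((S.erase u).erase v))
        = ∑ x ∈ (S.erase u).erase v, C (e u x) * F ((S.erase u).erase x) * F ((S.erase u).erase v) :=
        Finset.sum_congr rfl fun x _ => by ring
      rw [e1, e2]; ring
    rw [key, eval_add, eval_finsetSum]
    refine add_nonneg ?_ (Finset.sum_nonneg fun x hx => ?_)
    · simp only [eval_mul, eval_C, eval_pow]; exact mul_nonneg (he _ _) (sq_nonneg _)
    · rw [eval_mul, eval_C]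
      refine mul_nonneg (he _ _) (ih _ ?_ x (Finset.mem_of_mem_erase hx) v hvu (Finset.ne_of_mem_erase hx))
      rw [Finset.card_erase_of_mem hu, hS]; rfl

lemma MFam.W_ge (he : ∀ x y, 0 ≤ e x y) (h : MFam e F) (z : ℝ) :
    ∀ n : ℕ, ∀ S : Finset V, S.card = n → ∀ u ∈ S,
      (F (S.erase u)).eval z ^ 2 ≤
      (F (S.erase u) * derivative (F S) - F S * derivative (F (S.erase u))).eval z := by
  obtain ⟨_, w, hw⟩ := h
  intro n
  induction n with
  | zero => intro S hS u hu; simp [Finset.card_eq_zero.mp hS] at hu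
  | succ n ih =>
    intro S hS u hu
    have key : F (S.erase u) * derivative (F S) - F S * derivative (F (S.erase u))
        = F (S.erase u) ^ 2 + ∑ x ∈ S.erase u, C (e u x) *
          (F ((S.erase u).erase x) * derivative (F (S.erase u))
            - F (S.erase u) * derivative (F ((S.erase u).erase x))) := by
      rw [hw S u hu]
      simp only [derivative_sub, derivative_mul, derivative_add, derivative_X, derivative_C,
        derivative_sum, mul_sub, Finset.sum_sub_distrib, sub_mul, add_mul, mul_add, Finset.mul_sum,
        Finset.sum_mul, zero_mul, add_zero, zero_add, one_mul]
      have e1 : ∑ x ∈ S.erase u, C (e u x) * (F ((S.erase u).erase x) * derivative (F (S.erase u)))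
        = ∑ x ∈ S.erase u, C (e u x) * F ((S.erase u).erase x) * derivative (F (S.erase u)) :=
        Finset.sum_congr rfl fun x _ => by ring
      have e2 : ∑ x ∈ S.erase u, C (e u x) * (F (S.erase u) * derivative (F ((S.erase u).erase x)))
        = ∑ x ∈ S.erase u, F (S.erase u) * (C (e u x) * derivative (F ((S.erase u).erase x))) :=
        Finset.sum_congr rfl fun x _ => by ring
      rw [e1, e2]; ring
    rw [key, eval_add, eval_finsetSum, eval_pow]
    refine le_add_of_nonneg_right (Finset.sum_nonneg fun x hx => ?_)
    rw [eval_mul, eval_C]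
    refine mul_nonneg (he _ _) ((sq_nonneg _).trans (ih _ ?_ x hx))
    rw [Finset.card_erase_of_mem hu, hS]; rfl

lemma MFam.ne_zero (he : ∀ x y, 0 ≤ e x y) (h : MFam e F) (S : Finset V) : F S ≠ 0 := by
  induction S using Finset.induction_on with
  | empty => rw [h.1]; exact one_ne_zero
  | insert a S ha ih =>
    intro h0
    apply ih
    apply Polynomial.funext
    intro z
    have := h.W_ge he z _ (insert a S) rfl a (Finset.mem_insert_self _ _)
    rw [h0, Finset.erase_insert ha] at this
    simp only [derivative_zero, mul_zero, zero_mul, sub_zero, eval_zero] at this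
    rw [eval_zero]
    nlinarith [sq_nonneg (eval z (F S))]

end

lemma rm_factor (θ : ℝ) (p : ℝ[X]) (hp : p ≠ 0) :
    ∃ g : ℝ[X], p = (X - C θ) ^ (p.rootMultiplicity θ) * g ∧ g.eval θ ≠ 0 := by
  obtain ⟨g, hg, hnd⟩ := Polynomial.exists_eq_pow_rootMultiplicity_mul_and_not_dvd p hp θ
  exact ⟨g, hg, fun h0 => hnd (dvd_iff_isRoot.mpr h0)⟩

lemma rm_of_factor (θ : ℝ) (g : ℝ[X]) (n : ℕ) (hg : g.eval θ ≠ 0) :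
    ((X - C θ) ^ n * g).rootMultiplicity θ = n := by
  have hg0 : g ≠ 0 := by rintro rfl; simp at hg
  have : (X - C θ) ^ n ≠ 0 := pow_ne_zero _ (X_sub_C_ne_zero θ)
  rw [rootMultiplicity_mul (mul_ne_zero this hg0), rootMultiplicity_X_sub_C_pow,
    rootMultiplicity_eq_zero hg, add_zero]

lemma rm_even (θ : ℝ) (p : ℝ[X]) (hp : p ≠ 0) (h : ∀ z, 0 ≤ p.eval z) :
    Even (p.rootMultiplicity θ) := by
  obtain ⟨g, hg, hg0⟩ := rm_factor θ p hp
  set n := p.rootMultiplicity θ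
  by_contra hodd
  rw [Nat.not_even_iff_odd] at hodd
  have hpe : ∀ t : ℝ, 0 ≤ t ^ n * g.eval (θ + t) := by
    intro t
    have := h (θ + t)
    rw [hg] at this
    simpa using this
  have hpos : ∀ t : ℝ, 0 < t → 0 ≤ g.eval (θ + t) := fun t ht =>
    nonneg_of_mul_nonneg_right (hpe t) (pow_pos ht n)
  have hneg : ∀ t : ℝ, 0 < t → g.eval (θ - t) ≤ 0 := fun t ht => by
    have h1 := hpe (-t)
    rw [hodd.neg_pow, neg_mul, ← sub_eq_add_neg] at h1
    have := pow_pos ht n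
    by_contra hc
    push Not at hc
    nlinarith [mul_pos this hc]
  have c1 : Filter.Tendsto (fun t : ℝ => g.eval (θ + t)) (nhdsWithin 0 (Set.Ioi 0)) (nhds (g.eval θ)) := by
    have : Continuous (fun t : ℝ => g.eval (θ + t)) := by fun_prop
    have := (this.tendsto 0).mono_left (nhdsWithin_le_nhds (s := Set.Ioi 0))
    simpa using this
  have c2 : Filter.Tendsto (fun t : ℝ => g.eval (θ - t)) (nhdsWithin 0 (Set.Ioi 0)) (nhds (g.eval θ)) := by
    have : Continuous (fun t : ℝ => g.eval (θ - t)) := by fun_prop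
    have := (this.tendsto 0).mono_left (nhdsWithin_le_nhds (s := Set.Ioi 0))
    simpa using this
  apply hg0
  apply le_antisymm
  · exact le_of_tendsto c2 (Filter.eventually_of_mem self_mem_nhdsWithin fun t ht => hneg t ht)
  · exact ge_of_tendsto c1 (Filter.eventually_of_mem self_mem_nhdsWithin fun t ht => hpos t ht)

lemma rm_le_sq (θ : ℝ) (p q : ℝ[X]) (hp : p ≠ 0) (hq : q ≠ 0) (h : ∀ z, q.eval z ^ 2 ≤ p.eval z) :
    p.rootMultiplicity θ ≤ 2 * q.rootMultiplicity θ := by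
  obtain ⟨g, hg, hg0⟩ := rm_factor θ p hp
  obtain ⟨k, hk, hk0⟩ := rm_factor θ q hq
  set n := p.rootMultiplicity θ
  set m := q.rootMultiplicity θ
  by_contra! hlt
  obtain ⟨d, hd⟩ : ∃ d, n = 2 * m + (d + 1) := ⟨n - 2 * m - 1, by omega⟩
  have hpe : ∀ t : ℝ, 0 < t → k.eval (θ + t) ^ 2 ≤ t ^ (d + 1) * g.eval (θ + t) := by
    intro t ht
    have := h (θ + t)
    rw [hg, hk, hd] at this
    simp only [eval_mul, eval_pow, eval_sub, eval_X, eval_C, add_sub_cancel_left] at this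
    have hp := pow_pos ht (2 * m)
    refine le_of_mul_le_mul_left ?_ hp
    calc _ = (t ^ m * k.eval (θ + t)) ^ 2 := by ring
      _ ≤ _ := this
      _ = _ := by ring
  have c1 : Filter.Tendsto (fun t : ℝ => t ^ (d + 1) * g.eval (θ + t) - k.eval (θ + t) ^ 2)
      (nhdsWithin 0 (Set.Ioi 0)) (nhds (- k.eval θ ^ 2)) := by
    have : Continuous (fun t : ℝ => t ^ (d + 1) * g.eval (θ + t) - k.eval (θ + t) ^ 2) := by fun_prop
    have := (this.tendsto 0).mono_left (nhdsWithin_le_nhds (s := Set.Ioi 0))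
    simpa using this
  have : 0 ≤ - k.eval θ ^ 2 :=
    ge_of_tendsto c1 (Filter.eventually_of_mem self_mem_nhdsWithin fun t ht => sub_nonneg.mpr (hpe t ht))
  have := pow_pos (abs_pos.mpr hk0) 2
  rw [sq_abs] at this
  linarith

/-- Wronskian order. -/
lemma rm_wronskian (θ : ℝ) (p q : ℝ[X]) (hp : p ≠ 0) (hq : q ≠ 0)
    (hab : q.rootMultiplicity θ < p.rootMultiplicity θ) :
    (q * derivative p - p * derivative q).rootMultiplicity θ + 1
      = p.rootMultiplicity θ + q.rootMultiplicity θ := by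
  obtain ⟨g, hg, hg0⟩ := rm_factor θ p hp
  obtain ⟨k, hk, hk0⟩ := rm_factor θ q hq
  set a := p.rootMultiplicity θ
  set b := q.rootMultiplicity θ
  obtain ⟨d, hd⟩ : ∃ d, a = b + d + 1 := ⟨a - b - 1, by omega⟩
  have : q * derivative p - p * derivative q = (X - C θ) ^ (2 * b + d) *
      (C ((d : ℝ) + 1) * (g * k) + (X - C θ) * (k * derivative g - g * derivative k)) := by
    rw [hg, hk, hd]
    cases b with
    | zero =>
      simp only [derivative_mul, derivative_X_sub_C_pow, pow_zero, zero_add, derivative_one,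
        Nat.add_sub_cancel, map_add, map_one, map_natCast, Nat.cast_add, Nat.cast_one]
      ring
    | succ b =>
      simp only [derivative_mul, derivative_X_sub_C_pow,
        Nat.add_sub_cancel, map_add, map_one, map_natCast, Nat.cast_add, Nat.cast_one]
      ring
  rw [this, rm_of_factor, hd]
  · omega
  · simp only [eval_add, eval_mul, eval_C, eval_sub, eval_X, sub_self, zero_mul, add_zero]
    exact mul_ne_zero (by positivity) (mul_ne_zero hg0 hk0)

/-- Generic linear combination. -/
lemma rm_generic (θ : ℝ) (p q : ℝ[X]) (hp : p ≠ 0) (hq : q ≠ 0) :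
    ∃ s0 : ℝ, ∀ s : ℝ, s ≠ 0 → s ≠ s0 →
      (p + C s * q).rootMultiplicity θ = min (p.rootMultiplicity θ) (q.rootMultiplicity θ) := by
  obtain ⟨g, hg, hg0⟩ := rm_factor θ p hp
  obtain ⟨k, hk, hk0⟩ := rm_factor θ q hq
  set a := p.rootMultiplicity θ
  set b := q.rootMultiplicity θ
  refine ⟨- g.eval θ / k.eval θ, fun s hs hs0 => ?_⟩
  rcases lt_trichotomy a b with hab | hab | hab
  · obtain ⟨d, hd⟩ : ∃ d, b = a + d + 1 := ⟨b - a - 1, by omega⟩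
    have : p + C s * q = (X - C θ) ^ a * (g + C s * (X - C θ) ^ (d + 1) * k) := by
      rw [hg, hk, hd]; ring
    rw [this, rm_of_factor, min_eq_left hab.le]
    simpa using hg0
  · have : p + C s * q = (X - C θ) ^ a * (g + C s * k) := by
      rw [hg, hk, ← hab]; ring
    rw [this, rm_of_factor, hab, min_self]
    simp only [eval_add, eval_mul, eval_C]
    intro h0
    apply hs0
    rw [eq_div_iff hk0]; linarith
  · obtain ⟨d, hd⟩ : ∃ d, a = b + d + 1 := ⟨a - b - 1, by omega⟩
    have : p + C s * q = (X - C θ) ^ b * ((X - C θ) ^ (d + 1) * g + C s * k) := by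
      rw [hg, hk, hd]; ring
    rw [this, rm_of_factor, min_eq_right hab.le]
    simpa using ⟨hs, hk0⟩

lemma rm_sub (θ : ℝ) (p q : ℝ[X]) (hp : p ≠ 0) (hq : q ≠ 0)
    (h : p.rootMultiplicity θ ≠ q.rootMultiplicity θ) :
    p - q ≠ 0 ∧
    (p - q).rootMultiplicity θ = min (p.rootMultiplicity θ) (q.rootMultiplicity θ) := by
  refine ⟨fun h0 => h (by rw [sub_eq_zero.mp h0]), ?_⟩
  obtain ⟨g, hg, hg0⟩ := rm_factor θ p hp
  obtain ⟨k, hk, hk0⟩ := rm_factor θ q hq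
  set a := p.rootMultiplicity θ
  set b := q.rootMultiplicity θ
  rcases lt_or_gt_of_ne h with hab | hab
  · obtain ⟨d, hd⟩ : ∃ d, b = a + d + 1 := ⟨b - a - 1, by omega⟩
    have : p - q = (X - C θ) ^ a * (g - (X - C θ) ^ (d + 1) * k) := by
      rw [hg, hk, hd]; ring
    rw [this, rm_of_factor, min_eq_left hab.le]
    simpa using hg0
  · obtain ⟨d, hd⟩ : ∃ d, a = b + d + 1 := ⟨a - b - 1, by omega⟩
    have : p - q = (X - C θ) ^ b * ((X - C θ) ^ (d + 1) * g - k) := by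
      rw [hg, hk, hd]; ring
    rw [this, rm_of_factor, min_eq_right hab.le]
    simpa using hk0

section
variable {V : Type*} [DecidableEq V] {e : V → V → ℝ} {F : Finset V → ℝ[X]}

lemma MFam.le_succ (he : ∀ x y, 0 ≤ e x y) (h : MFam e F) (θ : ℝ) (S : Finset V) (u : V) (hu : u ∈ S) :
    (F S).rootMultiplicity θ ≤ (F (S.erase u)).rootMultiplicity θ + 1 := by
  by_contra! hlt
  have h1 := rm_wronskian θ (F S) (F (S.erase u)) (h.ne_zero he _) (h.ne_zero he _) (by omega)
  have h2 := rm_le_sq θ (F (S.erase u) * derivative (F S) - F S * derivative (F (S.erase u)))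
    (F (S.erase u)) ?_ (h.ne_zero he _) (fun z => h.W_ge he z _ S rfl u hu)
  · omega
  · intro h0
    rw [h0] at h1
    simp at h1
    omega

lemma MFam.le_succ' (he : ∀ x y, 0 ≤ e x y) (h : MFam e F) (θ : ℝ) (S : Finset V) (u : V) (hu : u ∈ S) :
    (F (S.erase u)).rootMultiplicity θ ≤ (F S).rootMultiplicity θ + 1 := by
  have hne := h.ne_zero he
  have h' := h
  obtain ⟨_, w, hw⟩ := h
  set b := (F (S.erase u)).rootMultiplicity θ with hb
  have : (X - C θ) ^ (b - 1) ∣ F S := by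
    rw [hw S u hu]
    refine dvd_sub (Dvd.dvd.mul_left ?_ _) (Finset.dvd_sum fun x hx => Dvd.dvd.mul_left ?_ _)
    · exact (le_rootMultiplicity_iff (hne _)).mp (by omega)
    · refine (le_rootMultiplicity_iff (hne _)).mp ?_
      have := h'.le_succ he θ (S.erase u) x hx
      omega
  have := (le_rootMultiplicity_iff (hne _)).mpr this
  omega

lemma MFam.parity (he : ∀ x y, 0 ≤ e x y) (h : MFam e F) (θ : ℝ) (S : Finset V) (u v : V)
    (hu : u ∈ S) (hv : v ∈ S) (huv : u ≠ v)
    (hne : (F (S.erase u)).rootMultiplicity θ + (F (S.erase v)).rootMultiplicity θ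
      ≠ (F S).rootMultiplicity θ + (F ((S.erase u).erase v)).rootMultiplicity θ) :
    Even (min ((F (S.erase u)).rootMultiplicity θ + (F (S.erase v)).rootMultiplicity θ)
      ((F S).rootMultiplicity θ + (F ((S.erase u).erase v)).rootMultiplicity θ)) := by
  have h1 := mul_ne_zero (h.ne_zero he (S.erase u)) (h.ne_zero he (S.erase v))
  have h2 := mul_ne_zero (h.ne_zero he S) (h.ne_zero he ((S.erase u).erase v))
  rw [← rootMultiplicity_mul h1, ← rootMultiplicity_mul h2] at hne ⊢
  obtain ⟨h3, h4⟩ := rm_sub θ _ _ h1 h2 hne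
  rw [← h4]
  exact rm_even θ _ h3 fun z => h.D_nonneg he z _ S rfl u hu v hv huv

lemma MFam.perturb [Finite V] (he : ∀ x y, 0 ≤ e x y) (h : MFam e F) (θ : ℝ) (c : V) :
    ∃ F' : Finset V → ℝ[X], MFam e F' ∧ (∀ T, c ∉ T → F' T = F T) ∧
      ∀ T, c ∈ T → (F' T).rootMultiplicity θ
        = min ((F T).rootMultiplicity θ) ((F (T.erase c)).rootMultiplicity θ) := by
  have hne := h.ne_zero he
  choose s0 hs0 using fun T : Finset V => rm_generic θ (F T) (F (T.erase c)) (hne _) (hne _)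
  obtain ⟨s, hs⟩ : ∃ s, s ∉ ({0} ∪ Set.range s0 : Set ℝ) :=
    ((Set.finite_singleton 0).union (Set.finite_range s0)).exists_notMem
  simp only [Set.mem_union, Set.mem_singleton_iff, Set.mem_range, not_or, not_exists] at hs
  refine ⟨fun T => if c ∈ T then F T + C s * F (T.erase c) else F T, ⟨?_, ?_⟩, ?_, ?_⟩
  · simpa using h.1
  · obtain ⟨_, w, hw⟩ := h
    refine ⟨Function.update w c (w c + s), fun S u hu => ?_⟩
    by_cases huc : u = c
    · subst huc
      simp only [hu, if_true, Finset.mem_erase, ne_eq, not_true_eq_false, false_and, and_false,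
        if_false, Function.update_self]
      rw [hw S u hu, C_add]; ring
    · rw [Function.update_of_ne huc]
      by_cases hc : c ∈ S
      · have hcu : c ∈ S.erase u := Finset.mem_erase.mpr ⟨Ne.symm huc, hc⟩
        have huc' : u ∈ S.erase c := Finset.mem_erase.mpr ⟨huc, hu⟩
        simp only [hc, hcu, if_true]
        rw [← Finset.add_sum_erase _ _ hcu]
        have : ∀ x ∈ (S.erase u).erase c, C (e u x) * (if c ∈ (S.erase u).erase x then
            F ((S.erase u).erase x) + C s * F (((S.erase u).erase x).erase c) else
            F ((S.erase u).erase x)) = C (e u x) * F ((S.erase u).erase x)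
              + C s * (C (e u x) * F (((S.erase u).erase c).erase x)) := by
          intro x hx
          have : c ∈ (S.erase u).erase x :=
            Finset.mem_erase.mpr ⟨(Finset.ne_of_mem_erase hx).symm, hcu⟩
          rw [if_pos this, Finset.erase_right_comm (a := x)]; ring
        rw [Finset.sum_congr rfl this, Finset.sum_add_distrib, ← Finset.mul_sum, hw S u hu,
          hw (S.erase c) u huc', Finset.erase_right_comm (a := c) (b := u),
          ← Finset.add_sum_erase _ _ hcu]
        simp only [Finset.mem_erase, ne_eq, not_true_eq_false, false_and, if_false]
        ring
      · simp only [Finset.mem_erase, hc, and_false, if_false]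
        exact hw S u hu
  · intro T hT; simp [hT]
  · intro T hT
    simp only [hT, if_true]
    exact hs0 T s hs.1 (fun h => hs.2 T h.symm)

lemma MFam.stable_one (he : ∀ x y, 0 ≤ e x y) (h : MFam e F) (θ : ℝ) (S : Finset V) (u a : V)
    (hu : u ∈ S) (ha : a ∈ S) (hua : u ≠ a)
    (h1 : (F (S.erase u)).rootMultiplicity θ + 1 = (F S).rootMultiplicity θ)
    (h2 : (F S).rootMultiplicity θ ≤ (F (S.erase a)).rootMultiplicity θ) :
    (F ((S.erase a).erase u)).rootMultiplicity θ + 1 = (F (S.erase a)).rootMultiplicity θ := by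
  have p := h.parity he θ S u a hu ha hua
  have hau : a ∈ S.erase u := Finset.mem_erase.mpr ⟨hua.symm, ha⟩
  have hua' : u ∈ S.erase a := Finset.mem_erase.mpr ⟨hua, hu⟩
  have a1 := h.le_succ he θ _ _ ha
  have a2 := h.le_succ' he θ _ _ ha
  have a3 := h.le_succ he θ _ _ hau
  have a4 := h.le_succ' he θ _ _ hau
  have a5 := h.le_succ he θ _ _ hua'
  have a6 := h.le_succ' he θ _ _ hua'
  rw [Finset.erase_right_comm (a := a)] at *
  grind

lemma MFam.perturb_ne (he : ∀ x y, 0 ≤ e x y) (h : MFam e F) (θ : ℝ) (S : Finset V) (b c : V)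
    (hb : b ∈ S) (hc : c ∈ S) (hbc : b ≠ c)
    (h2 : (F S).rootMultiplicity θ ≤ (F (S.erase b)).rootMultiplicity θ) :
    min ((F S).rootMultiplicity θ) ((F (S.erase c)).rootMultiplicity θ) ≤
    min ((F (S.erase b)).rootMultiplicity θ) ((F ((S.erase b).erase c)).rootMultiplicity θ) := by
  have p := h.parity he θ S b c hb hc hbc
  have hau : c ∈ S.erase b := Finset.mem_erase.mpr ⟨hbc.symm, hc⟩
  have hua' : b ∈ S.erase c := Finset.mem_erase.mpr ⟨hbc, hb⟩
  have a1 := h.le_succ he θ _ _ hc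
  have a2 := h.le_succ' he θ _ _ hc
  have a3 := h.le_succ he θ _ _ hau
  have a4 := h.le_succ' he θ _ _ hau
  have a5 := h.le_succ he θ _ _ hua'
  have a6 := h.le_succ' he θ _ _ hua'
  have a7 := h.le_succ' he θ _ _ hb
  rw [Finset.erase_right_comm (a := c)] at *
  grind

end

section
variable {V : Type*} [DecidableEq V] {e : V → V → ℝ}

lemma MFam.perturb_all [Finite V] (he : ∀ x y, 0 ≤ e x y) (θ : ℝ) (S : Finset V) (a u : V)
    (F : Finset V → ℝ[X]) (h : MFam e F) (A : Finset V) (hAS : A ⊆ S) (haS : a ∈ S) (haA : a ∉ A)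
    (huS : u ∈ S) (huA : u ∉ A)
    (hess : (F (S.erase u)).rootMultiplicity θ + 1 = (F S).rootMultiplicity θ)
    (hA : ∀ b ∈ insert a A, (F S).rootMultiplicity θ ≤ (F (S.erase b)).rootMultiplicity θ)
    (B : Finset V) (hB : B ⊆ A) :
    ∃ F', MFam e F' ∧ (∀ T, Disjoint T B → F' T = F T) ∧
      (F' (S.erase u)).rootMultiplicity θ + 1 = (F' S).rootMultiplicity θ ∧
      (∀ b ∈ insert a A, (F' S).rootMultiplicity θ ≤ (F' (S.erase b)).rootMultiplicity θ) ∧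
      (∀ b ∈ B, (F' (S.erase a)).rootMultiplicity θ
        ≤ (F' ((S.erase a).erase b)).rootMultiplicity θ) := by
  induction B using Finset.induction_on with
  | empty => exact ⟨F, h, fun _ _ => rfl, hess, hA, by simp⟩
  | insert c B hcB ih =>
    obtain ⟨F1, f1, f2, f3, f4, f5⟩ := ih ((Finset.subset_insert _ _).trans hB)
    have hcA : c ∈ A := hB (Finset.mem_insert_self _ _)
    have hcS := hAS hcA
    have hcu : c ≠ u := fun h => huA (h ▸ hcA)
    have hca : c ≠ a := fun h => haA (h ▸ hcA)
    obtain ⟨F2, g1, g2, g3⟩ := f1.perturb he θ c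
    have hAS' : ∀ b ∈ insert a A, b ∈ S := by
      intro b hb
      rcases Finset.mem_insert.mp hb with rfl | hb
      · exact haS
      · exact hAS hb
    have gen : ∀ T b, c ∈ T → b ∈ T →
        ((F1 T).rootMultiplicity θ ≤ (F1 (T.erase b)).rootMultiplicity θ ∨ b = c) →
        (F2 T).rootMultiplicity θ ≤ (F2 (T.erase b)).rootMultiplicity θ := by
      intro T b hcT hbT hh
      by_cases hbc : b = c
      · subst hbc
        rw [g3 T hcT, g2 (T.erase b) (Finset.notMem_erase _ _)]
        exact min_le_right _ _
      · have hh := hh.resolve_right hbc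
        rw [g3 T hcT, g3 (T.erase b) (Finset.mem_erase.mpr ⟨Ne.symm hbc, hcT⟩)]
        exact f1.perturb_ne he θ T b c hbT hcT hbc hh
    refine ⟨F2, g1, ?_, ?_, ?_, ?_⟩
    · intro T hT
      rw [Finset.disjoint_insert_right] at hT
      rw [g2 T hT.1, f2 T hT.2]
    · rw [g3 S hcS, g3 (S.erase u) (Finset.mem_erase.mpr ⟨hcu, hcS⟩)]
      have h1 := f4 c (Finset.mem_insert_of_mem hcA)
      have h2 := f1.stable_one he θ S u c huS hcS hcu.symm f3 h1
      rw [Finset.erase_right_comm] at h2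
      omega
    · intro b hb
      exact gen S b hcS (hAS' b hb) (Or.inl (f4 b hb))
    · intro b hb
      have hbA := hB hb
      refine gen (S.erase a) b (Finset.mem_erase.mpr ⟨hca, hcS⟩)
        (Finset.mem_erase.mpr ⟨fun h => haA (h ▸ hbA), hAS hbA⟩) ?_
      rcases Finset.mem_insert.mp hb with rfl | hb
      · exact Or.inr rfl
      · exact Or.inl (f5 b hb)

lemma MFam.main [Finite V] (he : ∀ x y, 0 ≤ e x y) (θ : ℝ) (u : V) (A : Finset V) :
    ∀ (S : Finset V) (F : Finset V → ℝ[X]), MFam e F → A ⊆ S → u ∈ S → u ∉ A →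
    (F (S.erase u)).rootMultiplicity θ + 1 = (F S).rootMultiplicity θ →
    (∀ b ∈ A, (F S).rootMultiplicity θ ≤ (F (S.erase b)).rootMultiplicity θ) →
    (F ((S \ A).erase u)).rootMultiplicity θ + 1 = (F (S \ A)).rootMultiplicity θ := by
  induction A using Finset.induction_on with
  | empty => intro S F _ _ _ _ h _; simpa using h
  | insert a A haA ih =>
    intro S F h hAS huS huA hess hA
    rw [Finset.insert_subset_iff] at hAS
    rw [Finset.mem_insert, not_or] at huA
    obtain ⟨F1, f1, f2, f3, f4, f5⟩ := MFam.perturb_all he θ S a u F h A hAS.2 hAS.1 haA huS huA.2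
      hess hA A subset_rfl
    have h2 := f1.stable_one he θ S u a huS hAS.1 huA.1 f3 (f4 a (Finset.mem_insert_self _ _))
    have h3 := ih (S.erase a) F1 f1
      (fun b hb => Finset.mem_erase.mpr ⟨fun h => haA (h ▸ hb), hAS.2 hb⟩)
      (Finset.mem_erase.mpr ⟨huA.1, huS⟩) huA.2 h2 f5
    have e1 : S.erase a \ A = S \ insert a A := by
      ext x; simp only [Finset.mem_sdiff, Finset.mem_erase, Finset.mem_insert]; tauto
    have d1 : Disjoint (S \ insert a A) A :=
      Finset.disjoint_of_subset_right (Finset.subset_insert _ _) Finset.sdiff_disjoint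
    rw [e1, f2 _ d1, f2 _ (Finset.disjoint_of_subset_left (Finset.erase_subset _ _) d1)] at h3
    exact h3

end

section
open Classical

/-- `M` is a matching of `G` inside `S`. -/
def IsMat {V : Type*} (G : SimpleGraph V) (S : Finset V) (M : Finset (Sym2 V)) : Prop :=
  (∀ e ∈ M, e ∈ G.edgeSet ∧ ∀ v ∈ e, v ∈ S) ∧
    ∀ e ∈ M, ∀ f ∈ M, e ≠ f → ∀ v, v ∈ e → v ∉ f

/-- matchings of `G` inside `S`. -/
noncomputable def mats {V : Type*} [Fintype V] (G : SimpleGraph V) (S : Finset V) :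
    Finset (Finset (Sym2 V)) := Finset.univ.filter (IsMat G S)

/-- matching polynomial of the subgraph induced on `S`. -/
noncomputable def NP {V : Type*} [Fintype V] (G : SimpleGraph V) (S : Finset V) : ℝ[X] :=
  ∑ M ∈ mats G S, (-1 : ℝ[X]) ^ M.card * X ^ (S.card - 2 * M.card)

lemma IsMat.card_le {V : Type*} {G : SimpleGraph V} {S : Finset V} {M : Finset (Sym2 V)}
    (h : IsMat G S M) : 2 * M.card ≤ S.card := by
  have h1 : (M.biUnion fun e => e.toFinset).card = ∑ e ∈ M, e.toFinset.card := by
    apply Finset.card_biUnion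
    intro e he f hf hne
    rw [Function.onFun, Finset.disjoint_left]
    intro v hv hv'
    rw [Sym2.mem_toFinset] at hv hv'
    exact h.2 e he f hf hne v hv hv'
  have h2 : ∑ e ∈ M, e.toFinset.card = ∑ e ∈ M, 2 :=
    Finset.sum_congr rfl fun e he =>
      Sym2.card_toFinset_of_not_isDiag e (G.not_isDiag_of_mem_edgeSet (h.1 e he).1)
  have h3 : (M.biUnion fun e => e.toFinset) ⊆ S := by
    intro v hv
    obtain ⟨e, he, hve⟩ := Finset.mem_biUnion.mp hv
    exact (h.1 e he).2 v (Sym2.mem_toFinset.mp hve)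
  have := Finset.card_le_card h3
  rw [h1, h2, Finset.sum_const, smul_eq_mul] at this
  omega

lemma mats_split {V : Type*} [Fintype V] (G : SimpleGraph V) (S : Finset V) (u : V) (hu : u ∈ S) :
    mats G S = mats G (S.erase u) ∪ ((S.erase u).filter (G.Adj u)).biUnion fun x =>
      (mats G ((S.erase u).erase x)).image (insert s(u, x)) := by
  ext M
  simp only [mats, Finset.mem_union, Finset.mem_biUnion, Finset.mem_image, Finset.mem_filter,
    Finset.mem_univ, true_and]
  constructor
  · intro h
    by_cases hc : ∃ e ∈ M, u ∈ e
    · right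
      obtain ⟨e, he, hue⟩ := hc
      obtain ⟨x, rfl⟩ := Sym2.mem_iff_exists.mp hue
      have hadj : G.Adj u x := (h.1 _ he).1
      refine ⟨x, ⟨Finset.mem_erase.mpr ⟨hadj.ne', (h.1 _ he).2 x (Sym2.mem_mk_right _ _)⟩, hadj⟩,
        M.erase s(u, x), ⟨?_, ?_⟩, Finset.insert_erase he⟩
      · intro f hf
        obtain ⟨hf1, hf2⟩ := Finset.mem_erase.mp hf
        refine ⟨(h.1 f hf2).1, fun v hv => ?_⟩
        have hvn := h.2 f hf2 _ he hf1 v hv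
        rw [Sym2.mem_iff, not_or] at hvn
        simp only [Finset.mem_erase]
        exact ⟨hvn.2, hvn.1, (h.1 f hf2).2 v hv⟩
      · intro f hf g hg
        exact h.2 f (Finset.mem_of_mem_erase hf) g (Finset.mem_of_mem_erase hg)
    · left
      push Not at hc
      refine ⟨fun e he => ⟨(h.1 e he).1, fun v hv => Finset.mem_erase.mpr
        ⟨?_, (h.1 e he).2 v hv⟩⟩, h.2⟩
      rintro rfl
      exact hc e he hv
  · rintro (h | ⟨x, ⟨hx, hadj⟩, N, h, rfl⟩)
    · exact ⟨fun e he => ⟨(h.1 e he).1, fun v hv => Finset.mem_of_mem_erase ((h.1 e he).2 v hv)⟩, h.2⟩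
    · have key : ∀ f ∈ N, ∀ v ∈ f, v ≠ x ∧ v ≠ u ∧ v ∈ S := by
        intro f hf v hv
        simpa using (h.1 f hf).2 v hv
      refine ⟨?_, ?_⟩
      · intro f hf
        rcases Finset.mem_insert.mp hf with rfl | hf
        · refine ⟨hadj, fun v hv => ?_⟩
          rcases Sym2.mem_iff.mp hv with rfl | rfl
          · exact hu
          · exact Finset.mem_of_mem_erase hx
        · exact ⟨(h.1 f hf).1, fun v hv => (key f hf v hv).2.2⟩
      · intro f hf g hg hne v hvf hvg
        rcases Finset.mem_insert.mp hf with rfl | hf <;> rcases Finset.mem_insert.mp hg with rfl | hg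
        · exact hne rfl
        · have := key g hg v hvg
          rcases Sym2.mem_iff.mp hvf with rfl | rfl <;> simp_all
        · have := key f hf v hvf
          rcases Sym2.mem_iff.mp hvg with rfl | rfl <;> simp_all
        · exact h.2 f hf g hg hne v hvf hvg

lemma NP_rec {V : Type*} [Fintype V] (G : SimpleGraph V) (S : Finset V) (u : V) (hu : u ∈ S) :
    NP G S = X * NP G (S.erase u)
      - ∑ x ∈ (S.erase u).filter (G.Adj u), NP G ((S.erase u).erase x) := by
  have hnot : ∀ x, ∀ N ∈ mats G ((S.erase u).erase x), ∀ y, s(u, y) ∉ N := by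
    intro x N hN y hy
    have hN' : IsMat G ((S.erase u).erase x) N := (Finset.mem_filter.mp hN).2
    have := (hN'.1 _ hy).2 u (Sym2.mem_mk_left _ _)
    simp at this
  unfold NP
  rw [mats_split G S u hu, Finset.sum_union, Finset.sum_biUnion, sub_eq_add_neg]
  · congr 1
    · rw [Finset.mul_sum]
      refine Finset.sum_congr rfl fun M hM => ?_
      have hM' : IsMat G (S.erase u) M := (Finset.mem_filter.mp hM).2
      have h1 := hM'.card_le
      have h2 := Finset.card_erase_add_one hu
      have : S.card - 2 * M.card = ((S.erase u).card - 2 * M.card) + 1 := by omega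
      rw [this]; ring
    · rw [← Finset.sum_neg_distrib]
      refine Finset.sum_congr rfl fun x hx => ?_
      rw [Finset.sum_image, ← Finset.sum_neg_distrib]
      · refine Finset.sum_congr rfl fun N hN => ?_
        rw [Finset.card_insert_of_notMem (hnot x N hN x)]
        have h2 := Finset.card_erase_add_one hu
        have h3 := Finset.card_erase_add_one (Finset.mem_filter.mp hx).1
        have : S.card - 2 * (N.card + 1) = ((S.erase u).erase x).card - 2 * N.card := by omega
        rw [this]; ring
      · intro N hN N' hN' heq
        have := congrArg (fun T => T.erase s(u, x)) heq
        simpa [Finset.erase_insert (hnot x N hN x), Finset.erase_insert (hnot x N' hN' x)] using this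
  · intro x hx y hy hxy
    rw [Function.onFun, Finset.disjoint_left]
    intro M hM hM'
    obtain ⟨N, hN, rfl⟩ := Finset.mem_image.mp hM
    obtain ⟨N', hN', heq⟩ := Finset.mem_image.mp hM'
    have : s(u, y) ∈ insert s(u, x) N := heq ▸ Finset.mem_insert_self _ _
    rcases Finset.mem_insert.mp this with h | h
    · exact hxy (Sym2.congr_right.mp h).symm
    · exact hnot x N hN y h
  · rw [Finset.disjoint_left]
    intro M hM hM'
    obtain ⟨x, hx, hM'⟩ := Finset.mem_biUnion.mp hM'
    obtain ⟨N, hN, rfl⟩ := Finset.mem_image.mp hM'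
    have hM2 : IsMat G (S.erase u) _ := (Finset.mem_filter.mp hM).2
    have := (hM2.1 _ (Finset.mem_insert_self _ _)).2 u (Sym2.mem_mk_left _ _)
    simp at this

lemma NP_fam {V : Type*} [Fintype V] (G : SimpleGraph V) :
    MFam (fun x y => if G.Adj x y then (1 : ℝ) else 0) (NP G) := by
  refine ⟨?_, fun _ => 0, fun S u hu => ?_⟩
  · have : mats G ∅ = {∅} := by
      ext M
      simp only [mats, Finset.mem_filter, Finset.mem_univ, true_and, Finset.mem_singleton]
      constructor
      · intro h
        have := h.card_le
        simpa using this
      · rintro rfl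
        exact ⟨by simp, by simp⟩
    simp [NP, this]
  · rw [NP_rec G S u hu, Finset.sum_filter, C_0, add_zero]
    congr 1
    refine Finset.sum_congr rfl fun x _ => ?_
    by_cases hx : G.Adj u x <;> simp [hx]

lemma matchingPolynomial_eq_NP {V W : Type*} [Fintype V] [Finite W] (G : SimpleGraph V)
    (H : SimpleGraph W) (f : H ↪g G) (S : Finset V) (hS : ∀ v, v ∈ S ↔ ∃ x, f x = v) :
    matchingPolynomial H = NP G S := by
  letI : Fintype W := Fintype.ofFinite W
  let φ : Sym2 W ↪ Sym2 V := ⟨Sym2.map f, Sym2.map.injective f.injective⟩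
  have hcard : Nat.card W = S.card := by
    have : S = Finset.univ.map f.toEmbedding := by
      ext v; rw [hS]; simp
    rw [this, Finset.card_map, Finset.card_univ, Nat.card_eq_fintype_card]
  have hedge : ∀ e : Sym2 W, φ e ∈ G.edgeSet ↔ e ∈ H.edgeSet := by
    intro e
    induction e with
    | h x y => exact f.map_adj_iff
  unfold matchingPolynomial NP
  refine Finset.sum_bij (fun M _ => M.map φ) ?_ ?_ ?_ ?_
  · intro M hM
    obtain ⟨-, h1, h2⟩ := Finset.mem_filter.mp hM
    refine Finset.mem_filter.mpr ⟨Finset.mem_univ _, ?_, ?_⟩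
    · intro e he
      obtain ⟨e', he', rfl⟩ := Finset.mem_map.mp he
      refine ⟨(hedge e').mpr (h1 e' he'), fun v hv => (hS v).mpr ?_⟩
      obtain ⟨x, _, hx⟩ := Sym2.mem_map.mp hv
      exact ⟨x, hx⟩
    · intro e he g hg hne v hv hv'
      obtain ⟨e', he', rfl⟩ := Finset.mem_map.mp he
      obtain ⟨g', hg', rfl⟩ := Finset.mem_map.mp hg
      obtain ⟨x, hx, rfl⟩ := Sym2.mem_map.mp hv
      obtain ⟨y, hy, hxy⟩ := Sym2.mem_map.mp hv'
      rw [f.injective hxy] at hy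
      exact h2 e' he' g' hg' (fun h => hne (by rw [h])) x hx hy
  · intro M _ M' _ h
    exact Finset.map_injective φ h
  · intro M hM
    obtain ⟨-, h1, h2⟩ := Finset.mem_filter.mp hM
    have hr : ∀ e ∈ M, ∃ e', φ e' = e := by
      intro e he
      have := (h1 e he).2
      induction e with
      | h x y =>
        obtain ⟨x', rfl⟩ := (hS x).mp (this x (Sym2.mem_mk_left _ _))
        obtain ⟨y', rfl⟩ := (hS y).mp (this y (Sym2.mem_mk_right _ _))
        exact ⟨s(x', y'), rfl⟩
    refine ⟨Finset.univ.filter (fun e => φ e ∈ M), ?_, ?_⟩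
    · refine Finset.mem_filter.mpr ⟨Finset.mem_univ _, ?_, ?_⟩
      · intro e he
        exact (hedge e).mp (h1 _ (Finset.mem_filter.mp he).2).1
      · intro e he g hg hne v hv hv'
        exact h2 _ (Finset.mem_filter.mp he).2 _ (Finset.mem_filter.mp hg).2
          (fun h => hne (φ.injective h)) (f v) (Sym2.mem_map.mpr ⟨v, hv, rfl⟩)
          (Sym2.mem_map.mpr ⟨v, hv', rfl⟩)
    · ext e
      simp only [Finset.mem_map, Finset.mem_filter, Finset.mem_univ, true_and]
      constructor
      · rintro ⟨e', h, rfl⟩; exact h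
      · intro he
        obtain ⟨e', rfl⟩ := hr e he
        exact ⟨e', he, rfl⟩
  · intro M hM
    rw [Finset.card_map, hcard]

end

theorem essential_stable_under_deleting_nonessential {V : Type*} [Finite V] (θ : ℝ)
    (G : SimpleGraph V) (A : Set V) (hA : ∀ a ∈ A, ¬ IsEssential θ G a)
    (u : V) (hu : u ∉ A) (hess : IsEssential θ G u) :
    IsEssential θ (G.induce Aᶜ) ⟨u, hu⟩ := by
  classical
  letI : Fintype V := Fintype.ofFinite V
  have he : ∀ x y, 0 ≤ (if G.Adj x y then (1 : ℝ) else 0) := by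
    intro x y; split_ifs <;> norm_num
  have k0 : matchingPolynomial G = NP G Finset.univ :=
    matchingPolynomial_eq_NP G G (SimpleGraph.Embedding.refl) _ (by simp)
  have k1 : ∀ v, matchingPolynomial (G.induce {x | x ≠ v}) = NP G (Finset.univ.erase v) := fun v =>
    matchingPolynomial_eq_NP G _ (SimpleGraph.Embedding.induce _) _ (by simp)
  have k2 : matchingPolynomial (G.induce Aᶜ) = NP G (Finset.univ \ A.toFinset) :=
    matchingPolynomial_eq_NP G _ (SimpleGraph.Embedding.induce _) _ (by simp)
  have k3 : matchingPolynomial ((G.induce Aᶜ).induce {x | x ≠ ⟨u, hu⟩})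
      = NP G ((Finset.univ \ A.toFinset).erase u) :=
    matchingPolynomial_eq_NP G _
      ((SimpleGraph.Embedding.induce (G := G) Aᶜ).comp (SimpleGraph.Embedding.induce _)) _ (by
        intro v
        simp only [Finset.mem_erase, Finset.mem_sdiff, Finset.mem_univ, true_and, Set.mem_toFinset]
        constructor
        · rintro ⟨h1, h2⟩
          exact ⟨⟨⟨v, h2⟩, fun h => h1 (congrArg Subtype.val h)⟩, rfl⟩
        · rintro ⟨⟨⟨x, h2⟩, h1⟩, rfl⟩
          exact ⟨fun h => h1 (Subtype.ext h), h2⟩)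
  unfold IsEssential matchMult at *
  rw [k0, k1] at hess
  rw [k2, k3]
  refine MFam.main he θ u A.toFinset Finset.univ (NP G) (NP_fam G) (Finset.subset_univ _)
    (Finset.mem_univ _) (by simpa using hu) hess ?_
  intro b hb
  have h1 := hA b (by simpa using hb)
  rw [k0, k1] at h1
  have h2 := (NP_fam G).le_succ he θ Finset.univ b (Finset.mem_univ _)
  omega
end

section
/- Let θ ∈ ℝ, let G be a finite simple graph, let A be a set of vertices of G none of which is θ-essential, and let u ∉ A be a θ-special vertex of G. Then u is θ-special in G−A: u is not θ-essential in G−A, and u has a neighbor in G−A that is θ-essential in G−A. -/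
open Polynomial

set_option linter.unusedSimpArgs false

namespace MP

variable {V : Type*} [Fintype V] [DecidableEq V]

/-- `M` is a matching of `G` using only vertices of `S`. -/
def IsM (G : SimpleGraph V) (S : Finset V) (M : Finset (Sym2 V)) : Prop :=
  (∀ e ∈ M, e ∈ G.edgeSet ∧ ∀ v, v ∈ e → v ∈ S) ∧
    ∀ e ∈ M, ∀ f ∈ M, e ≠ f → ∀ v, v ∈ e → v ∉ f

open Classical in
/-- weighted matching polynomial of the subgraph induced on `S`. -/
noncomputable def P {R : Type*} [CommRing R] (G : SimpleGraph V) (x : V → R) (S : Finset V) : R :=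
  ∑ M ∈ Finset.univ.filter (fun M : Finset (Sym2 V) => IsM G S M),
    (-1 : R) ^ M.card * ∏ v ∈ S.filter (fun v => ∀ e ∈ M, v ∉ e), x v

open Classical in
theorem P_rec {R : Type*} [CommRing R] (G : SimpleGraph V) (x : V → R) (S : Finset V) (a : V)
    (ha : a ∈ S) :
    P G x S = x a * P G x (S.erase a) -
      ∑ c ∈ (S.erase a).filter (fun c => G.Adj a c), P G x ((S.erase a).erase c) := by
  unfold P
  rw [← Finset.sum_filter_add_sum_filter_not
    (Finset.univ.filter (fun M : Finset (Sym2 V) => IsM G S M)) (fun M => ∀ e ∈ M, a ∉ e),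
    sub_eq_add_neg]
  congr 1
  · rw [Finset.mul_sum]
    apply Finset.sum_congr
    · ext M
      simp only [Finset.mem_filter, Finset.mem_univ, true_and]
      simp only [IsM, Finset.mem_erase, Finset.mem_filter, Finset.mem_univ, true_and]
      constructor
      · rintro ⟨⟨h1, h2⟩, h3⟩
        refine ⟨fun e he => ⟨(h1 e he).1, fun v hv => ⟨?_, (h1 e he).2 v hv⟩⟩, h2⟩
        rintro rfl
        exact h3 e he hv
      · rintro ⟨h1, h2⟩
        exact ⟨⟨fun e he => ⟨(h1 e he).1, fun v hv => ((h1 e he).2 v hv).2⟩, h2⟩,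
          fun e he hv => ((h1 e he).2 a hv).1 rfl⟩
    · intro M hM
      simp only [Finset.mem_filter, Finset.mem_univ, true_and] at hM
      simp only [IsM, Finset.mem_erase, Finset.mem_filter, Finset.mem_univ, true_and] at hM
      have h3 : ∀ e ∈ M, a ∉ e := fun e he hv => ((hM.1 e he).2 a hv).1 rfl
      have : S.filter (fun v => ∀ e ∈ M, v ∉ e) =
          insert a ((S.erase a).filter (fun v => ∀ e ∈ M, v ∉ e)) := by
        ext v
        simp only [Finset.mem_filter, Finset.mem_insert, Finset.mem_erase]
        by_cases hv : v = a
        · subst hv; simp [ha]; exact h3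
        · simp [hv]
      rw [this, Finset.prod_insert (by simp)]
      ring
  · rw [← Finset.sum_neg_distrib]
    simp_rw [← Finset.sum_neg_distrib]
    rw [Finset.sum_sigma']
    symm
    apply Finset.sum_bij (fun (p : (_ : V) × Finset (Sym2 V)) _ => insert s(a, p.1) p.2)
    · rintro ⟨c, M⟩ h
      simp only [Finset.mem_filter, Finset.mem_univ, true_and, Finset.mem_sigma] at h ⊢
      simp only [IsM, Finset.mem_erase, not_forall, not_not, Finset.mem_insert, Finset.mem_filter, Finset.mem_univ, true_and] at h ⊢
      obtain ⟨⟨⟨hca, hcS⟩, hac⟩, h1, h2⟩ := h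
      refine ⟨⟨?_, ?_⟩, s(a,c), Or.inl rfl, by simp⟩
      · rintro e (rfl | he)
        · refine ⟨hac, ?_⟩
          intro v hv
          rcases Sym2.mem_iff.1 hv with rfl | rfl <;> assumption
        · exact ⟨(h1 e he).1, fun v hv => ((h1 e he).2 v hv).2.2⟩
      · have key : ∀ f ∈ M, ∀ v, v ∈ s(a,c) → v ∉ f := by
          intro f hf v hv hvf
          have := (h1 f hf).2 v hvf
          rcases Sym2.mem_iff.1 hv with rfl | rfl
          · exact this.2.1 rfl
          · exact this.1 rfl
        rintro e (rfl | he) f (rfl | hf) hne v hv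
        · exact absurd rfl hne
        · exact key f hf v hv
        · exact fun hv' => key e he v hv' hv
        · exact h2 e he f hf hne v hv
    · rintro ⟨c, M⟩ h ⟨c', M'⟩ h' heq
      simp only [Finset.mem_filter, Finset.mem_univ, true_and, Finset.mem_sigma] at h h'
      simp only [IsM, Finset.mem_erase, Finset.mem_filter, Finset.mem_univ, true_and] at h h'
      dsimp only at heq
      have hM : ∀ e ∈ M, a ∉ e := fun e he hv => ((h.2.1 e he).2 a hv).2.1 rfl
      have hM' : ∀ e ∈ M', a ∉ e := fun e he hv => ((h'.2.1 e he).2 a hv).2.1 rfl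
      have h1 : s(a,c) ∈ insert s(a,c') M' := by rw [← heq]; exact Finset.mem_insert_self _ _
      have hcc : c = c' := by
        rcases Finset.mem_insert.1 h1 with h1 | h1
        · exact Sym2.congr_right.1 h1
        · exact absurd (Sym2.mem_mk_left a c) (hM' _ h1)
      subst hcc
      have n1 : s(a,c) ∉ M := fun hh => hM _ hh (Sym2.mem_mk_left a c)
      have n2 : s(a,c) ∉ M' := fun hh => hM' _ hh (Sym2.mem_mk_left a c)
      have : M = M' := by
        rw [← Finset.erase_insert n1, heq, Finset.erase_insert n2]
      rw [this]
    · intro M h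
      simp only [Finset.mem_filter, Finset.mem_univ, true_and] at h
      simp only [IsM, not_forall, not_not, Finset.mem_filter, Finset.mem_univ, true_and] at h
      obtain ⟨⟨h1, h2⟩, e, he, hae⟩ := h
      obtain ⟨c, rfl⟩ := Sym2.mem_iff_exists.1 hae
      have hac : G.Adj a c := (h1 _ he).1
      refine ⟨⟨c, M.erase s(a,c)⟩, ?_, Finset.insert_erase he⟩
      simp only [Finset.mem_filter, Finset.mem_univ, true_and, Finset.mem_sigma]
      simp only [IsM, Finset.mem_erase, Finset.mem_filter, Finset.mem_univ, true_and]
      refine ⟨⟨⟨hac.ne', (h1 _ he).2 c (Sym2.mem_mk_right a c)⟩, hac⟩, ?_, ?_⟩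
      · rintro f ⟨hne, hf⟩
        refine ⟨(h1 f hf).1, fun v hv => ⟨?_, ?_, (h1 f hf).2 v hv⟩⟩
        · rintro rfl
          exact h2 f hf _ he hne v hv (Sym2.mem_mk_right a v)
        · rintro rfl
          exact h2 f hf _ he hne v hv (Sym2.mem_mk_left v c)
      · rintro f ⟨_, hf⟩ g ⟨_, hg⟩
        exact h2 f hf g hg
    · rintro ⟨c, M⟩ h
      simp only [Finset.mem_filter, Finset.mem_univ, true_and, Finset.mem_sigma] at h
      simp only [IsM, Finset.mem_erase, Finset.mem_filter, Finset.mem_univ, true_and] at h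
      have n1 : s(a,c) ∉ M := fun hh => ((h.2.1 _ hh).2 a (Sym2.mem_mk_left a c)).2.1 rfl
      rw [Finset.card_insert_of_notMem n1]
      have : S.filter (fun v => ∀ e ∈ insert s(a,c) M, v ∉ e) =
          ((S.erase a).erase c).filter (fun v => ∀ e ∈ M, v ∉ e) := by
        ext v
        simp only [Finset.mem_filter, Finset.mem_erase, Finset.forall_mem_insert, Sym2.mem_iff]
        tauto
      dsimp only
      rw [this]
      ring

theorem P_empty {R : Type*} [CommRing R] (G : SimpleGraph V) (x : V → R) : P G x ∅ = 1 := by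
  classical
  unfold P
  have : Finset.univ.filter (fun M : Finset (Sym2 V) => IsM G ∅ M) = {∅} := by
    ext M
    simp only [Finset.mem_filter, Finset.mem_univ, true_and]
    simp only [IsM, Finset.mem_singleton, Finset.mem_filter, Finset.mem_univ, true_and]
    constructor
    · rintro ⟨h1, -⟩
      apply Finset.eq_empty_of_forall_notMem
      intro e he
      induction e with
      | _ p q => exact absurd ((h1 _ he).2 p (Sym2.mem_mk_left p q)) (by simp)
    · rintro rfl; simp
  rw [this]
  simp

theorem matchingPolynomial_eq (G : SimpleGraph V) :
    matchingPolynomial G = P G (fun _ => (X : ℝ[X])) Finset.univ := by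
  classical
  unfold matchingPolynomial P
  have hF : Fintype.ofFinite V = ‹Fintype V› := Subsingleton.elim _ _
  simp only [hF]
  apply Finset.sum_congr
  · ext M
    simp [IsM]
  · intro M hM
    simp only [Finset.mem_filter, Finset.mem_univ, true_and] at hM
    simp only [IsM, Finset.mem_filter, Finset.mem_univ, true_and] at hM
    obtain ⟨h1, h2⟩ := hM
    congr 1
    rw [Finset.prod_const]
    congr 1
    have hc : (M.biUnion (fun e => e.toFinset)).card = 2 * M.card := by
      rw [Finset.card_biUnion]
      · rw [Finset.sum_congr rfl (g := fun _ => 2)]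
        · simp [mul_comm]
        · intro e he
          exact Sym2.card_toFinset_of_not_isDiag e (G.not_isDiag_of_mem_edgeSet (h1 e he).1)
      · intro e he f hf hne
        rw [Function.onFun, Finset.disjoint_left]
        intro v hv hv'
        exact h2 e he f hf hne v (Sym2.mem_toFinset.1 hv) (Sym2.mem_toFinset.1 hv')
    rw [← hc, Nat.card_eq_fintype_card, ← Finset.card_compl]
    congr 1
    ext v
    simp

open Classical in
theorem P_map {R : Type*} [CommRing R] {W : Type*} [Fintype W] [DecidableEq W]
    (H : SimpleGraph W) (G : SimpleGraph V) (φ : H ↪g G) (r : R) (T : Finset W) :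
    P H (fun _ => r) T = P G (fun _ => r) (T.map φ.toEmbedding) := by
  induction hn : T.card using Nat.strong_induction_on generalizing T with
  | _ n ih =>
  rcases T.eq_empty_or_nonempty with rfl | ⟨a, ha⟩
  · simp [P_empty]
  · have hlt : (T.erase a).card < n := hn ▸ Finset.card_erase_lt_of_mem ha
    rw [P_rec H _ T a ha, P_rec G _ (T.map φ.toEmbedding) (φ a) (by simpa using ha)]
    have e1 : (T.map φ.toEmbedding).erase (φ a) = (T.erase a).map φ.toEmbedding := by
      rw [Finset.map_erase]; rfl
    rw [e1, ← ih _ hlt _ rfl]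
    congr 1
    have e2 : ((T.erase a).map φ.toEmbedding).filter (fun c => G.Adj (φ a) c) =
        ((T.erase a).filter (fun c => H.Adj a c)).map φ.toEmbedding := by
      ext v
      simp only [Finset.mem_filter, Finset.mem_map]
      constructor
      · rintro ⟨⟨w, hw, rfl⟩, h⟩
        exact ⟨w, ⟨hw, φ.map_adj_iff.1 h⟩, rfl⟩
      · rintro ⟨w, ⟨hw, h⟩, rfl⟩
        exact ⟨⟨w, hw, rfl⟩, φ.map_adj_iff.2 h⟩
    rw [e2, Finset.sum_map]
    apply Finset.sum_congr rfl
    intro c _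
    rw [ih _ (lt_of_le_of_lt (Finset.card_erase_le) hlt) _ rfl, Finset.map_erase]

theorem P_congr {R : Type*} [CommRing R] (G : SimpleGraph V) (x y : V → R) (S : Finset V)
    (h : ∀ v ∈ S, x v = y v) : P G x S = P G y S := by
  unfold P
  apply Finset.sum_congr rfl
  intro M _
  congr 1
  apply Finset.prod_congr rfl
  intro v hv
  exact h v (Finset.mem_filter.1 hv).1

theorem P_shift {R : Type*} [CommRing R] (G : SimpleGraph V) (x : V → R) (s : R) (S : Finset V)
    (v : V) (hv : v ∈ S) :
    P G (Function.update x v (x v + s)) S = P G x S + s * P G x (S.erase v) := by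
  classical
  have hc : ∀ T : Finset V, v ∉ T → P G (Function.update x v (x v + s)) T = P G x T := by
    intro T hT
    apply P_congr
    intro w hw
    rw [Function.update_of_ne]
    rintro rfl
    exact hT hw
  rw [P_rec G _ S v hv, P_rec G x S v hv, hc _ (Finset.notMem_erase _ _)]
  rw [Finset.sum_congr rfl (fun c _ => hc _ (by simp))]
  simp
  ring

/-- Heilmann-Lieb inequality. -/
theorem HL (G : SimpleGraph V) (x : V → ℝ) (S : Finset V) (a b : V) (ha : a ∈ S) (hb : b ∈ S)
    (hab : a ≠ b) :
    0 ≤ P G x (S.erase a) * P G x (S.erase b) - P G x S * P G x ((S.erase a).erase b) := by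
  classical
  induction hn : S.card using Nat.strong_induction_on generalizing S a b with
  | _ n ih =>
  have hlt : (S.erase a).card < n := hn ▸ Finset.card_erase_lt_of_mem ha
  have hbA : b ∈ S.erase a := Finset.mem_erase.2 ⟨hab.symm, hb⟩
  rw [P_rec G x S a ha, P_rec G x (S.erase b) a (Finset.mem_erase.2 ⟨hab, ha⟩)]
  set A := S.erase a with hA
  have e0 : (S.erase b).erase a = A.erase b := Finset.erase_right_comm
  rw [e0]
  have e1 : (A.erase b).filter (fun c => G.Adj a c) = (A.filter (fun c => G.Adj a c)).erase b := by
    ext v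
    simp only [Finset.mem_filter, Finset.mem_erase]
    tauto
  rw [e1]
  set N := A.filter (fun c => G.Adj a c) with hN
  have hterm : 0 ≤ ∑ c ∈ N.erase b, (P G x (A.erase c) * P G x (A.erase b)
      - P G x A * P G x ((A.erase b).erase c)) := by
    apply Finset.sum_nonneg
    intro c hc
    have hc' := Finset.mem_erase.1 hc
    have := ih _ hlt A b c hbA (Finset.mem_filter.1 hc'.2).1 hc'.1.symm rfl
    linarith
  rw [Finset.sum_sub_distrib, ← Finset.sum_mul, ← Finset.mul_sum] at hterm
  by_cases hbN : b ∈ N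
  · rw [← Finset.add_sum_erase N _ hbN]
    nlinarith [sq_nonneg (P G x (A.erase b))]
  · rw [Finset.erase_eq_of_notMem hbN] at hterm ⊢
    nlinarith

/-- the univariate polynomial -/
noncomputable def F (G : SimpleGraph V) (S : Finset V) : ℝ[X] := P G (fun _ => (X : ℝ[X])) S

open Classical in
theorem F_rec (G : SimpleGraph V) (S : Finset V) (a : V) (ha : a ∈ S) :
    F G S = X * F G (S.erase a) -
      ∑ c ∈ (S.erase a).filter (fun c => G.Adj a c), F G ((S.erase a).erase c) :=
  P_rec G _ S a ha

theorem F_eval (G : SimpleGraph V) (S : Finset V) (t : ℝ) :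
    (F G S).eval t = P G (fun _ => t) S := by
  unfold F P
  simp [Polynomial.eval_finsetSum, Polynomial.eval_prod]

theorem F_coeff (G : SimpleGraph V) (S : Finset V) (k : ℕ) (hk : S.card ≤ k) :
    (F G S).coeff k = if k = S.card then 1 else 0 := by
  classical
  induction hn : S.card using Nat.strong_induction_on generalizing S k with
  | _ n ih =>
  rcases S.eq_empty_or_nonempty with rfl | ⟨a, ha⟩
  · simp at hn
    subst hn
    simp [F, P_empty, Polynomial.coeff_one]
  · have hc := Finset.card_erase_of_mem ha
    have hpos : 0 < S.card := Finset.card_pos.2 ⟨a, ha⟩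
    obtain ⟨k, rfl⟩ : ∃ j, k = j + 1 := ⟨k - 1, by omega⟩
    rw [F_rec G S a ha, Polynomial.coeff_sub, Polynomial.coeff_X_mul,
      ih _ (by omega) (S.erase a) k (by omega) rfl, Polynomial.finsetSum_coeff,
      Finset.sum_eq_zero]
    · have : (k = (S.erase a).card) ↔ (k + 1 = n) := by omega
      simp [this]
    · intro c hc'
      have h2 := Finset.card_erase_of_mem (Finset.mem_filter.1 hc').1
      have h3 : 0 < (S.erase a).card := Finset.card_pos.2 ⟨c, (Finset.mem_filter.1 hc').1⟩
      rw [ih _ (by omega) ((S.erase a).erase c) (k+1) (by omega) rfl, if_neg (by omega)]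

theorem F_ne (G : SimpleGraph V) (S : Finset V) : F G S ≠ 0 := by
  intro h
  have := F_coeff G S _ le_rfl
  simp [h] at this

open Classical in
theorem F_deriv (G : SimpleGraph V) (S : Finset V) :
    derivative (F G S) = ∑ a ∈ S, F G (S.erase a) := by
  induction hn : S.card using Nat.strong_induction_on generalizing S with
  | _ n ih =>
  rcases S.eq_empty_or_nonempty with rfl | ⟨a, ha⟩
  · simp [F, P_empty]
  · have hlt : (S.erase a).card < n := hn ▸ Finset.card_erase_lt_of_mem ha
    rw [F_rec G S a ha]
    simp only [Polynomial.derivative_sub, Polynomial.derivative_mul, Polynomial.derivative_X,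
      one_mul, Polynomial.derivative_sum]
    rw [ih _ hlt _ rfl, ← Finset.add_sum_erase S _ ha, add_sub_assoc]
    congr 1
    rw [Finset.sum_congr rfl (fun c _ => ih _ (lt_of_le_of_lt (Finset.card_erase_le) hlt) _ rfl)]
    set A := S.erase a with hA
    have hb : ∀ b ∈ A, F G (S.erase b) = X * F G (A.erase b) -
        ∑ c ∈ (A.erase b).filter (fun c => G.Adj a c), F G ((A.erase b).erase c) := by
      intro b hb
      have hb' := Finset.mem_erase.1 hb
      rw [F_rec G (S.erase b) a (Finset.mem_erase.2 ⟨hb'.1.symm, ha⟩),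
        Finset.erase_right_comm (a := b)]
    rw [Finset.sum_congr rfl hb, Finset.sum_sub_distrib, ← Finset.mul_sum]
    congr 1
    rw [Finset.sum_sigma', Finset.sum_sigma']
    refine Finset.sum_bij' (fun p _ => ⟨p.2, p.1⟩) (fun p _ => ⟨p.2, p.1⟩) ?_ ?_ ?_ ?_ ?_
    · rintro ⟨c, b⟩ h
      simp only [Finset.mem_sigma, Finset.mem_filter, Finset.mem_erase] at h ⊢
      tauto
    · rintro ⟨c, b⟩ h
      simp only [Finset.mem_sigma, Finset.mem_filter, Finset.mem_erase] at h ⊢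
      tauto
    · rintro ⟨c, b⟩ h; rfl
    · rintro ⟨c, b⟩ h; rfl
    · rintro ⟨c, b⟩ h
      dsimp only
      rw [Finset.erase_right_comm]

theorem F_mul (G : SimpleGraph V) (S T : Finset V) (hd : Disjoint S T)
    (h : ∀ a ∈ S, ∀ b ∈ T, ¬ G.Adj a b) : F G (S ∪ T) = F G S * F G T := by
  classical
  induction hn : S.card using Nat.strong_induction_on generalizing S with
  | _ n ih =>
  rcases S.eq_empty_or_nonempty with rfl | ⟨a, ha⟩
  · simp [F, P_empty]
  · have hlt : (S.erase a).card < n := hn ▸ Finset.card_erase_lt_of_mem ha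
    have hT : ∀ v ∈ S, v ∉ T := fun v hv => Finset.disjoint_left.1 hd hv
    have step : ∀ S' ⊆ S, S'.card < n → F G (S' ∪ T) = F G S' * F G T := fun S' hs hc =>
      ih _ hc S' (Finset.disjoint_of_subset_left hs hd) (fun a ha => h a (hs ha)) rfl
    have e1 : (S ∪ T).erase a = S.erase a ∪ T := by
      rw [Finset.erase_union_distrib, Finset.erase_eq_of_notMem (hT a ha)]
    have e2 : (S.erase a ∪ T).filter (fun c => G.Adj a c) =
        (S.erase a).filter (fun c => G.Adj a c) := by
      ext c
      simp only [Finset.mem_filter, Finset.mem_union]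
      have := h a ha c
      tauto
    rw [F_rec G (S ∪ T) a (Finset.mem_union_left _ ha), e1, e2, F_rec G S a ha,
      step _ (Finset.erase_subset _ _) hlt, sub_mul, Finset.sum_mul, mul_assoc]
    congr 1
    apply Finset.sum_congr rfl
    intro c hc
    have hcS := (Finset.mem_erase.1 (Finset.mem_filter.1 hc).1).2
    rw [Finset.erase_union_distrib, Finset.erase_eq_of_notMem (hT c hcS)]
    exact step _ ((Finset.erase_subset _ _).trans (Finset.erase_subset _ _))
      (lt_of_le_of_lt (Finset.card_erase_le) hlt)

theorem F_HL (G : SimpleGraph V) (S : Finset V) (a b : V) (ha : a ∈ S) (hb : b ∈ S)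
    (hab : a ≠ b) (t : ℝ) :
    0 ≤ (F G (S.erase a) * F G (S.erase b) - F G S * F G ((S.erase a).erase b)).eval t := by
  simp only [Polynomial.eval_sub, Polynomial.eval_mul, F_eval]
  exact HL G _ S a b ha hb hab

theorem F_HL2 (G : SimpleGraph V) (S : Finset V) (v a b : V) (hv : v ∈ S) (ha : a ∈ S) (hb : b ∈ S)
    (hab : a ≠ b) (hva : v ≠ a) (hvb : v ≠ b) (t s : ℝ) :
    0 ≤ (F G (S.erase a) * F G (S.erase b) - F G S * F G ((S.erase a).erase b)).eval t
      + s * (F G (S.erase a) * F G ((S.erase v).erase b) + F G ((S.erase v).erase a) * F G (S.erase b)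
          - F G S * F G (((S.erase v).erase a).erase b)
          - F G (S.erase v) * F G ((S.erase a).erase b)).eval t
      + s * s * (F G ((S.erase v).erase a) * F G ((S.erase v).erase b)
          - F G (S.erase v) * F G (((S.erase v).erase a).erase b)).eval t := by
  have h := HL G (Function.update (fun _ => t) v (t + s)) S a b ha hb hab
  have e : ∀ T : Finset V, v ∈ T → P G (Function.update (fun _ => t) v (t + s)) T =
      (F G T).eval t + s * (F G (T.erase v)).eval t := by
    intro T hT
    rw [F_eval, F_eval]
    exact P_shift G (fun _ => t) s T v hT
  rw [e _ hv, e _ (Finset.mem_erase.2 ⟨hva, hv⟩), e _ (Finset.mem_erase.2 ⟨hvb, hv⟩),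
    e _ (Finset.mem_erase.2 ⟨hvb, Finset.mem_erase.2 ⟨hva, hv⟩⟩)] at h
  rw [Finset.erase_right_comm (s := S.erase a) (a := b) (b := v),
    Finset.erase_right_comm (s := S) (a := a) (b := v),
    Finset.erase_right_comm (s := S) (a := b) (b := v)] at h
  simp only [Polynomial.eval_sub, Polynomial.eval_mul, Polynomial.eval_add]
  linarith

/-! ### orders of vanishing -/

/-- order of vanishing at `θ` -/
noncomputable def r (G : SimpleGraph V) (θ : ℝ) (S : Finset V) : ℕ :=
  rootMultiplicity θ (F G S)

theorem nonneg_lemma (θ : ℝ) (k : ℕ) (q : ℝ[X])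
    (h : ∀ t : ℝ, 0 ≤ ((X - C θ) ^ k * q).eval t) :
    0 ≤ q.eval θ ∧ (Odd k → q.eval θ = 0) := by
  have hcont : Continuous (fun t => q.eval t) := q.continuous
  have h1 : 0 ≤ q.eval θ := by
    have ht : Filter.Tendsto (fun t => q.eval t) (nhdsWithin θ (Set.Ioi θ)) (nhds (q.eval θ)) :=
      (hcont.tendsto θ).mono_left nhdsWithin_le_nhds
    refine ge_of_tendsto ht ?_
    filter_upwards [self_mem_nhdsWithin] with t ht
    have h2 := h t
    simp only [eval_mul, eval_pow, eval_sub, eval_X, eval_C] at h2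
    exact nonneg_of_mul_nonneg_right h2 (pow_pos (sub_pos.2 ht) k)
  refine ⟨h1, fun hk => le_antisymm ?_ h1⟩
  have ht : Filter.Tendsto (fun t => q.eval t) (nhdsWithin θ (Set.Iio θ)) (nhds (q.eval θ)) :=
    (hcont.tendsto θ).mono_left nhdsWithin_le_nhds
  refine le_of_tendsto ht ?_
  filter_upwards [self_mem_nhdsWithin] with t ht
  have h2 := h t
  simp only [eval_mul, eval_pow, eval_sub, eval_X, eval_C] at h2
  have h3 : (t - θ) ^ k < 0 := hk.pow_neg (sub_neg.2 ht)
  by_contra hc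
  push Not at hc
  nlinarith

/-- cofactor -/
noncomputable def q (G : SimpleGraph V) (θ : ℝ) (S : Finset V) : ℝ[X] :=
  F G S /ₘ (X - C θ) ^ r G θ S

theorem F_eq (G : SimpleGraph V) (θ : ℝ) (S : Finset V) :
    F G S = (X - C θ) ^ r G θ S * q G θ S :=
  (pow_mul_divByMonic_rootMultiplicity_eq (F G S) θ).symm

/-- leading coefficient at `θ` -/
noncomputable def lc (G : SimpleGraph V) (θ : ℝ) (S : Finset V) : ℝ := (q G θ S).eval θ

theorem lc_ne (G : SimpleGraph V) (θ : ℝ) (S : Finset V) : lc G θ S ≠ 0 :=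
  eval_divByMonic_pow_rootMultiplicity_ne_zero θ (F_ne G S)

theorem le_r_iff (G : SimpleGraph V) (θ : ℝ) (S : Finset V) (k : ℕ) :
    k ≤ r G θ S ↔ (X - C θ) ^ k ∣ F G S := le_rootMultiplicity_iff (F_ne G S)

theorem le_r_of_rec (G : SimpleGraph V) (θ : ℝ) (S : Finset V) (a : V) (ha : a ∈ S) (k : ℕ)
    (h1 : k ≤ r G θ (S.erase a))
    (h2 : ∀ c ∈ S.erase a, G.Adj a c → k ≤ r G θ ((S.erase a).erase c)) :
    k ≤ r G θ S := by
  classical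
  rw [le_r_iff, F_rec G S a ha]
  apply dvd_sub
  · exact Dvd.dvd.mul_left ((le_r_iff _ _ _ _).1 h1) _
  · apply Finset.dvd_sum
    intro c hc
    rw [Finset.mem_filter] at hc
    exact (le_r_iff _ _ _ _).1 (h2 c hc.1 hc.2)

theorem wronskian (G : SimpleGraph V) (S : Finset V) (a : V) (ha : a ∈ S) (t : ℝ) :
    0 ≤ (derivative (F G S) * F G (S.erase a) - F G S * derivative (F G (S.erase a))
      - F G (S.erase a) ^ 2).eval t := by
  classical
  rw [F_deriv, F_deriv, ← Finset.add_sum_erase S _ ha]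
  have : (F G (S.erase a) + ∑ b ∈ S.erase a, F G (S.erase b)) * F G (S.erase a) -
      F G S * (∑ b ∈ S.erase a, F G ((S.erase a).erase b)) - F G (S.erase a) ^ 2 =
      ∑ b ∈ S.erase a, (F G (S.erase a) * F G (S.erase b) - F G S * F G ((S.erase a).erase b)) := by
    rw [Finset.sum_sub_distrib, ← Finset.mul_sum, ← Finset.mul_sum]
    ring
  rw [this, eval_finsetSum]
  apply Finset.sum_nonneg
  intro b hb
  have hb' := Finset.mem_erase.1 hb
  exact F_HL G S a b ha hb'.2 hb'.1.symm t

theorem T_deriv (θ : ℝ) (m : ℕ) (p : ℝ[X]) :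
    (X - C θ) * derivative ((X - C θ) ^ m * p) =
      (X - C θ) ^ m * (C (m : ℝ) * p + (X - C θ) * derivative p) := by
  rw [derivative_mul, derivative_X_sub_C_pow]
  cases m with
  | zero => simp
  | succ n => simp only [Nat.add_sub_cancel, map_natCast]; ring

theorem L2a (G : SimpleGraph V) (θ : ℝ) (S : Finset V) (a : V) (ha : a ∈ S) :
    r G θ S ≤ r G θ (S.erase a) + 1 ∧
    (r G θ S ≠ r G θ (S.erase a) →
      0 < ((r G θ S : ℝ) - r G θ (S.erase a)) * (lc G θ S * lc G θ (S.erase a))) := by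
  have hW := wronskian G S a ha
  have e1 := F_eq G θ S
  have e2 := F_eq G θ (S.erase a)
  have n1 := lc_ne G θ S
  have n2 := lc_ne G θ (S.erase a)
  unfold lc at *
  generalize r G θ S = m at *
  generalize r G θ (S.erase a) = k at *
  generalize q G θ S = p at *
  generalize q G θ (S.erase a) = s at *
  rw [e1, e2] at hW
  set D : ℝ[X] := X - C θ with hD
  set Q : ℝ[X] := (C (m : ℝ) * p + D * derivative p) * s - p * (C (k : ℝ) * s + D * derivative s)
    with hQ
  have hDθ : D.eval θ = 0 := by simp [hD]
  have hQθ : Q.eval θ = ((m : ℝ) - k) * (p.eval θ * s.eval θ) := by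
    simp only [hQ, eval_sub, eval_mul, eval_add, hDθ, eval_C]; ring
  have key : D ^ 2 * (derivative (D ^ m * p) * (D ^ k * s) - D ^ m * p * derivative (D ^ k * s)
      - (D ^ k * s) ^ 2) = D ^ (m + k + 1) * Q - D ^ (2 * k + 2) * s ^ 2 := by
    have t1 := T_deriv θ m p
    have t2 := T_deriv θ k s
    rw [← hD] at t1 t2
    have : D ^ 2 * (derivative (D ^ m * p) * (D ^ k * s) - D ^ m * p * derivative (D ^ k * s)
      - (D ^ k * s) ^ 2) = D * ((D * derivative (D ^ m * p)) * (D ^ k * s) -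
        D ^ m * p * (D * derivative (D ^ k * s))) - D ^ 2 * (D ^ k * s) ^ 2 := by ring
    rw [this, t1, t2, hQ]
    ring
  have hpos : ∀ t : ℝ, 0 ≤ (D ^ (m + k + 1) * Q - D ^ (2 * k + 2) * s ^ 2).eval t := by
    intro t
    rw [← key, eval_mul]
    exact mul_nonneg (by rw [eval_pow]; exact sq_nonneg _) (hW t)
  have hpos2 : ∀ t : ℝ, 0 ≤ (D ^ (m + k + 1) * Q).eval t := by
    intro t
    have h1 := hpos t
    have h2 : 0 ≤ (D ^ (2 * k + 2) * s ^ 2).eval t := by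
      have : D ^ (2 * k + 2) * s ^ 2 = (D ^ (k + 1) * s) ^ 2 := by ring
      rw [this, eval_pow]
      exact sq_nonneg _
    rw [eval_sub] at h1
    linarith
  have hN := nonneg_lemma θ _ Q hpos2
  rw [hQθ] at hN
  constructor
  · by_contra hc
    push Not at hc
    obtain ⟨j, rfl⟩ : ∃ j, m = k + 2 + j := ⟨m - (k + 2), by omega⟩
    have : D ^ (k + 2 + j + k + 1) * Q - D ^ (2 * k + 2) * s ^ 2 =
        D ^ (2 * k + 2) * (D ^ (j + 1) * Q - s ^ 2) := by ring
    rw [this] at hpos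
    have h3 := (nonneg_lemma θ _ _ hpos).1
    rw [eval_sub, eval_mul, eval_pow, hDθ, eval_pow] at h3
    have h4 : 0 < (s.eval θ) ^ 2 := by positivity
    simp at h3
    exact n2 h3
  · intro hne
    have : ((m : ℝ) - k) ≠ 0 := sub_ne_zero.2 (by exact_mod_cast hne)
    exact lt_of_le_of_ne hN.1 (mul_ne_zero this (mul_ne_zero n1 n2)).symm

theorem L2b (G : SimpleGraph V) (θ : ℝ) (S : Finset V) (a : V) (ha : a ∈ S) :
    r G θ (S.erase a) ≤ r G θ S + 1 := by
  have : r G θ (S.erase a) - 1 ≤ r G θ S := by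
    apply le_r_of_rec G θ S a ha
    · omega
    · intro c hc _
      have := (L2a G θ (S.erase a) c hc).1
      omega
  omega

/-- essential -/
def E (G : SimpleGraph V) (θ : ℝ) (S : Finset V) (a : V) : Prop :=
  r G θ (S.erase a) + 1 = r G θ S

theorem not_E (G : SimpleGraph V) (θ : ℝ) (S : Finset V) (a : V) (ha : a ∈ S) :
    ¬ E G θ S a ↔ r G θ S ≤ r G θ (S.erase a) := by
  have := (L2a G θ S a ha).1
  unfold E
  omega

theorem E_lc (G : SimpleGraph V) (θ : ℝ) (S : Finset V) (a : V) (ha : a ∈ S) (h : E G θ S a) :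
    0 < lc G θ S * lc G θ (S.erase a) := by
  unfold E at h
  have := (L2a G θ S a ha).2 (by omega)
  rw [← h] at this
  push_cast at this
  linarith

theorem L3 (G : SimpleGraph V) (θ : ℝ) (S : Finset V) (a b : V) (ha : a ∈ S) (hb : b ∈ S)
    (hab : a ≠ b) (hE : E G θ S a) (hn : ¬ E G θ S b) : E G θ (S.erase b) a := by
  by_contra hc
  have haB : a ∈ S.erase b := Finset.mem_erase.2 ⟨hab, ha⟩
  rw [not_E _ _ _ _ haB, Finset.erase_right_comm] at hc
  have hp := E_lc G θ S a ha hE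
  rw [not_E _ _ _ _ hb] at hn
  have hn2 := L2b G θ S b hb
  have hneg := (L2a G θ S b hb).2
  unfold E at hE
  have hR := F_HL G S a b ha hb hab
  have n1 := lc_ne G θ (S.erase a)
  have n2 := lc_ne G θ (S.erase b)
  rw [F_eq G θ S, F_eq G θ (S.erase a), F_eq G θ (S.erase b), F_eq G θ ((S.erase a).erase b)] at hR
  unfold lc at *
  generalize q G θ S = p at *
  generalize q G θ (S.erase a) = pa at *
  generalize q G θ (S.erase b) = pb at *
  generalize q G θ ((S.erase a).erase b) = pab at *
  generalize r G θ (S.erase a) = l at *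
  generalize r G θ S = m at *
  generalize r G θ (S.erase b) = k at *
  generalize r G θ ((S.erase a).erase b) = j at *
  subst hE
  obtain ⟨i, rfl⟩ : ∃ i, j = k + i := ⟨j - k, by omega⟩
  have e : (X - C θ) ^ l * pa * ((X - C θ) ^ k * pb) -
      (X - C θ) ^ (l + 1) * p * ((X - C θ) ^ (k + i) * pab) =
      (X - C θ) ^ (l + k) * (pa * pb - (X - C θ) ^ (i + 1) * (p * pab)) := by ring
  rw [e] at hR
  have hN := nonneg_lemma θ _ _ hR
  simp only [eval_sub, eval_mul, eval_pow, eval_X, eval_C, sub_self, ne_eq, Nat.succ_ne_zero,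
    not_false_eq_true, zero_pow, zero_mul, sub_zero] at hN
  rcases (by omega : k = l + 1 ∨ k = l + 1 + 1) with rfl | rfl
  · have := hN.2 ⟨l, by ring⟩
    exact mul_ne_zero n1 n2 this
  · have h1 := hneg (by omega)
    push_cast at h1
    have h2 : (eval θ p * eval θ pa) * (eval θ p * eval θ pb) < 0 := by nlinarith
    nlinarith [sq_nonneg (eval θ p), hN.1]

theorem L4 (G : SimpleGraph V) (θ : ℝ) (S : Finset V) (s v : V) (hs : s ∈ S)
    (hv : v ∈ S.erase s) (hadj : G.Adj s v) (hE : E G θ (S.erase s) v) :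
    r G θ S + 1 = r G θ (S.erase s) := by
  classical
  have hb := L2b G θ S s hs
  by_contra hc
  have hge : r G θ (S.erase s) ≤ r G θ S := by omega
  obtain ⟨k, hk⟩ : ∃ k, r G θ (S.erase s) = k + 1 := ⟨_, hE.symm⟩
  have hg : ∀ c ∈ (S.erase s).filter (fun c => G.Adj s c), ∃ g : ℝ[X],
      F G ((S.erase s).erase c) = (X - C θ) ^ k * g ∧ 0 ≤ lc G θ (S.erase s) * g.eval θ ∧
      (c = v → 0 < lc G θ (S.erase s) * g.eval θ) := by
    intro c hc
    have hcS := (Finset.mem_filter.1 hc).1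
    by_cases hEc : E G θ (S.erase s) c
    · have hp := E_lc _ _ _ _ hcS hEc
      refine ⟨q G θ ((S.erase s).erase c), ?_, hp.le, fun _ => hp⟩
      have : r G θ ((S.erase s).erase c) = k := by unfold E at hEc; omega
      rw [← this]
      exact F_eq _ _ _
    · have hEc' := hEc
      rw [not_E _ _ _ _ hcS, hk, le_r_iff] at hEc'
      obtain ⟨g, hg⟩ := hEc'
      refine ⟨(X - C θ) * g, ?_, ?_, ?_⟩
      · rw [hg]; ring
      · simp
      · rintro rfl
        exact absurd hE hEc
  choose! g hg1 hg2 hg3 using hg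
  have hdvd : (X - C θ) ^ (k + 1) ∣
      ∑ c ∈ (S.erase s).filter (fun c => G.Adj s c), F G ((S.erase s).erase c) := by
    have h1 : (X - C θ) ^ (k + 1) ∣ F G S := by rw [← le_r_iff]; omega
    have h2 : (X - C θ) ^ (k + 1) ∣ X * F G (S.erase s) :=
      Dvd.dvd.mul_left ((le_r_iff _ _ _ _).1 (by omega)) _
    rw [F_rec G S s hs] at h1
    have := dvd_sub h2 h1
    simpa using this
  rw [Finset.sum_congr rfl hg1, ← Finset.mul_sum, pow_succ] at hdvd
  have h3 := (mul_dvd_mul_iff_left (pow_ne_zero k (X_sub_C_ne_zero θ))).1 hdvd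
  rw [dvd_iff_isRoot, IsRoot, eval_finsetSum] at h3
  have h4 : 0 < ∑ c ∈ (S.erase s).filter (fun c => G.Adj s c),
      lc G θ (S.erase s) * (g c).eval θ := by
    apply Finset.sum_pos' hg2
    have hvN : v ∈ (S.erase s).filter (fun c => G.Adj s c) := Finset.mem_filter.2 ⟨hv, hadj⟩
    exact ⟨v, hvN, hg3 v hvN rfl⟩
  rw [← Finset.mul_sum, h3] at h4
  simp at h4

theorem L6 (G : SimpleGraph V) (θ : ℝ) (S : Finset V) (v a b : V) (hv : v ∈ S) (ha : a ∈ S)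
    (hb : b ∈ S) (hab : a ≠ b) (hva : v ≠ a) (hvb : v ≠ b)
    (Ev : E G θ S v) (Ea : E G θ S a) (Eb : E G θ S b)
    (h1 : ¬ E G θ (S.erase v) a) (h2 : ¬ E G θ (S.erase v) b) : ¬ E G θ (S.erase a) b := by
  intro Eab
  have hav : a ∈ S.erase v := Finset.mem_erase.2 ⟨hva.symm, ha⟩
  have hbv : b ∈ S.erase v := Finset.mem_erase.2 ⟨hvb.symm, hb⟩
  have hbva : b ∈ (S.erase v).erase a := Finset.mem_erase.2 ⟨hab.symm, hbv⟩
  rw [not_E _ _ _ _ hav] at h1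
  rw [not_E _ _ _ _ hbv] at h2
  have h3 := (L2a G θ _ b hbva).1
  unfold E at *
  have hR := F_HL2 G S v a b hv ha hb hab hva hvb
  have n1 := lc_ne G θ (S.erase v)
  have n2 := lc_ne G θ ((S.erase a).erase b)
  obtain ⟨l, hl⟩ : ∃ l, r G θ ((S.erase a).erase b) = l := ⟨_, rfl⟩
  have rv : r G θ (S.erase v) = l + 1 := by omega
  obtain ⟨f, hf⟩ := (le_r_iff G θ S (l + 2)).1 (by omega)
  obtain ⟨fa, hfa⟩ := (le_r_iff G θ (S.erase a) (l + 1)).1 (by omega)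
  obtain ⟨fb, hfb⟩ := (le_r_iff G θ (S.erase b) (l + 1)).1 (by omega)
  obtain ⟨fva, hfva⟩ := (le_r_iff G θ ((S.erase v).erase a) (l + 1)).1 (by omega)
  obtain ⟨fvb, hfvb⟩ := (le_r_iff G θ ((S.erase v).erase b) (l + 1)).1 (by omega)
  obtain ⟨fvab, hfvab⟩ := (le_r_iff G θ (((S.erase v).erase a).erase b) l).1 (by omega)
  have hfv := F_eq G θ (S.erase v)
  have hfab := F_eq G θ ((S.erase a).erase b)
  rw [rv] at hfv
  rw [hl] at hfab
  unfold lc at n1 n2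
  generalize q G θ (S.erase v) = fv at *
  generalize q G θ ((S.erase a).erase b) = fab at *
  rw [hf, hfa, hfb, hfva, hfvb, hfvab, hfv, hfab] at hR
  set D : ℝ[X] := X - C θ with hD
  have hDθ : D.eval θ = 0 := by simp [hD]
  set A' : ℝ[X] := fa * fb - f * fab with hA'
  set B' : ℝ[X] := D * (fa * fvb + fva * fb - f * fvab) - fv * fab with hB'
  set C' : ℝ[X] := D * (fva * fvb) - fv * fvab with hC'
  have eA : D ^ (l + 1) * fa * (D ^ (l + 1) * fb) - D ^ (l + 2) * f * (D ^ l * fab)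
    = D ^ (2 * l + 2) * A' := by rw [hA']; ring
  have eB : D ^ (l + 1) * fa * (D ^ (l + 1) * fvb) + D ^ (l + 1) * fva * (D ^ (l + 1) * fb) -
      D ^ (l + 2) * f * (D ^ l * fvab) - D ^ (l + 1) * fv * (D ^ l * fab)
    = D ^ (2 * l + 1) * B' := by rw [hB']; ring
  have eC : D ^ (l + 1) * fva * (D ^ (l + 1) * fvb) - D ^ (l + 1) * fv * (D ^ l * fvab)
    = D ^ (2 * l + 1) * C' := by rw [hC']; ring
  rw [eA, eB, eC] at hR
  have hpos : ∀ t : ℝ, 0 ≤ (D ^ (4 * l + 2) * (4 * D * A' * C' - B' ^ 2)).eval t := by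
    intro t
    have hd := discrim_le_zero (a := (D ^ (2 * l + 1) * C').eval t)
      (b := (D ^ (2 * l + 1) * B').eval t) (c := (D ^ (2 * l + 2) * A').eval t)
      (fun s => by have := hR t s; linarith)
    unfold discrim at hd
    have e : D ^ (4 * l + 2) * (4 * D * A' * C' - B' ^ 2) =
      4 * (D ^ (2 * l + 1) * C') * (D ^ (2 * l + 2) * A') - (D ^ (2 * l + 1) * B') ^ 2 := by ring
    rw [e, eval_sub, eval_mul, eval_mul, eval_pow]
    have : eval t (4 : ℝ[X]) = 4 := eval_ofNat _ _
    rw [this]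
    linarith
  have h4 := (nonneg_lemma θ _ _ hpos).1
  have hBθ : B'.eval θ = - (fv.eval θ * fab.eval θ) := by
    simp only [hB', eval_sub, eval_mul, hDθ]; ring
  simp only [eval_sub, eval_mul, hDθ, eval_pow, hBθ] at h4
  have h5 : 0 < (fv.eval θ * fab.eval θ) ^ 2 := by
    have := mul_ne_zero n1 n2
    positivity
  simp at h4
  exact h4.elim n1 n2

theorem special_pos (G : SimpleGraph V) (θ : ℝ) (S : Finset V) (u w : V) (hu : u ∈ S) (hw : w ∈ S)
    (hadj : G.Adj u w) (hEw : E G θ S w) (hEu : ¬ E G θ S u) :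
    E G θ (S.erase u) w ∧ r G θ S + 1 = r G θ (S.erase u) := by
  have h := L3 G θ S w u hw hu hadj.ne' hEw hEu
  exact ⟨h, L4 G θ S u w hu (Finset.mem_erase.2 ⟨hadj.ne', hw⟩) hadj h⟩

theorem L5 (G : SimpleGraph V) (θ : ℝ) (S : Finset V) (u w v : V) (hu : u ∈ S) (hw : w ∈ S)
    (hv : v ∈ S) (huv : u ≠ v)
    (hadj : G.Adj u w) (hEw : E G θ S w) (hEu : ¬ E G θ S u) (hEv : ¬ E G θ S v) :
    ¬ E G θ (S.erase u) v := by
  intro hcon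
  obtain ⟨hw1, hm⟩ := special_pos G θ S u w hu hw hadj hEw hEu
  have hwv : w ≠ v := by rintro rfl; exact hEv hEw
  have hvu : v ∈ S.erase u := Finset.mem_erase.2 ⟨huv.symm, hv⟩
  have hwu : w ∈ S.erase u := Finset.mem_erase.2 ⟨hadj.ne', hw⟩
  have huv' : u ∈ S.erase v := Finset.mem_erase.2 ⟨huv, hu⟩
  have par : ∀ c ∈ S, c ≠ v → G.Adj u c → ¬ E G θ ((S.erase u).erase v) c := by
    intro c hc hcv hac hE
    have h := L4 G θ (S.erase v) u c huv'
      (Finset.mem_erase.2 ⟨hac.ne', Finset.mem_erase.2 ⟨hcv, hc⟩⟩) hac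
      (by rw [Finset.erase_right_comm]; exact hE)
    rw [Finset.erase_right_comm] at h
    rw [not_E _ _ _ _ hv] at hEv
    unfold E at hcon
    omega
  have main : r G θ S ≤ r G θ (S.erase w) := by
    have huw : u ∈ S.erase w := Finset.mem_erase.2 ⟨hadj.ne, hu⟩
    apply le_r_of_rec G θ _ u huw
    · rw [Finset.erase_right_comm]
      unfold E at hw1
      omega
    · intro c hc hac
      rw [Finset.erase_right_comm (a := w)] at hc ⊢
      have hc1 := Finset.mem_erase.1 hc
      have hcS := (Finset.mem_erase.1 hc1.2).2
      by_cases hcv : c = v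
      · subst hcv
        have h := par w hw hwv hadj
        rw [not_E _ _ _ _ (Finset.mem_erase.2 ⟨hwv, hwu⟩),
          Finset.erase_right_comm (s := S.erase u)] at h
        unfold E at hcon
        omega
      · by_cases hEc : E G θ (S.erase u) c
        · have h := L6 G θ (S.erase u) v w c hvu hwu hc1.2 hc1.1.symm hwv.symm (Ne.symm hcv)
            hcon hw1 hEc (par w hw hwv hadj) (par c hcS hcv hac)
          rw [not_E _ _ _ _ hc] at h
          unfold E at hw1
          omega
        · have h := L3 G θ (S.erase u) w c hwu hc1.2 hc1.1.symm hw1 hEc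
          rw [not_E _ _ _ _ hc1.2] at hEc
          unfold E at h
          rw [Finset.erase_right_comm (s := S.erase u)] at h
          omega
  unfold E at hEw
  omega

theorem r_sdiff (G : SimpleGraph V) (θ : ℝ) (T : Finset V) : ∀ S : Finset V, T ⊆ S →
    r G θ S ≤ r G θ (S \ T) + T.card := by
  induction T using Finset.induction_on with
  | empty => intro S _; simp
  | insert a T ha ih =>
    intro S hT
    have haS : a ∈ S := hT (Finset.mem_insert_self _ _)
    have h1 := ih S ((Finset.subset_insert _ _).trans hT)
    have h2 := (L2a G θ (S \ T) a (Finset.mem_sdiff.2 ⟨haS, ha⟩)).1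
    rw [Finset.card_insert_of_notMem ha, Finset.sdiff_insert]
    omega

theorem indep_E (G : SimpleGraph V) (θ : ℝ) (S T : Finset V) (hT : T ⊆ S)
    (h : r G θ (S \ T) + T.card = r G θ S) (a : V) (ha : a ∈ T) : E G θ S a := by
  have h1 := (L2a G θ S a (hT ha)).1
  have h2 := r_sdiff G θ (T.erase a) (S.erase a) (Finset.erase_subset_erase a hT)
  have e : S.erase a \ T.erase a = S \ T := by
    ext v
    simp only [Finset.mem_sdiff, Finset.mem_erase]
    by_cases hv : v = a
    · subst hv; simp [ha]
    · simp [hv]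
  rw [e, Finset.card_erase_of_mem ha] at h2
  have : 0 < T.card := Finset.card_pos.2 ⟨a, ha⟩
  unfold E
  omega

theorem r_union (G : SimpleGraph V) (θ : ℝ) (S T : Finset V) (hd : Disjoint S T)
    (h : ∀ a ∈ S, ∀ b ∈ T, ¬ G.Adj a b) : r G θ (S ∪ T) = r G θ S + r G θ T := by
  unfold r
  rw [F_mul G S T hd h, rootMultiplicity_mul (mul_ne_zero (F_ne _ _) (F_ne _ _))]

theorem claim (G : SimpleGraph V) (θ : ℝ) (S : Finset V) : ∀ (A T : Finset V), A ⊆ S →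
    (∀ a ∈ A, ¬ E G θ S a) → T ⊆ S → r G θ (S \ T) + T.card = r G θ S →
    r G θ ((S \ A) \ T) + T.card = r G θ (S \ A) := by
  classical
  induction hn : S.card using Nat.strong_induction_on generalizing S with
  | _ n ih =>
  intro A T hAS hA hTS hT
  have hTE := indep_E G θ S T hTS hT
  have hAT : ∀ a ∈ A, a ∉ T := fun a ha h => hA a ha (hTE a h)
  by_cases hsp : ∃ s ∈ S, ¬ E G θ S s ∧ ∃ w ∈ S, G.Adj s w ∧ E G θ S w
  · obtain ⟨s, hs, hEs, w, hw, hadj, hEw⟩ := hsp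
    have hlt : (S.erase s).card < n := hn ▸ Finset.card_erase_lt_of_mem hs
    obtain ⟨-, hm⟩ := special_pos G θ S s w hs hw hadj hEw hEs
    have hsT : s ∉ T := fun h => hEs (hTE s h)
    have hA' : ∀ a ∈ A, a ≠ s → ¬ E G θ (S.erase s) a := fun a ha has =>
      L5 G θ S s w a hs hw (hAS ha) has.symm hadj hEw hEs (hA a ha)
    have hTS' : T ⊆ S.erase s := fun v hv => Finset.mem_erase.2
      ⟨by rintro rfl; exact hsT hv, hTS hv⟩
    have e1 : (S \ T).erase s = S.erase s \ T := (Finset.erase_sdiff_comm S T s).symm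
    have hlow := r_sdiff G θ T (S.erase s) hTS'
    obtain ⟨c, hc, hac, hcr⟩ : ∃ c ∈ S.erase s \ T, G.Adj s c ∧
        r G θ ((S.erase s \ T).erase c) + T.card + 1 ≤ r G θ (S.erase s) := by
      by_contra hcon
      push Not at hcon
      have : r G θ (S \ T) + 1 ≤ r G θ (S \ T) := by
        apply le_r_of_rec G θ (S \ T) s (Finset.mem_sdiff.2 ⟨hs, hsT⟩)
        · rw [e1]; omega
        · rw [e1]
          intro c hc hac
          have := hcon c hc hac
          omega
      omega
    have hcS := (Finset.mem_sdiff.1 hc).1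
    have hcT := (Finset.mem_sdiff.1 hc).2
    by_cases hsA : s ∈ A
    · have h1 := (L2a G θ _ c hc).1
      have h2 := ih _ hlt (S.erase s) rfl (A.erase s) T (Finset.erase_subset_erase s hAS)
        (fun a ha => hA' a (Finset.mem_erase.1 ha).2 (Finset.mem_erase.1 ha).1) hTS' (by omega)
      have e : S.erase s \ A.erase s = S \ A := by
        ext v
        simp only [Finset.mem_sdiff, Finset.mem_erase]
        by_cases hv : v = s
        · subst hv; simp [hsA]
        · simp [hv]
      rwa [e] at h2
    · have hTc : insert c T ⊆ S.erase s := Finset.insert_subset hcS hTS'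
      have hAs : A ⊆ S.erase s := fun v hv => Finset.mem_erase.2
        ⟨by rintro rfl; exact hsA hv, hAS hv⟩
      have hlow2 := r_sdiff G θ (insert c T) (S.erase s) hTc
      have hcard : (insert c T).card = T.card + 1 := Finset.card_insert_of_notMem hcT
      have hA'' : ∀ a ∈ A, ¬ E G θ (S.erase s) a := fun a ha =>
        hA' a ha (by rintro rfl; exact hsA ha)
      have hind : r G θ (S.erase s \ insert c T) + (insert c T).card = r G θ (S.erase s) := by
        rw [Finset.sdiff_insert] at hlow2 ⊢
        omega
      have h2 := ih _ hlt (S.erase s) rfl A (insert c T) hAs hA'' hTc hind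
      have hcA : c ∉ A := fun h => hA'' c h
        (indep_E G θ _ _ hTc hind c (Finset.mem_insert_self _ _))
      have hsub : insert c T ⊆ S.erase s \ A := fun v hv => by
        refine Finset.mem_sdiff.2 ⟨hTc hv, fun h => ?_⟩
        rcases Finset.mem_insert.1 hv with rfl | hv
        · exact hcA h
        · exact hAT v h hv
      have hEc := indep_E G θ _ _ hsub h2 c (Finset.mem_insert_self _ _)
      have e2 : (S \ A).erase s = S.erase s \ A := (Finset.erase_sdiff_comm S A s).symm
      have e3 : ((S \ A) \ T).erase s = (S.erase s \ A) \ T := by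
        rw [← e2, Finset.erase_sdiff_comm]
      have hsSA : s ∈ S \ A := Finset.mem_sdiff.2 ⟨hs, hsA⟩
      have hcSA : c ∈ S.erase s \ A := Finset.mem_sdiff.2 ⟨hcS, hcA⟩
      have hcSAT : c ∈ (S.erase s \ A) \ T := Finset.mem_sdiff.2 ⟨hcSA, hcT⟩
      have h3 := L4 G θ (S \ A) s c hsSA (by rw [e2]; exact hcSA) hac (by rw [e2]; exact hEc)
      have h4 := r_sdiff G θ T (S.erase s \ A) ((Finset.subset_insert _ _).trans hsub)
      have h5 := (L2a G θ _ c hcSAT).1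
      rw [Finset.sdiff_insert, hcard] at h2
      have hEc2 : E G θ ((S.erase s \ A) \ T) c := by
        unfold E
        omega
      have h6 := L4 G θ ((S \ A) \ T) s c (Finset.mem_sdiff.2 ⟨hsSA, hsT⟩)
        (by rw [e3]; exact hcSAT) hac (by rw [e3]; exact hEc2)
      rw [e2] at h3
      rw [e3] at h6
      unfold E at hEc2
      omega
  · push Not at hsp
    set D := S.filter (fun v => E G θ S v) with hD
    set K := S.filter (fun v => ¬ E G θ S v) with hK
    have hDK : ∀ a ∈ D, ∀ b ∈ K, ¬ G.Adj a b := by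
      intro a ha b hb hab
      rw [hD, Finset.mem_filter] at ha
      rw [hK, Finset.mem_filter] at hb
      exact hsp b hb.1 hb.2 a ha.1 hab.symm ha.2
    have hdisj : Disjoint D K := Finset.disjoint_filter_filter_not _ _ _
    have key : ∀ D' ⊆ D, ∀ K' ⊆ K, r G θ (D' ∪ K') = r G θ D' + r G θ K' := by
      intro D' hD' K' hK'
      exact r_union G θ D' K' (Finset.disjoint_of_subset_left hD'
        (Finset.disjoint_of_subset_right hK' hdisj)) (fun a ha b hb => hDK a (hD' ha) b (hK' hb))
    have e1 : S = D ∪ K := by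
      ext v; simp only [hD, hK, Finset.mem_union, Finset.mem_filter]; tauto
    have e2 : S \ T = (D \ T) ∪ K := by
      ext v
      have := hTE v
      simp only [hD, hK, Finset.mem_union, Finset.mem_filter, Finset.mem_sdiff]; tauto
    have e3 : S \ A = D ∪ (K \ A) := by
      ext v
      have := hA v
      simp only [hD, hK, Finset.mem_union, Finset.mem_filter, Finset.mem_sdiff]; tauto
    have e4 : (S \ A) \ T = (D \ T) ∪ (K \ A) := by
      rw [e3]
      ext v
      have h0 : v ∈ K → v ∉ T := fun h ht => (Finset.mem_filter.1 h).2 (hTE v ht)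
      simp only [Finset.mem_union, Finset.mem_sdiff]
      tauto
    clear_value D K
    have k1 := key D subset_rfl K subset_rfl
    have k2 := key (D \ T) Finset.sdiff_subset K subset_rfl
    have k3 := key D subset_rfl (K \ A) Finset.sdiff_subset
    have k4 := key (D \ T) Finset.sdiff_subset (K \ A) Finset.sdiff_subset
    have f1 := congrArg (r G θ) e1
    have f2 := congrArg (r G θ) e2
    have f3 := congrArg (r G θ) e3
    have f4 := congrArg (r G θ) e4
    omega

theorem main_claim (G : SimpleGraph V) (θ : ℝ) (S A : Finset V) (hAS : A ⊆ S)
    (hA : ∀ a ∈ A, ¬ E G θ S a) (u w : V) (hu : u ∈ S) (hw : w ∈ S) (huA : u ∉ A)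
    (hadj : G.Adj u w) (hEw : E G θ S w) (hEu : ¬ E G θ S u) :
    w ∉ A ∧ ¬ E G θ (S \ A) u ∧ E G θ (S \ A) w := by
  have hwA : w ∉ A := fun h => hA w h hEw
  obtain ⟨hw1, -⟩ := special_pos G θ S u w hu hw hadj hEw hEu
  have single : ∀ S' : Finset V, w ∈ S' → A ⊆ S' → (∀ a ∈ A, ¬ E G θ S' a) → E G θ S' w →
      E G θ (S' \ A) w := by
    intro S' hw' hA' hnE hE
    have h := claim G θ S' A {w} hA' hnE (Finset.singleton_subset_iff.2 hw')
      (by rw [Finset.sdiff_singleton_eq_erase]; exact hE)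
    rw [Finset.sdiff_singleton_eq_erase] at h
    exact h
  refine ⟨hwA, ?_, single S hw hAS hA hEw⟩
  have hwu : w ∈ S.erase u := Finset.mem_erase.2 ⟨hadj.ne', hw⟩
  have h1 := single (S.erase u) hwu
    (fun v hv => Finset.mem_erase.2 ⟨by rintro rfl; exact huA hv, hAS hv⟩)
    (fun a ha => L5 G θ S u w a hu hw (hAS ha) (by rintro rfl; exact huA ha) hadj hEw hEu (hA a ha))
    hw1
  have e2 : (S \ A).erase u = S.erase u \ A := (Finset.erase_sdiff_comm S A u).symm
  have h2 := L4 G θ (S \ A) u w (Finset.mem_sdiff.2 ⟨hu, huA⟩)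
    (by rw [e2]; exact Finset.mem_sdiff.2 ⟨hwu, hwA⟩) hadj (by rw [e2]; exact h1)
  unfold E
  omega

theorem matchMult_eq {W : Type*} [Finite W] (H : SimpleGraph W) (G : SimpleGraph V) (φ : H ↪g G)
    (θ : ℝ) (S : Finset V) (hS : ∀ v, v ∈ S ↔ ∃ w, φ w = v) : matchMult θ H = r G θ S := by
  classical
  have : Fintype W := Fintype.ofFinite W
  unfold matchMult r F
  rw [matchingPolynomial_eq, P_map H G φ]
  congr 2
  ext v
  rw [hS]
  simp

end MP

theorem special_stable_under_deleting_nonessential {V : Type*} [Finite V] (θ : ℝ)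
    (G : SimpleGraph V) (A : Set V) (hA : ∀ a ∈ A, ¬ IsEssential θ G a)
    (u : V) (hu : u ∉ A) (hspec : IsSpecial θ G u) :
    IsSpecial θ (G.induce Aᶜ) ⟨u, hu⟩ := by
  classical
  have : Fintype V := Fintype.ofFinite V
  have h1 : ∀ a, IsEssential θ G a ↔ MP.E G θ Finset.univ a := by
    intro a
    unfold IsEssential MP.E
    rw [MP.matchMult_eq (G.induce {v | v ≠ a}) G (SimpleGraph.Embedding.induce _) θ
      (Finset.univ.erase a) (by intro v; simp),
      MP.matchMult_eq G G (SimpleGraph.Embedding.refl) θ Finset.univ (by intro v; simp)]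
  have h2 : ∀ a (ha : a ∉ A), IsEssential θ (G.induce Aᶜ) ⟨a, ha⟩ ↔
      MP.E G θ (Finset.univ \ A.toFinset) a := by
    intro a ha
    unfold IsEssential MP.E
    rw [MP.matchMult_eq ((G.induce Aᶜ).induce {v | v ≠ ⟨a, ha⟩}) G
      ((SimpleGraph.Embedding.induce _).comp (SimpleGraph.Embedding.induce _)) θ
      ((Finset.univ \ A.toFinset).erase a) (by
        intro v
        simp only [Finset.mem_erase, Finset.mem_sdiff, Finset.mem_univ, true_and, Set.mem_toFinset]
        constructor
        · rintro ⟨hv, hvA⟩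
          exact ⟨⟨⟨v, hvA⟩, fun h => hv (congrArg Subtype.val h)⟩, rfl⟩
        · rintro ⟨⟨⟨w, hw⟩, hne⟩, rfl⟩
          exact ⟨fun h => hne (Subtype.ext h), hw⟩),
      MP.matchMult_eq (G.induce Aᶜ) G (SimpleGraph.Embedding.induce _) θ
        (Finset.univ \ A.toFinset) (by intro v; simp)]
  obtain ⟨hn, w, hadj, hw⟩ := hspec
  rw [h1] at hn hw
  obtain ⟨m1, m2, m3⟩ := MP.main_claim G θ Finset.univ A.toFinset (Finset.subset_univ _)
    (fun a ha => by rw [← h1]; exact hA a (Set.mem_toFinset.1 ha)) u w (Finset.mem_univ _)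
    (Finset.mem_univ _) (by simpa using hu) hadj hw hn
  have hwA : w ∉ A := by simpa using m1
  exact ⟨by rw [h2]; exact m2, ⟨w, hwA⟩, hadj, by rw [h2]; exact m3⟩
end

section
/- Let θ ∈ ℝ, let G be a finite simple graph, let A be a set of θ-special vertices of G, and let u ∉ A be a θ-positive vertex of G. Then u is θ-positive in G−A: mult(θ, (G−A)−u) = mult(θ, G−A) + 1. -/
open Polynomial

namespace MatchAux

/-- `M` is a matching of `G` all of whose edges lie inside `S`. -/
def IsM {V : Type*} (G : SimpleGraph V) (S : Finset V) (M : Finset (Sym2 V)) : Prop :=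
  (∀ e ∈ M, e ∈ G.edgeSet ∧ ∀ v ∈ e, v ∈ S) ∧
    ∀ e ∈ M, ∀ f ∈ M, e ≠ f → ∀ v, v ∈ e → v ∉ f

open Classical in
/-- Matching polynomial of the subgraph induced on `S`. -/
noncomputable def MP {V : Type*} [Fintype V] (G : SimpleGraph V) (S : Finset V) : ℝ[X] :=
  ∑ M ∈ Finset.univ.filter (fun M : Finset (Sym2 V) => IsM G S M),
    (-1 : ℝ[X]) ^ M.card * X ^ (S.card - 2 * M.card)

lemma IsM.card_le {V : Type*} [DecidableEq V] {G : SimpleGraph V} {S : Finset V}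
    {M : Finset (Sym2 V)} (h : IsM G S M) : 2 * M.card ≤ S.card := by
  have h1 : (M.biUnion (fun e => e.toFinset)).card = ∑ e ∈ M, e.toFinset.card := by
    apply Finset.card_biUnion
    intro e he f hf hef
    change Disjoint e.toFinset f.toFinset
    rw [Finset.disjoint_left]
    intro v hv hv'
    rw [Sym2.mem_toFinset] at hv hv'
    exact h.2 e he f hf hef v hv hv'
  have h2 : ∑ e ∈ M, e.toFinset.card = ∑ e ∈ M, 2 := by
    apply Finset.sum_congr rfl
    intro e he
    exact Sym2.card_toFinset_of_not_isDiag e (G.not_isDiag_of_mem_edgeSet (h.1 e he).1)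
  have h3 : (M.biUnion (fun e => e.toFinset)) ⊆ S := by
    intro v hv
    rw [Finset.mem_biUnion] at hv
    obtain ⟨e, he, hv⟩ := hv
    rw [Sym2.mem_toFinset] at hv
    exact (h.1 e he).2 v hv
  have h4 := Finset.card_le_card h3
  rw [h1, h2] at h4
  simp at h4
  omega

lemma MP_empty {V : Type*} [Fintype V] (G : SimpleGraph V) : MP G ∅ = 1 := by
  classical
  unfold MP
  rw [Finset.sum_eq_single ∅]
  · simp
  · intro M hM hne
    rw [Finset.mem_filter] at hM
    have := hM.2.card_le
    simp at this
    exact absurd this hne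
  · intro h
    exact absurd (by simp [IsM]) h

open Classical in
lemma MP_rec {V : Type*} [Fintype V] (G : SimpleGraph V) (S : Finset V) (u : V) (hu : u ∈ S) :
    MP G S = X * MP G (S.erase u) -
      ∑ v ∈ (S.erase u).filter (fun v => G.Adj u v), MP G ((S.erase u).erase v) := by
  have key : MP G S = (∑ M ∈ (Finset.univ.filter (fun M : Finset (Sym2 V) => IsM G S M)).filter
        (fun M => ∃ e ∈ M, u ∈ e), (-1 : ℝ[X]) ^ M.card * X ^ (S.card - 2 * M.card)) +
      (∑ M ∈ (Finset.univ.filter (fun M : Finset (Sym2 V) => IsM G S M)).filter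
        (fun M => ¬ ∃ e ∈ M, u ∈ e), (-1 : ℝ[X]) ^ M.card * X ^ (S.card - 2 * M.card)) := by
    unfold MP
    rw [Finset.sum_filter_add_sum_filter_not]
  have hcard : (S.erase u).card + 1 = S.card := Finset.card_erase_add_one hu
  have h1 : (∑ M ∈ (Finset.univ.filter (fun M : Finset (Sym2 V) => IsM G S M)).filter
        (fun M => ¬ ∃ e ∈ M, u ∈ e), (-1 : ℝ[X]) ^ M.card * X ^ (S.card - 2 * M.card))
      = X * MP G (S.erase u) := by
    unfold MP
    rw [Finset.mul_sum]
    apply Finset.sum_congr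
    · ext M
      simp only [Finset.mem_filter, Finset.mem_univ, true_and, IsM, Finset.mem_erase]
      grind
    · intro M hM
      rw [Finset.mem_filter] at hM
      have := hM.2.card_le
      rw [show S.card - 2 * M.card = ((S.erase u).card - 2 * M.card) + 1 by omega, pow_succ]
      ring
  have h2 : ∑ v ∈ (S.erase u).filter (fun v => G.Adj u v), MP G ((S.erase u).erase v) =
      - (∑ M ∈ (Finset.univ.filter (fun M : Finset (Sym2 V) => IsM G S M)).filter
        (fun M => ∃ e ∈ M, u ∈ e), (-1 : ℝ[X]) ^ M.card * X ^ (S.card - 2 * M.card)) := by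
    unfold MP
    rw [Finset.sum_sigma', ← Finset.sum_neg_distrib]
    have hnot : ∀ (v w : V) (M : Finset (Sym2 V)), IsM G ((S.erase u).erase v) M →
        s(u, w) ∉ M := by
      intro v w M hM h
      have := (hM.1 _ h).2 u (by simp)
      simp at this
    apply Finset.sum_bij (fun p _ => insert s(u, p.1) p.2)
    · rintro ⟨v, M⟩ hp
      simp only [Finset.mem_sigma, Finset.mem_filter, Finset.mem_univ, true_and,
        Finset.mem_erase] at hp ⊢
      obtain ⟨⟨⟨hvu, hvS⟩, hadj⟩, hM⟩ := hp
      refine ⟨⟨?_, ?_⟩, s(u, v), by simp, by simp⟩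
      · intro e he
        rw [Finset.mem_insert] at he
        rcases he with rfl | he
        · refine ⟨hadj, ?_⟩
          intro w hw
          rw [Sym2.mem_iff] at hw
          rcases hw with rfl | rfl <;> assumption
        · refine ⟨(hM.1 e he).1, fun w hw => ?_⟩
          have := (hM.1 e he).2 w hw
          simp only [Finset.mem_erase] at this
          exact this.2.2
      · have haux : ∀ f ∈ M, ∀ w, w ∈ s(u, v) → w ∉ f := by
          intro f hf w hw hwf
          have := (hM.1 f hf).2 w hwf
          simp only [Finset.mem_erase] at this
          rw [Sym2.mem_iff] at hw
          tauto
        intro e he f hf hef w hwe hwf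
        rw [Finset.mem_insert] at he hf
        rcases he with rfl | he
        · rcases hf with rfl | hf
          · exact hef rfl
          · exact haux f hf w hwe hwf
        · rcases hf with rfl | hf
          · exact haux e he w hwf hwe
          · exact hM.2 e he f hf hef w hwe hwf
    · rintro ⟨v, M⟩ hp ⟨v', M'⟩ hp' heq
      simp only [Finset.mem_sigma, Finset.mem_filter, Finset.mem_univ, true_and] at hp hp' heq
      have hv : s(u, v) ∈ insert s(u, v') M' := by rw [← heq]; simp
      rw [Finset.mem_insert] at hv
      have hvv : v = v' := by
        rcases hv with hv | hv
        · have hv2 : v = v' ∨ u = v' ∧ v = u := by simpa using hv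
          grind
        · exact absurd hv (hnot _ _ _ hp'.2)
      subst hvv
      have : M = M' := by
        have h := congrArg (fun N => Finset.erase N s(u, v)) heq
        simpa [Finset.erase_insert (hnot _ v _ hp.2), Finset.erase_insert (hnot _ v _ hp'.2)]
          using h
      rw [this]
    · intro M hM
      simp only [Finset.mem_filter, Finset.mem_univ, true_and] at hM
      obtain ⟨hM, e, he, hue⟩ := hM
      obtain ⟨v, rfl⟩ := hue
      have hadj : G.Adj u v := (hM.1 _ he).1
      refine ⟨⟨v, M.erase s(u, v)⟩, ?_, ?_⟩
      · simp only [Finset.mem_sigma, Finset.mem_filter, Finset.mem_univ, true_and,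
          Finset.mem_erase]
        refine ⟨⟨⟨hadj.ne', (hM.1 _ he).2 v (by simp)⟩, hadj⟩, ?_, ?_⟩
        · intro f hf
          rw [Finset.mem_erase] at hf
          refine ⟨(hM.1 f hf.2).1, fun w hw => ?_⟩
          have h1 := hM.2 _ hf.2 _ he hf.1 w hw
          rw [Sym2.mem_iff] at h1
          simp only [Finset.mem_erase]
          exact ⟨fun h => h1 (Or.inr h), fun h => h1 (Or.inl h), (hM.1 f hf.2).2 w hw⟩
        · intro f hf g hg
          rw [Finset.mem_erase] at hf hg
          exact hM.2 f hf.2 g hg.2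
      · simp [Finset.insert_erase he]
    · rintro ⟨v, M⟩ hp
      simp only [Finset.mem_sigma, Finset.mem_filter, Finset.mem_univ, true_and] at hp
      have hc : ((S.erase u).erase v).card + 1 = (S.erase u).card :=
        Finset.card_erase_add_one hp.1.1
      simp only
      rw [Finset.card_insert_of_notMem (hnot _ v _ hp.2),
        show S.card - 2 * (M.card + 1) = ((S.erase u).erase v).card - 2 * M.card by omega,
        pow_succ]
      ring
  rw [key, h1, h2]
  ring

lemma matchingPolynomial_eq {V W : Type*} [Fintype V] [Finite W] (G : SimpleGraph V)
    (H : SimpleGraph W) (f : W → V) (hf : Function.Injective f)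
    (hadj : ∀ x y, H.Adj x y ↔ G.Adj (f x) (f y)) (S : Finset V)
    (hS : ∀ v, v ∈ S ↔ ∃ x, f x = v) : matchingPolynomial H = MP G S := by
  classical
  let _ : Fintype W := Fintype.ofFinite W
  have hcard : Nat.card W = S.card := by
    rw [Nat.card_eq_fintype_card, ← Finset.card_univ,
      ← Finset.card_image_of_injective _ hf]
    congr 1
    ext v
    simp [hS]
  have hinj : Function.Injective (Sym2.map f) := Sym2.map.injective hf
  have hedge : ∀ e : Sym2 W, e ∈ H.edgeSet ↔ Sym2.map f e ∈ G.edgeSet := by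
    intro e
    induction e with
    | h x y => simp [hadj]
  unfold matchingPolynomial MP
  simp only
  apply Finset.sum_bij (fun M _ => M.image (Sym2.map f))
  · intro M hM
    simp only [Finset.mem_filter, Finset.mem_univ, true_and] at hM ⊢
    refine ⟨?_, ?_⟩
    · intro e he
      rw [Finset.mem_image] at he
      obtain ⟨e, he, rfl⟩ := he
      refine ⟨(hedge e).1 (hM.1 e he), fun v hv => ?_⟩
      rw [Sym2.mem_map] at hv
      obtain ⟨x, _, rfl⟩ := hv
      exact (hS _).2 ⟨x, rfl⟩
    · intro e he g hg hne v hv hv'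
      rw [Finset.mem_image] at he hg
      obtain ⟨e, he, rfl⟩ := he
      obtain ⟨g, hg, rfl⟩ := hg
      rw [Sym2.mem_map] at hv hv'
      obtain ⟨x, hx, rfl⟩ := hv
      obtain ⟨y, hy, hxy⟩ := hv'
      rw [hf hxy] at hy
      exact hM.2 e he g hg (fun h => hne (by rw [h])) x hx hy
  · intro M _ M' _ h
    exact Finset.image_injective hinj h
  · intro M hM
    simp only [Finset.mem_filter, Finset.mem_univ, true_and] at hM
    have himg : ∀ e ∈ M, ∃ e', Sym2.map f e' = e := by
      intro e he
      have := (hM.1 e he).2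
      induction e with
      | h x y =>
        obtain ⟨a, rfl⟩ := (hS _).1 (this x (by simp))
        obtain ⟨b, rfl⟩ := (hS _).1 (this y (by simp))
        exact ⟨s(a, b), by simp⟩
    refine ⟨Finset.univ.filter (fun e => Sym2.map f e ∈ M), ?_, ?_⟩
    · simp only [Finset.mem_filter, Finset.mem_univ, true_and]
      refine ⟨fun e he => (hedge e).2 (hM.1 _ he).1, fun e he g hg hne v hv hv' => ?_⟩
      exact hM.2 _ he _ hg (fun h => hne (hinj h)) (f v) (Sym2.mem_map.2 ⟨v, hv, rfl⟩)
        (Sym2.mem_map.2 ⟨v, hv', rfl⟩)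
    · ext e
      simp only [Finset.mem_image, Finset.mem_filter, Finset.mem_univ, true_and]
      constructor
      · rintro ⟨e', h, rfl⟩
        exact h
      · intro he
        obtain ⟨e', rfl⟩ := himg e he
        exact ⟨e', he, rfl⟩
  · intro M _
    rw [Finset.card_image_of_injective _ hinj, hcard]

open Classical in
/-- The vertex-deletion recurrence with vertex weights `x`. -/
def Rec {V : Type*} (G : SimpleGraph V) (x : V → ℝ) (F : Finset V → ℝ) : Prop :=
  ∀ S : Finset V, ∀ u ∈ S, F S = x u * F (S.erase u) -
    ∑ v ∈ (S.erase u).filter (fun v => G.Adj u v), F ((S.erase u).erase v)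

open Classical in
lemma heilmann_lieb {V : Type*} {G : SimpleGraph V} {x : V → ℝ} {F : Finset V → ℝ}
    (h : Rec G x F) : ∀ (n : ℕ) (S : Finset V), S.card = n → ∀ a ∈ S, ∀ w ∈ S, a ≠ w →
    (if G.Adj a w then F ((S.erase a).erase w) ^ 2 else 0) ≤
      F (S.erase a) * F (S.erase w) - F S * F ((S.erase a).erase w) := by
  intro n
  induction n with
  | zero =>
    intro S hS a ha
    rw [Finset.card_eq_zero] at hS
    simp [hS] at ha
  | succ n ih =>
    intro S hS a ha w hw haw
    have hT : (S.erase a).card = n := by rw [Finset.card_erase_of_mem ha, hS]; rfl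
    have hwT : w ∈ S.erase a := Finset.mem_erase.2 ⟨haw.symm, hw⟩
    have e1 := h S a ha
    have e2 := h (S.erase w) a (Finset.mem_erase.2 ⟨haw, ha⟩)
    rw [Finset.erase_right_comm (a := w) (b := a)] at e2
    generalize hTT : S.erase a = T at *
    have hnn : 0 ≤ ∑ i ∈ (T.erase w).filter (fun v => G.Adj a v),
        (F (T.erase i) * F (T.erase w) - F T * F ((T.erase w).erase i)) := by
      apply Finset.sum_nonneg
      intro i hi
      rw [Finset.mem_filter, Finset.mem_erase] at hi
      have := ih T hT i hi.1.2 w hwT hi.1.1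
      rw [Finset.erase_right_comm (a := i) (b := w)] at this
      refine le_trans ?_ this
      split_ifs <;> positivity
    rw [Finset.sum_sub_distrib, ← Finset.sum_mul, ← Finset.mul_sum] at hnn
    have hsum : ∑ i ∈ T.filter (fun v => G.Adj a v), F (T.erase i) =
        (if G.Adj a w then F (T.erase w) else 0) +
          ∑ i ∈ (T.erase w).filter (fun v => G.Adj a v), F (T.erase i) := by
      rw [Finset.sum_filter, Finset.sum_filter, Finset.add_sum_erase T
        (fun i => if G.Adj a i then F (T.erase i) else 0) hwT]
    rw [hsum] at e1
    rw [e1, e2]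
    split_ifs at * <;> nlinarith

lemma rec_eval {V : Type*} [Fintype V] (G : SimpleGraph V) (z : ℝ) :
    Rec G (fun _ => z) (fun S => (MP G S).eval z) := by
  classical
  intro S u hu
  have := congrArg (eval z) (MP_rec G S u hu)
  simpa [eval_finsetSum] using this

open Classical in
lemma rec_shift {V : Type*} {G : SimpleGraph V} {x : V → ℝ} {F : Finset V → ℝ}
    (h : Rec G x F) (u : V) (s : ℝ) :
    Rec G (fun v => if v = u then x v + s else x v)
      (fun S => F S + if u ∈ S then s * F (S.erase u) else 0) := by
  intro S v hv
  simp only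
  by_cases huv : v = u
  · subst huv
    rw [h S v hv]
    simp only [Finset.mem_erase, if_true, hv]
    simp
    ring
  · by_cases hu : u ∈ S
    · have e1 := h S v hv
      have e2 := h (S.erase u) v (Finset.mem_erase.2 ⟨huv, hv⟩)
      have huT : u ∈ S.erase v := Finset.mem_erase.2 ⟨fun h => huv h.symm, hu⟩
      rw [Finset.erase_right_comm (a := u) (b := v)] at e2
      generalize S.erase v = T at *
      have e3 : ∑ i ∈ T.filter (fun w => G.Adj v w),
          (if u ∈ T.erase i then s * F ((T.erase i).erase u) else 0) =
          s * ∑ i ∈ (T.erase u).filter (fun w => G.Adj v w), F ((T.erase u).erase i) := by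
        rw [Finset.mul_sum, Finset.sum_filter, Finset.sum_filter,
          ← Finset.add_sum_erase T _ huT]
        simp only [Finset.mem_erase, ne_eq, not_true_eq_false, false_and, if_false, ite_self,
          zero_add]
        apply Finset.sum_congr rfl
        intro i hi
        rw [Finset.mem_erase] at hi
        rw [Finset.erase_right_comm (a := i) (b := u)]
        have hui : u ≠ i := hi.1.symm
        simp [hui, huT]
      rw [Finset.sum_add_distrib, e3, e1, e2]
      simp only [hu, huT, huv, if_true, if_false]
      ring
    · rw [h S v hv]
      simp [hu, huv]

open Classical in
lemma hl_disc {V : Type*} {G : SimpleGraph V} {x : V → ℝ} {F : Finset V → ℝ}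
    (h : Rec G x F) (S : Finset V) {a w u : V} (ha : a ∈ S) (hw : w ∈ S) (hu : u ∈ S)
    (haw : a ≠ w) (hau : a ≠ u) (hwu : w ≠ u) :
    (F ((S.erase a).erase u) * F (S.erase w) + F (S.erase a) * F ((S.erase w).erase u)
      - F S * F (((S.erase a).erase w).erase u) - F (S.erase u) * F ((S.erase a).erase w)) ^ 2 ≤
    4 * ((F ((S.erase a).erase u) * F ((S.erase w).erase u)
        - F (S.erase u) * F (((S.erase a).erase w).erase u)) *
      (F (S.erase a) * F (S.erase w) - F S * F ((S.erase a).erase w))) := by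
  have key := discrim_le_zero (a := F ((S.erase a).erase u) * F ((S.erase w).erase u)
        - F (S.erase u) * F (((S.erase a).erase w).erase u))
      (b := F ((S.erase a).erase u) * F (S.erase w) + F (S.erase a) * F ((S.erase w).erase u)
      - F S * F (((S.erase a).erase w).erase u) - F (S.erase u) * F ((S.erase a).erase w))
      (c := F (S.erase a) * F (S.erase w) - F S * F ((S.erase a).erase w)) (by
    intro s
    have h1 := heilmann_lieb (rec_shift h u s) _ S rfl a ha w hw haw
    have h2 := le_trans (by split_ifs <;> positivity) h1
    simp only [Finset.mem_erase, hu, ne_eq, hau.symm, hwu.symm, not_false_eq_true, and_self,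
      if_true] at h2
    linarith)
  unfold discrim at key
  linarith

/-- `(X - θ)^n` divides `p`. -/
def D (θ : ℝ) (n : ℕ) (p : ℝ[X]) : Prop := (X - C θ) ^ n ∣ p

lemma D.mono {θ : ℝ} {n m : ℕ} {p : ℝ[X]} (h : D θ n p) (hm : m ≤ n) : D θ m p :=
  (pow_dvd_pow _ hm).trans h

lemma D.mul {θ : ℝ} {n m k : ℕ} {p q : ℝ[X]} (h : D θ n p) (h' : D θ m q) (hk : k ≤ n + m) :
    D θ k (p * q) :=
  (pow_dvd_pow _ hk).trans (by rw [pow_add]; exact mul_dvd_mul h h')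

lemma D.sub {θ : ℝ} {n : ℕ} {p q : ℝ[X]} (h : D θ n p) (h' : D θ n q) : D θ n (p - q) :=
  dvd_sub h h'

lemma D.add {θ : ℝ} {n : ℕ} {p q : ℝ[X]} (h : D θ n p) (h' : D θ n q) : D θ n (p + q) :=
  dvd_add h h'

lemma D.deriv {θ : ℝ} {n : ℕ} {p : ℝ[X]} (h : D θ n p) : D θ (n - 1) (derivative p) := by
  obtain ⟨q, rfl⟩ := h
  exact pow_sub_one_dvd_derivative_of_pow_dvd (Dvd.intro _ rfl)

lemma D_iff {θ : ℝ} {n : ℕ} {p : ℝ[X]} (hp : p ≠ 0) : D θ n p ↔ n ≤ rootMultiplicity θ p :=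
  (le_rootMultiplicity_iff hp).symm

/-- If `q² ≤ p` and `(X-θ)^(2j+1) ∣ p` then `(X-θ)^(j+1) ∣ q`. -/
lemma D_of_sq_le {θ : ℝ} {j : ℕ} {p q : ℝ[X]} (h : D θ (2 * j + 1) p)
    (hle : ∀ z, (q.eval z) ^ 2 ≤ p.eval z) : D θ (j + 1) q := by
  by_cases hq : q = 0
  · rw [hq]; exact dvd_zero _
  rw [D_iff hq]
  by_contra hlt
  obtain ⟨q1, hq1, hnd⟩ := exists_eq_pow_rootMultiplicity_mul_and_not_dvd q hq θ
  generalize rootMultiplicity θ q = r at *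
  obtain ⟨p1, hp1⟩ : D θ (2 * r + 1) p := h.mono (by omega)
  rw [dvd_iff_isRoot, IsRoot.def] at hnd
  have h1 : ∀ z, z ≠ θ → (q1.eval z) ^ 2 ≤ (z - θ) * p1.eval z := by
    intro z hz
    have := hle z
    rw [hq1, hp1] at this
    simp only [eval_mul, eval_pow, eval_sub, eval_X, eval_C] at this
    have hpos : 0 < ((z - θ) ^ r) ^ 2 := by
      have : z - θ ≠ 0 := sub_ne_zero.2 hz
      positivity
    refine le_of_mul_le_mul_left ?_ hpos
    calc _ = ((z - θ) ^ r * eval z q1) ^ 2 := by ring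
      _ ≤ _ := this
      _ = _ := by ring
  have h2 : (q1.eval θ) ^ 2 ≤ (θ - θ) * p1.eval θ := by
    have c1 : Filter.Tendsto (fun z => (q1.eval z) ^ 2) (nhdsWithin θ {θ}ᶜ)
        (nhds ((q1.eval θ) ^ 2)) :=
      ((q1.continuous.pow 2).tendsto θ).mono_left nhdsWithin_le_nhds
    have c2 : Filter.Tendsto (fun z => (z - θ) * p1.eval z) (nhdsWithin θ {θ}ᶜ)
        (nhds ((θ - θ) * p1.eval θ)) :=
      ((((continuous_id.sub continuous_const).mul p1.continuous)).tendsto θ).mono_left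
        nhdsWithin_le_nhds
    refine le_of_tendsto_of_tendsto c1 c2 ?_
    filter_upwards [self_mem_nhdsWithin] with z hz
    exact h1 z hz
  simp at h2
  exact hnd h2

/-- A nonnegative polynomial vanishes to even order. -/
lemma D_even {θ : ℝ} {j : ℕ} {p : ℝ[X]} (h : D θ (2 * j + 1) p)
    (hp : ∀ z, 0 ≤ p.eval z) : D θ (2 * j + 2) p := by
  obtain ⟨r, hr⟩ := h
  have h1 : ∀ z, 0 ≤ (z - θ) * r.eval z := by
    intro z
    by_cases hz : z = θ
    · simp [hz]
    have := hp z
    rw [hr] at this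
    simp only [eval_mul, eval_pow, eval_sub, eval_X, eval_C] at this
    have hpos : 0 < ((z - θ) ^ j) ^ 2 := by
      have : z - θ ≠ 0 := sub_ne_zero.2 hz
      positivity
    refine le_of_mul_le_mul_left ?_ hpos
    calc _ = (0 : ℝ) := by ring
      _ ≤ _ := this
      _ = _ := by ring
  have hroot : r.eval θ = 0 := by
    apply le_antisymm
    · refine le_of_tendsto (x := nhdsWithin θ (Set.Iio θ))
        ((r.continuous.tendsto θ).mono_left nhdsWithin_le_nhds) ?_
      filter_upwards [self_mem_nhdsWithin] with z hz
      rw [Set.mem_Iio] at hz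
      nlinarith [h1 z]
    · refine ge_of_tendsto (x := nhdsWithin θ (Set.Ioi θ))
        ((r.continuous.tendsto θ).mono_left nhdsWithin_le_nhds) ?_
      filter_upwards [self_mem_nhdsWithin] with z hz
      rw [Set.mem_Ioi] at hz
      nlinarith [h1 z]
  obtain ⟨t, ht⟩ := dvd_iff_isRoot.2 hroot
  exact ⟨t, by rw [hr, ht]; ring⟩

open Classical in
lemma wronskian {V : Type*} [Fintype V] (G : SimpleGraph V) (z : ℝ) :
    ∀ (n : ℕ) (S : Finset V), S.card = n → ∀ u ∈ S,
    ((MP G (S.erase u)).eval z) ^ 2 + ∑ v ∈ (S.erase u).filter (fun v => G.Adj u v),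
      ((MP G ((S.erase u).erase v)).eval z) ^ 2 ≤
    (MP G (S.erase u) * derivative (MP G S) - MP G S * derivative (MP G (S.erase u))).eval z := by
  intro n
  induction n with
  | zero =>
    intro S hS a ha
    rw [Finset.card_eq_zero] at hS
    simp [hS] at ha
  | succ n ih =>
    intro S hS u hu
    have hT : (S.erase u).card = n := by rw [Finset.card_erase_of_mem hu, hS]; rfl
    rw [MP_rec G S u hu]
    generalize S.erase u = T at *
    have h1 : ∑ v ∈ T.filter (fun v => G.Adj u v), ((MP G (T.erase v)).eval z) ^ 2 ≤
        ∑ v ∈ T.filter (fun v => G.Adj u v), (MP G (T.erase v) * derivative (MP G T)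
          - MP G T * derivative (MP G (T.erase v))).eval z := by
      apply Finset.sum_le_sum
      intro v hv
      rw [Finset.mem_filter] at hv
      refine le_trans ?_ (ih T hT v hv.1)
      have : 0 ≤ ∑ w ∈ (T.erase v).filter (fun w => G.Adj v w),
        ((MP G ((T.erase v).erase w)).eval z) ^ 2 := Finset.sum_nonneg fun _ _ => sq_nonneg _
      linarith
    have h2 : MP G T * derivative (X * MP G T -
          ∑ v ∈ T.filter (fun v => G.Adj u v), MP G (T.erase v)) -
        (X * MP G T - ∑ v ∈ T.filter (fun v => G.Adj u v), MP G (T.erase v)) *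
          derivative (MP G T) = MP G T ^ 2 + ∑ v ∈ T.filter (fun v => G.Adj u v),
          (MP G (T.erase v) * derivative (MP G T)
          - MP G T * derivative (MP G (T.erase v))) := by
      rw [Finset.sum_sub_distrib, ← Finset.sum_mul, ← Finset.mul_sum]
      simp only [derivative_sub, derivative_mul, derivative_X, derivative_sum]
      ring
    rw [h2, eval_add, eval_pow, eval_finsetSum]
    linarith

lemma MP_ne {V : Type*} [Fintype V] (G : SimpleGraph V) (S : Finset V) : MP G S ≠ 0 := by
  classical
  induction S using Finset.induction_on with
  | empty => rw [MP_empty]; exact one_ne_zero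
  | insert u S hu ih =>
    intro h0
    apply ih
    apply Polynomial.funext
    intro z
    have := wronskian G z _ (insert u S) rfl u (by simp)
    rw [h0, Finset.erase_insert hu] at this
    have h1 : 0 ≤ ∑ v ∈ S.filter (fun v => G.Adj u v),
        ((MP G (S.erase v)).eval z) ^ 2 := Finset.sum_nonneg fun _ _ => sq_nonneg _
    simp at this ⊢
    nlinarith [sq_nonneg (eval z (MP G S))]

/-- multiplicity -/
noncomputable def mu {V : Type*} [Fintype V] (G : SimpleGraph V) (θ : ℝ) (S : Finset V) : ℕ :=
  rootMultiplicity θ (MP G S)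

lemma D_mu {V : Type*} [Fintype V] {G : SimpleGraph V} {θ : ℝ} {S : Finset V} {n : ℕ} :
    D θ n (MP G S) ↔ n ≤ mu G θ S := D_iff (MP_ne G S)

lemma D_mu_mul {V : Type*} [Fintype V] {G : SimpleGraph V} {θ : ℝ} {S T : Finset V} {n : ℕ} :
    D θ n (MP G S * MP G T) ↔ n ≤ mu G θ S + mu G θ T := by
  have h := mul_ne_zero (MP_ne G S) (MP_ne G T)
  rw [D_iff h, rootMultiplicity_mul h]
  rfl

open Classical in
lemma interlace_le {V : Type*} [Fintype V] (G : SimpleGraph V) (θ : ℝ) {S : Finset V} {u : V}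
    (hu : u ∈ S) : mu G θ S ≤ mu G θ (S.erase u) + 1 := by
  by_contra hlt
  have hp : D θ (mu G θ S) (MP G S) := D_mu.2 le_rfl
  have hq : D θ (mu G θ (S.erase u)) (MP G (S.erase u)) := D_mu.2 le_rfl
  have hW : D θ (2 * mu G θ (S.erase u) + 1) (MP G (S.erase u) * derivative (MP G S)
      - MP G S * derivative (MP G (S.erase u))) :=
    (hq.mul hp.deriv (by omega)).sub (hp.mul hq.deriv (by omega))
  have := D_of_sq_le (q := MP G (S.erase u)) hW (by
    intro z
    refine le_trans ?_ (wronskian G z _ S rfl u hu)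
    have h1 : 0 ≤ ∑ v ∈ (S.erase u).filter (fun v => G.Adj u v),
      ((MP G ((S.erase u).erase v)).eval z) ^ 2 := Finset.sum_nonneg fun _ _ => sq_nonneg _
    linarith)
  rw [D_mu] at this
  omega

open Classical in
lemma interlace_ge {V : Type*} [Fintype V] (G : SimpleGraph V) (θ : ℝ) {S : Finset V} {u : V}
    (hu : u ∈ S) : mu G θ (S.erase u) ≤ mu G θ S + 1 := by
  by_contra hlt
  have hp : D θ (mu G θ S) (MP G S) := D_mu.2 le_rfl
  have hq : D θ (mu G θ (S.erase u)) (MP G (S.erase u)) := D_mu.2 le_rfl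
  have hW : D θ (2 * mu G θ S + 1) (MP G (S.erase u) * derivative (MP G S)
      - MP G S * derivative (MP G (S.erase u))) :=
    (hq.mul hp.deriv (by omega)).sub (hp.mul hq.deriv (by omega))
  have h2 : ∀ v ∈ (S.erase u).filter (fun v => G.Adj u v),
      D θ (mu G θ S + 1) (MP G ((S.erase u).erase v)) := by
    intro v hv
    refine D_of_sq_le hW fun z => le_trans ?_ (wronskian G z _ S rfl u hu)
    have h1 := Finset.single_le_sum
      (f := fun v => ((MP G ((S.erase u).erase v)).eval z) ^ 2) (fun _ _ => sq_nonneg _) hv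
    nlinarith [sq_nonneg (eval z (MP G (S.erase u)))]
  have h3 : D θ (mu G θ S + 1) (MP G S) := by
    rw [MP_rec G S u hu]
    exact D.sub (dvd_mul_of_dvd_right (hq.mono (by omega)) _) (Finset.dvd_sum h2)
  rw [D_mu] at h3
  omega

open Classical in
lemma hl_nonneg {V : Type*} [Fintype V] (G : SimpleGraph V) {S : Finset V} {a w : V}
    (ha : a ∈ S) (hw : w ∈ S) (haw : a ≠ w) (z : ℝ) :
    0 ≤ (MP G (S.erase a) * MP G (S.erase w) - MP G S * MP G ((S.erase a).erase w)).eval z := by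
  have := heilmann_lieb (rec_eval G z) _ S rfl a ha w hw haw
  simp only [eval_sub, eval_mul]
  refine le_trans ?_ this
  split_ifs <;> positivity

open Classical in
lemma hl_adj {V : Type*} [Fintype V] (G : SimpleGraph V) {S : Finset V} {a w : V}
    (ha : a ∈ S) (hw : w ∈ S) (haw : G.Adj a w) (z : ℝ) :
    (eval z (MP G ((S.erase a).erase w))) ^ 2 ≤
      (MP G (S.erase a) * MP G (S.erase w) - MP G S * MP G ((S.erase a).erase w)).eval z := by
  have := heilmann_lieb (rec_eval G z) _ S rfl a ha w hw haw.ne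
  rw [if_pos haw] at this
  simpa only [eval_sub, eval_mul] using this

open Classical in
/-- special vertices are positive -/
lemma special_pos {V : Type*} [Fintype V] (G : SimpleGraph V) (θ : ℝ) {S : Finset V} {a w : V}
    (ha : a ∈ S) (hw : w ∈ S) (haw : G.Adj a w) (hess : mu G θ (S.erase w) + 1 = mu G θ S)
    (hne : mu G θ (S.erase a) + 1 ≠ mu G θ S) : mu G θ (S.erase a) = mu G θ S + 1 := by
  have h1 := interlace_le G θ ha
  have h2 := interlace_ge G θ ha
  by_contra hcon
  have hk : mu G θ (S.erase a) = mu G θ S := by omega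
  have hwa : w ∈ S.erase a := Finset.mem_erase.2 ⟨haw.ne', hw⟩
  have h3 := interlace_le G θ hwa
  obtain ⟨j, hj⟩ : ∃ j, mu G θ S = j + 1 := ⟨mu G θ (S.erase w), by omega⟩
  have h4 : D θ (2 * j + 1)
      (MP G (S.erase a) * MP G (S.erase w) - MP G S * MP G ((S.erase a).erase w)) :=
    (D_mu_mul.2 (by omega)).sub (D_mu_mul.2 (by omega))
  have h5 := D_of_sq_le h4 (hl_adj G ha hw haw)
  have h6 := D_even h4 (hl_nonneg G ha hw haw.ne)
  rw [D_mu] at h5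
  have h7 := h6.add (D_mu_mul.2 (show 2 * j + 2 ≤ mu G θ S + mu G θ ((S.erase a).erase w) by omega))
  rw [sub_add_cancel, D_mu_mul] at h7
  omega

open Classical in
/-- essential vertices stay essential after deleting a positive vertex -/
lemma ess_stable {V : Type*} [Fintype V] (G : SimpleGraph V) (θ : ℝ) {S : Finset V} {a w : V}
    (ha : a ∈ S) (hw : w ∈ S) (haw : a ≠ w) (hess : mu G θ (S.erase w) + 1 = mu G θ S)
    (hpos : mu G θ (S.erase a) = mu G θ S + 1) :
    mu G θ ((S.erase a).erase w) + 1 = mu G θ (S.erase a) := by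
  have h1 := interlace_le G θ (Finset.mem_erase.2 ⟨haw.symm, hw⟩ : w ∈ S.erase a)
  have h2 := interlace_ge G θ (Finset.mem_erase.2 ⟨haw, ha⟩ : a ∈ S.erase w)
  rw [Finset.erase_right_comm (a := w) (b := a)] at h2
  omega

set_option maxHeartbeats 2000000 in
open Classical in
/-- positive vertices stay positive after deleting a special vertex -/
lemma pos_stable {V : Type*} [Fintype V] (G : SimpleGraph V) (θ : ℝ) {S : Finset V} {a w u : V}
    (ha : a ∈ S) (hw : w ∈ S) (hu : u ∈ S) (hau : a ≠ u) (haw : G.Adj a w)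
    (hess : mu G θ (S.erase w) + 1 = mu G θ S)
    (hposa : mu G θ (S.erase a) = mu G θ S + 1)
    (hposu : mu G θ (S.erase u) = mu G θ S + 1) :
    mu G θ ((S.erase a).erase u) = mu G θ (S.erase a) + 1 := by
  have hwu : w ≠ u := by rintro rfl; omega
  have e1 := ess_stable G θ ha hw haw.ne hess hposa
  have e2 := ess_stable G θ hu hw hwu.symm hess hposu
  have huA : u ∈ S.erase a := Finset.mem_erase.2 ⟨hau.symm, hu⟩
  have i1 := interlace_le G θ huA
  have i2 := interlace_ge G θ huA
  have i3 := interlace_le G θ (Finset.mem_erase.2 ⟨hwu.symm, Finset.mem_erase.2 ⟨hau.symm, hu⟩⟩ :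
    u ∈ (S.erase a).erase w)
  obtain ⟨j, hj⟩ : ∃ j, mu G θ S = j + 1 := ⟨mu G θ (S.erase w), by omega⟩
  have c1 : (S.erase u).erase a = (S.erase a).erase u := Finset.erase_right_comm
  have c2 : (S.erase u).erase w = (S.erase w).erase u := Finset.erase_right_comm
  have c3 : ((S.erase u).erase a).erase w = ((S.erase a).erase w).erase u := by
    rw [c1, Finset.erase_right_comm]
  -- the triple deletion has multiplicity at least `k`
  have f1 := hl_adj G (S := S.erase u) (Finset.mem_erase.2 ⟨hau, ha⟩)
    (Finset.mem_erase.2 ⟨hwu, hw⟩) haw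
  rw [c3, c1, c2] at f1
  rw [c2] at e2
  have f2 : D θ (2 * j + 1) (MP G ((S.erase a).erase u) * MP G ((S.erase w).erase u) -
      MP G (S.erase u) * MP G (((S.erase a).erase w).erase u)) :=
    (D_mu_mul.2 (by omega)).sub (D_mu_mul.2 (by omega))
  have f3 := D_of_sq_le f2 f1
  rw [D_mu] at f3
  -- the discriminant inequality
  have hA : D θ (2 * j + 2)
      (MP G (S.erase a) * MP G (S.erase w) - MP G S * MP G ((S.erase a).erase w)) :=
    (D_mu_mul.2 (by omega)).sub (D_mu_mul.2 (by omega))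
  have hC : D θ (2 * j + 2) (MP G ((S.erase a).erase u) * MP G ((S.erase w).erase u) -
      MP G (S.erase u) * MP G (((S.erase a).erase w).erase u)) :=
    (D_mu_mul.2 (by omega)).sub (D_mu_mul.2 (by omega))
  have hAC : D θ (2 * (2 * j + 1) + 1) (C 4 *
      ((MP G ((S.erase a).erase u) * MP G ((S.erase w).erase u) -
      MP G (S.erase u) * MP G (((S.erase a).erase w).erase u)) *
      (MP G (S.erase a) * MP G (S.erase w) - MP G S * MP G ((S.erase a).erase w)))) :=
    dvd_mul_of_dvd_right (hC.mul hA (by omega)) _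
  have hB := D_of_sq_le (q := MP G ((S.erase a).erase u) * MP G (S.erase w)
      + MP G (S.erase a) * MP G ((S.erase w).erase u)
      - MP G S * MP G (((S.erase a).erase w).erase u)
      - MP G (S.erase u) * MP G ((S.erase a).erase w)) hAC (by
    intro z
    have := hl_disc (rec_eval G z) S ha hw hu haw.ne hau hwu
    simpa only [eval_sub, eval_mul, eval_add, eval_C] using this)
  have g1 : D θ (2 * j + 2) (MP G ((S.erase a).erase u) * MP G (S.erase w)) := by
    have g2 : D θ (2 * j + 2) (MP G (S.erase a) * MP G ((S.erase w).erase u)) :=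
      D_mu_mul.2 (by omega)
    have g3 : D θ (2 * j + 2) (MP G S * MP G (((S.erase a).erase w).erase u)) :=
      D_mu_mul.2 (by omega)
    have g4 : D θ (2 * j + 2) (MP G (S.erase u) * MP G ((S.erase a).erase w)) :=
      D_mu_mul.2 (by omega)
    have := ((D.add hB g4).add g3).sub g2
    convert this using 1
    ring
  rw [D_mu_mul] at g1
  -- parity
  have p1 : D θ (2 * (j + 1) + 1)
      (MP G (S.erase a) * MP G (S.erase u) - MP G S * MP G ((S.erase a).erase u)) :=
    (D_mu_mul.2 (by omega)).sub (D_mu_mul.2 (by omega))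
  have p2 := D_even p1 (hl_nonneg G ha hu hau)
  have p3 : D θ (2 * (j + 1) + 2) (MP G S * MP G ((S.erase a).erase u)) := by
    have p4 : D θ (2 * (j + 1) + 2) (MP G (S.erase a) * MP G (S.erase u)) :=
      D_mu_mul.2 (by omega)
    have := p4.sub p2
    rwa [sub_sub_cancel] at this
  rw [D_mu_mul] at p3
  omega

open Classical in
lemma main_finset {V : Type*} [Fintype V] (G : SimpleGraph V) (θ : ℝ) (T : Finset V) :
    ∀ S : Finset V, T ⊆ S →
    (∀ a ∈ T, mu G θ (S.erase a) + 1 ≠ mu G θ S ∧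
      ∃ w ∈ S, G.Adj a w ∧ mu G θ (S.erase w) + 1 = mu G θ S) →
    ∀ u ∈ S, u ∉ T → mu G θ (S.erase u) = mu G θ S + 1 →
    mu G θ ((S \ T).erase u) = mu G θ (S \ T) + 1 := by
  induction T using Finset.induction_on with
  | empty => intro S _ _ u _ _ h; simpa using h
  | insert a T haT ih =>
    intro S hTS hsp u hu huT hpos
    have ha : a ∈ S := hTS (by simp)
    obtain ⟨hane, w, hw, haw, hess⟩ := hsp a (by simp)
    have hposa := special_pos G θ ha hw haw hess hane
    have hua : u ≠ a := by rintro rfl; simp at huT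
    have hset : S \ insert a T = S.erase a \ T := by
      ext v; simp only [Finset.mem_sdiff, Finset.mem_insert, Finset.mem_erase]
      exact ⟨fun ⟨h1, h2⟩ => ⟨⟨fun h => h2 (Or.inl h), h1⟩, fun h => h2 (Or.inr h)⟩,
        fun ⟨⟨h1, h2⟩, h3⟩ => ⟨h2, fun h => h.elim h1 h3⟩⟩
    rw [hset]
    apply ih
    · intro v hv
      rw [Finset.mem_erase]
      exact ⟨fun h => haT (h ▸ hv), hTS (by simp [hv])⟩
    · intro b hb
      have hbS : b ∈ S := hTS (by simp [hb])
      have hba : b ≠ a := fun h => haT (h ▸ hb)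
      obtain ⟨hbne, w', hw', hbw, hess'⟩ := hsp b (by simp [hb])
      have hposb := special_pos G θ hbS hw' hbw hess' hbne
      have hbp := pos_stable G θ ha hw hbS hba.symm haw hess hposa hposb
      have hw'a : w' ≠ a := by rintro rfl; exact hane hess'
      refine ⟨by omega, w', Finset.mem_erase.2 ⟨hw'a, hw'⟩, hbw, ?_⟩
      exact ess_stable G θ ha hw' hw'a.symm hess' hposa
    · exact Finset.mem_erase.2 ⟨hua, hu⟩
    · intro h; exact huT (by simp [h])
    · exact pos_stable G θ ha hw hu hua.symm haw hess hposa hpos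

end MatchAux

theorem positive_stable_under_deleting_special {V : Type*} [Finite V] (θ : ℝ)
    (G : SimpleGraph V) (A : Set V) (hA : ∀ a ∈ A, IsSpecial θ G a)
    (u : V) (hu : u ∉ A) (hpos : IsPositive θ G u) :
    IsPositive θ (G.induce Aᶜ) ⟨u, hu⟩ := by
  classical
  let _ : Fintype V := Fintype.ofFinite V
  have m0 : matchMult θ G = MatchAux.mu G θ Finset.univ := by
    unfold matchMult MatchAux.mu
    rw [MatchAux.matchingPolynomial_eq G G id Function.injective_id (by simp) Finset.univ (by simp)]
  have m1 : ∀ v, matchMult θ (G.induce {x | x ≠ v}) = MatchAux.mu G θ (Finset.univ.erase v) := by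
    intro v
    unfold matchMult MatchAux.mu
    rw [MatchAux.matchingPolynomial_eq G _ Subtype.val Subtype.val_injective (by simp)
      (Finset.univ.erase v) (by simp)]
  have m2 : matchMult θ (G.induce Aᶜ) = MatchAux.mu G θ (Finset.univ \ A.toFinset) := by
    unfold matchMult MatchAux.mu
    rw [MatchAux.matchingPolynomial_eq G _ Subtype.val Subtype.val_injective (by simp)
      (Finset.univ \ A.toFinset) (by simp)]
  have m3 : matchMult θ ((G.induce Aᶜ).induce {v | v ≠ ⟨u, hu⟩}) =
      MatchAux.mu G θ ((Finset.univ \ A.toFinset).erase u) := by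
    unfold matchMult MatchAux.mu
    rw [MatchAux.matchingPolynomial_eq G _ (fun x => x.1.1)
      (Subtype.val_injective.comp Subtype.val_injective) (by simp)
      ((Finset.univ \ A.toFinset).erase u) (by
        intro v
        simp [and_comm])]
  unfold IsPositive at hpos ⊢
  unfold IsSpecial IsEssential at hA
  rw [m2, m3]
  rw [m0, m1] at hpos
  simp only [m0, m1] at hA
  apply MatchAux.main_finset G θ A.toFinset Finset.univ (Finset.subset_univ _) _ u
    (Finset.mem_univ _) (by simpa using hu) hpos
  intro a ha
  obtain ⟨h1, w, h2, h3⟩ := hA a (by simpa using ha)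
  exact ⟨h1, w, Finset.mem_univ _, h2, h3⟩
end
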